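/- Let n ≥ 1, Q = 2n+2, and let u : ℍⁿ → ℝ be a positive smooth solution of −Δ_H u = u^{(Q+2)/(Q−2)} on ℍⁿ. Fix β ∈ ℝ, ξ₀ ∈ ℍⁿ, and define λ̲(ξ₀) := sup{ μ > 0 : u(ζ) ≤ u_{ξ₀,λ}^β(ζ) for all ζ ∈ B_λ(ξ₀) ∖ {ξ₀} and all λ ∈ (0,μ) }. If λ̲(ξ₀) < ∞, then u_{ξ₀,λ̲(ξ₀)}^β(ζ) = u(ζ) for all ζ ∈ ℍⁿ ∖ {ξ₀}. -/

import Mathlib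

open Complex Filter Topology MeasureTheory

noncomputable section

/-- The Heisenberg group ℍⁿ as ℂⁿ × ℝ. -/
abbrev Heis (n : ℕ) := (Fin n → ℂ) × ℝ

namespace Heis

variable {n : ℕ}

/-- Hermitian inner product ⟨z,z'⟩ = Σ_j z_j conj(z'_j). -/
def hermInner (z w : Fin n → ℂ) : ℂ := ∑ j, z j * (starRingEnd ℂ) (w j)

/-- Squared Euclidean norm |z|² = Σ_j |z_j|². -/
def nsq (z : Fin n → ℂ) : ℝ := ∑ j, Complex.normSq (z j)

/-- Group law (z,t)·(z',t') = (z+z', t+t'+2 Im⟨z,z'⟩). -/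
def hmul (a b : Heis n) : Heis n :=
  (a.1 + b.1, a.2 + b.2 + 2 * (hermInner a.1 b.1).im)

/-- Group inverse: ζ⁻¹ = −ζ. -/
def hinv (a : Heis n) : Heis n := (-a.1, -a.2)

/-- Korányi norm |(z,t)|_H = (|z|⁴ + t²)^{1/4}. -/
def korNorm (a : Heis n) : ℝ := ((nsq a.1) ^ 2 + a.2 ^ 2) ^ ((1 : ℝ)/4)

/-- Korányi distance d_H(ξ,ζ) = |ζ⁻¹·ξ|_H. -/
def dH (a b : Heis n) : ℝ := korNorm (hmul (hinv b) a)

/-- Open Korányi ball B_λ(ξ). -/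
def ball (ξ : Heis n) (lam : ℝ) : Set (Heis n) := {ζ | dH ξ ζ < lam}

/-- Left translation τ_ξ. -/
def tau (ξ ζ : Heis n) : Heis n := hmul ξ ζ

/-- Dilation δ_λ(z,t) = (λz, λ²t). -/
def dil (lam : ℝ) (a : Heis n) : Heis n := (fun j => (lam : ℂ) * a.1 j, lam ^ 2 * a.2)

/-- Rotation ρ_M(z,t) = (Mz,t). -/
def rot (M : Matrix (Fin n) (Fin n) ℂ) (a : Heis n) : Heis n := (M.mulVec a.1, a.2)

/-- Inversion ι(z,t) = (conj z, −t). -/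
def iota (a : Heis n) : Heis n := (fun j => (starRingEnd ℂ) (a.1 j), -a.2)

/-- w = t + i|z|². -/
def wC (a : Heis n) : ℂ := (a.2 : ℂ) + Complex.I * ((nsq a.1 : ℝ) : ℂ)

/-- CR inversion 𝒥(z,t) = (z/w, −t/|w|²). -/
def crInv (a : Heis n) : Heis n :=
  (fun j => a.1 j / wC a, -a.2 / Complex.normSq (wC a))

/-- Angles θ_k for the rotation matrix M_{ξ,β}. -/
def theta (ξ : Heis n) (β : ℝ) (k : Fin n) : ℝ :=
  if ξ.1 k ≠ 0 then 2 * (ξ.1 k).arg + (wC ξ + Complex.I * (β : ℂ)).arg else 0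

/-- The unitary diagonal matrix M_{ξ,β} = diag(e^{iθ₁},…,e^{iθₙ}). -/
def Mmat (ξ : Heis n) (β : ℝ) : Matrix (Fin n) (Fin n) ℂ :=
  Matrix.diagonal fun k => Complex.exp (Complex.I * ((theta ξ β k : ℝ) : ℂ))

/-- Generalized CR inversion Φ_{ξ,λ}^β = τ_ξ ∘ ρ_{M_{ξ,β}} ∘ δ_{λ²} ∘ 𝒥 ∘ ι ∘ τ_ξ⁻¹. -/
def Phi (ξ : Heis n) (lam β : ℝ) (ζ : Heis n) : Heis n :=
  tau ξ (rot (Mmat ξ β) (dil (lam ^ 2) (crInv (iota (hmul (hinv ξ) ζ)))))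

/-- Direction of the vector field X_j at p. -/
def XVec (j : Fin n) (p : Heis n) : Heis n := (Pi.single j (1 : ℂ), 2 * (p.1 j).im)

/-- Direction of the vector field Y_j at p. -/
def YVec (j : Fin n) (p : Heis n) : Heis n := (Pi.single j Complex.I, -2 * (p.1 j).re)

/-- The vector field X_j acting on functions. -/
def Xop (j : Fin n) (u : Heis n → ℝ) (p : Heis n) : ℝ := fderiv ℝ u p (XVec j p)

/-- The vector field Y_j acting on functions. -/
def Yop (j : Fin n) (u : Heis n → ℝ) (p : Heis n) : ℝ := fderiv ℝ u p (YVec j p)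

/-- Sub-Laplacian Δ_H = Σ_j (X_j² + Y_j²). -/
def subLap (u : Heis n → ℝ) (p : Heis n) : ℝ :=
  ∑ j, (Xop j (Xop j u) p + Yop j (Yop j u) p)

/-- Squared length of the horizontal gradient |∇_H u|² = Σ_j ((X_j u)² + (Y_j u)²). -/
def gradHSq (u : Heis n → ℝ) (p : Heis n) : ℝ :=
  ∑ j, ((Xop j u p) ^ 2 + (Yop j u p) ^ 2)

/-- Generalized Kelvin transform u_{ξ,λ}^β(η) = (λ/d_H(η,ξ))^{Q−2} u(Φ_{ξ,λ}^β(η)), Q−2 = 2n. -/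
def kelvin (u : Heis n → ℝ) (ξ : Heis n) (lam β : ℝ) (η : Heis n) : ℝ :=
  (lam / dH η ξ) ^ (2 * n) * u (Phi ξ lam β η)

/-- The filter |ζ|_H → ∞ on ℍⁿ. -/
def atInftyH (n : ℕ) : Filter (Heis n) := Filter.comap korNorm Filter.atTop

end Heis

open Heis

section

/-! ## 2-jets of curves -/

section Jets
variable {F G : Type*} [NormedAddCommGroup F] [NormedSpace ℝ F] [NormedAddCommGroup G]
  [NormedSpace ℝ G]

/-- `h` has second order jet `(a,b,c)` at `0`. -/
def J2 (h : ℝ → F) (a b c : F) : Prop :=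
  h 0 = a ∧ ∃ h' : ℝ → F, h' 0 = b ∧ (∀ᶠ ε in 𝓝 (0:ℝ), HasDerivAt h (h' ε) ε) ∧ HasDerivAt h' c 0

theorem J2.unique {h : ℝ → F} {a b c a' b' c' : F} (H : J2 h a b c) (H' : J2 h a' b' c') :
    a = a' ∧ b = b' ∧ c = c' := by
  obtain ⟨h0, k, k0, k1, k2⟩ := H
  obtain ⟨g0, l, l0, l1, l2⟩ := H'
  have hkl : k =ᶠ[𝓝 0] l := by
    filter_upwards [k1, l1] with x hx hy using hx.unique hy
  refine ⟨h0.symm.trans g0, ?_, ?_⟩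
  · rw [← k0, ← l0]; exact hkl.self_of_nhds
  · exact k2.unique (l2.congr_of_eventuallyEq hkl)

theorem J2.congr {h g : ℝ → F} {a b c : F} (H : J2 h a b c) (hg : g =ᶠ[𝓝 0] h) :
    J2 g a b c := by
  obtain ⟨h0, k, k0, k1, k2⟩ := H
  refine ⟨by rw [hg.self_of_nhds, h0], k, k0, ?_, k2⟩
  filter_upwards [k1, hg.eventuallyEq_nhds] with x hx hy using hx.congr_of_eventuallyEq hy

theorem J2.cast {h : ℝ → F} {a b c a' b' c' : F} (H : J2 h a b c) (ha : a = a') (hb : b = b')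
    (hc : c = c') : J2 h a' b' c' := by subst ha hb hc; exact H

theorem J2.const (a : F) : J2 (fun _ => a) a 0 0 :=
  ⟨rfl, fun _ => 0, rfl, Eventually.of_forall fun x => hasDerivAt_const x a, hasDerivAt_const 0 _⟩

theorem J2.line (a b : F) : J2 (fun ε : ℝ => a + ε • b) a b 0 :=
  ⟨by simp, fun _ => b, rfl, Eventually.of_forall fun x => by
    simpa using ((hasDerivAt_id x).smul_const b).const_add a, hasDerivAt_const 0 _⟩

theorem J2.quad (a b c : F) : J2 (fun ε : ℝ => a + ε • b + (ε^2/2) • c) a b c := by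
  refine ⟨by simp, fun ε => b + ε • c, by simp, Eventually.of_forall fun x => ?_, ?_⟩
  · have h1 := ((hasDerivAt_id x).smul_const b).const_add a
    have h2 := (((hasDerivAt_id x).pow 2).div_const 2).smul_const c
    refine (h1.add h2).congr_deriv ?_
    simp
  · simpa using ((hasDerivAt_id (0:ℝ)).smul_const c).const_add b

theorem J2.add {h g : ℝ → F} {a b c a' b' c' : F} (H : J2 h a b c) (H' : J2 g a' b' c') :
    J2 (fun ε => h ε + g ε) (a + a') (b + b') (c + c') := by
  obtain ⟨h0, k, k0, k1, k2⟩ := H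
  obtain ⟨g0, l, l0, l1, l2⟩ := H'
  refine ⟨by simp [h0, g0], fun ε => k ε + l ε, by simp [k0, l0], ?_, k2.add l2⟩
  filter_upwards [k1, l1] with x hx hy using hx.add hy

theorem J2.clm (L : F →L[ℝ] G) {h : ℝ → F} {a b c : F} (H : J2 h a b c) :
    J2 (fun ε => L (h ε)) (L a) (L b) (L c) := by
  obtain ⟨h0, k, k0, k1, k2⟩ := H
  refine ⟨by simp [h0], fun ε => L (k ε), by simp [k0], ?_, L.hasFDerivAt.comp_hasDerivAt 0 k2⟩
  filter_upwards [k1] with x hx using L.hasFDerivAt.comp_hasDerivAt x hx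

theorem J2.prodMk {h : ℝ → F} {g : ℝ → G} {a b c : F} {a' b' c' : G} (H : J2 h a b c)
    (H' : J2 g a' b' c') : J2 (fun ε => (h ε, g ε)) (a, a') (b, b') (c, c') := by
  obtain ⟨h0, k, k0, k1, k2⟩ := H
  obtain ⟨g0, l, l0, l1, l2⟩ := H'
  refine ⟨by simp [h0, g0], fun ε => (k ε, l ε), by simp [k0, l0], ?_, k2.prodMk l2⟩
  filter_upwards [k1, l1] with x hx hy using hx.prodMk hy

theorem J2.pi {ι : Type*} [Fintype ι] {h : ℝ → ι → F} {a b c : ι → F}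
    (H : ∀ i, J2 (fun ε => h ε i) (a i) (b i) (c i)) : J2 h a b c := by
  choose h0 k k0 k1 k2 using H
  refine ⟨funext h0, fun ε i => k i ε, funext k0, ?_, hasDerivAt_pi.2 k2⟩
  filter_upwards [eventually_all.2 k1] with x hx using hasDerivAt_pi.2 hx

theorem J2.mul {𝔸 : Type*} [NormedCommRing 𝔸] [NormedAlgebra ℝ 𝔸] {h g : ℝ → 𝔸}
    {a b c a' b' c' : 𝔸} (H : J2 h a b c) (H' : J2 g a' b' c') :
    J2 (fun ε => h ε * g ε) (a * a') (b * a' + a * b') (c * a' + 2 * b * b' + a * c') := by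
  obtain ⟨h0, k, k0, k1, k2⟩ := H
  obtain ⟨g0, l, l0, l1, l2⟩ := H'
  refine ⟨by simp [h0, g0], fun ε => k ε * g ε + h ε * l ε, by simp [h0, g0, k0, l0], ?_, ?_⟩
  · filter_upwards [k1, l1] with x hx hy using hx.mul hy
  · have := (k2.mul l1.self_of_nhds).add (k1.self_of_nhds.mul l2)
    refine this.congr_deriv ?_
    simp only [h0, g0, k0, l0]; ring

theorem J2.inv {h : ℝ → ℂ} {a b c : ℂ} (H : J2 h a b c) (ha : a ≠ 0) :
    J2 (fun ε => (h ε)⁻¹) a⁻¹ (-b / a ^ 2) (2 * b ^ 2 / a ^ 3 - c / a ^ 2) := by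
  obtain ⟨h0, k, k0, k1, k2⟩ := H
  have hd := k1.self_of_nhds
  have hne : ∀ᶠ ε in 𝓝 (0:ℝ), h ε ≠ 0 :=
    hd.continuousAt.eventually_ne (by rwa [h0])
  refine ⟨by simp [h0], fun ε => - k ε / (h ε) ^ 2, by simp [h0, k0], ?_, ?_⟩
  · filter_upwards [k1, hne] with x hx hy using hx.inv hy
  · have := (k2.neg).div (hd.pow 2) (by simp [h0, ha])
    refine this.congr_deriv ?_
    simp [h0, k0]; field_simp; ring

theorem J2.comp_real {φ φ' : ℝ → ℝ} {φ'' : ℝ} {h : ℝ → ℝ} {a b c : ℝ} (H : J2 h a b c)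
    (hφ : ∀ᶠ x in 𝓝 a, HasDerivAt φ (φ' x) x) (hφ' : HasDerivAt φ' φ'' a) :
    J2 (fun ε => φ (h ε)) (φ a) (φ' a * b) (φ'' * b ^ 2 + φ' a * c) := by
  obtain ⟨h0, k, k0, k1, k2⟩ := H
  subst h0
  have hd := k1.self_of_nhds
  refine ⟨rfl, fun ε => φ' (h ε) * k ε, by simp [k0], ?_, ?_⟩
  · filter_upwards [k1, hd.continuousAt.eventually hφ] with x hx hy using hy.comp x hx
  · have := (hφ'.comp 0 hd).mul k2
    refine this.congr_deriv ?_
    simp [k0]; ring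

/-- second derivative -/
def D2 (f : F → ℝ) (p : F) : F →L[ℝ] F →L[ℝ] ℝ := fderiv ℝ (fderiv ℝ f) p

theorem J2.comp {f : F → ℝ} {γ : ℝ → F} {a b c : F} (H : J2 γ a b c) (hf : ContDiffAt ℝ 2 f a) :
    J2 (fun ε => f (γ ε)) (f a) (fderiv ℝ f a b) (D2 f a b b + fderiv ℝ f a c) := by
  obtain ⟨h0, k, k0, k1, k2⟩ := H
  subst h0
  have hd := k1.self_of_nhds
  refine ⟨rfl, fun ε => fderiv ℝ f (γ ε) (k ε), by simp [k0], ?_, ?_⟩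
  · have : ∀ᶠ x in 𝓝 (γ 0), DifferentiableAt ℝ f x := by
      filter_upwards [hf.eventually (by simp)] with x hx using hx.differentiableAt (by simp)
    filter_upwards [k1, hd.continuousAt.eventually this] with x hx hy
      using hy.hasFDerivAt.comp_hasDerivAt x hx
  · have h2 : DifferentiableAt ℝ (fderiv ℝ f) (γ 0) :=
      (hf.fderiv_right (m := 1) (by norm_num)).differentiableAt (by simp)
    have := (h2.hasFDerivAt.comp_hasDerivAt (0:ℝ) hd).clm_apply k2
    refine this.congr_deriv ?_
    simp [k0, D2]

theorem D2_symm {f : F → ℝ} {p : F} (hf : ContDiffAt ℝ 2 f p) (v w : F) :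
    D2 f p v w = D2 f p w v := by
  have := hf.isSymmSndFDerivAt (by simp)
  exact this v w

end Jets

/-! ## the sub-Laplacian through 2-jets -/
variable {n : ℕ}

def hv (p : Heis n) (j : Fin n) (c : ℂ) : Heis n :=
  (Pi.single j c, 2 * (p.1 j * (starRingEnd ℂ) c).im)

theorem XVec_eq (p : Heis n) (j : Fin n) : XVec j p = hv p j 1 := by
  simp [XVec, hv]
theorem YVec_eq (p : Heis n) (j : Fin n) : YVec j p = hv p j I := by
  simp [YVec, hv]

theorem fderiv_field {f : Heis n → ℝ} {p : Heis n} (hf : ContDiffAt ℝ 2 f p)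
    {V : Heis n → Heis n} {V' : Heis n →L[ℝ] Heis n} (hV : HasFDerivAt V V' p) (x : Heis n) :
    fderiv ℝ (fun q => fderiv ℝ f q (V q)) p x = D2 f p x (V p) + fderiv ℝ f p (V' x) := by
  have h2 : DifferentiableAt ℝ (fderiv ℝ f) p :=
    (hf.fderiv_right (m := 1) (by norm_num)).differentiableAt (by simp)
  have := (h2.hasFDerivAt.clm_apply hV).fderiv
  rw [this]; simp [D2, add_comm]

theorem hasFDerivAt_XVec (j : Fin n) (p : Heis n) :
    HasFDerivAt (XVec j) ((0 : Heis n →L[ℝ] (Fin n → ℂ)).prod ((2:ℝ) • (imCLM.comp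
      ((ContinuousLinearMap.proj j).comp (ContinuousLinearMap.fst ℝ (Fin n → ℂ) ℝ))))) p := by
  unfold XVec
  refine (hasFDerivAt_const _ _).prodMk ?_
  have := (imCLM.comp ((ContinuousLinearMap.proj (R := ℝ) (φ := fun _ : Fin n => ℂ) j).comp
    (ContinuousLinearMap.fst ℝ (Fin n → ℂ) ℝ))).hasFDerivAt (x := p)
  exact this.const_mul 2

theorem hasFDerivAt_YVec (j : Fin n) (p : Heis n) :
    HasFDerivAt (YVec j) ((0 : Heis n →L[ℝ] (Fin n → ℂ)).prod ((-2:ℝ) • (reCLM.comp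
      ((ContinuousLinearMap.proj j).comp (ContinuousLinearMap.fst ℝ (Fin n → ℂ) ℝ))))) p := by
  unfold YVec
  refine (hasFDerivAt_const _ _).prodMk ?_
  have := (reCLM.comp ((ContinuousLinearMap.proj (R := ℝ) (φ := fun _ : Fin n => ℂ) j).comp
    (ContinuousLinearMap.fst ℝ (Fin n → ℂ) ℝ))).hasFDerivAt (x := p)
  exact this.const_mul (-2)

theorem Xop_Xop {f : Heis n → ℝ} {p : Heis n} (hf : ContDiffAt ℝ 2 f p) (j : Fin n) :
    Xop j (Xop j f) p = D2 f p (hv p j 1) (hv p j 1) := by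
  have := fderiv_field hf (hasFDerivAt_XVec j p) (XVec j p)
  unfold Xop
  rw [this, ← XVec_eq]
  simp only [add_eq_left]
  convert (fderiv ℝ f p).map_zero
  ext <;> simp [XVec]

theorem Yop_Yop {f : Heis n → ℝ} {p : Heis n} (hf : ContDiffAt ℝ 2 f p) (j : Fin n) :
    Yop j (Yop j f) p = D2 f p (hv p j I) (hv p j I) := by
  have := fderiv_field hf (hasFDerivAt_YVec j p) (YVec j p)
  unfold Yop
  rw [this, ← YVec_eq]
  simp only [add_eq_left]
  convert (fderiv ℝ f p).map_zero
  ext <;> simp [YVec]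

theorem subLap_eq {f : Heis n → ℝ} {p : Heis n} (hf : ContDiffAt ℝ 2 f p) :
    subLap f p = ∑ j, (D2 f p (hv p j 1) (hv p j 1) + D2 f p (hv p j I) (hv p j I)) := by
  unfold subLap
  exact Finset.sum_congr rfl fun j _ => by rw [Xop_Xop hf, Yop_Yop hf]

theorem D2_line {f : Heis n → ℝ} {p v : Heis n} (hf : ContDiffAt ℝ 2 f p) {a b c : ℝ}
    (h : J2 (fun ε : ℝ => f (p + ε • v)) a b c) : D2 f p v v = c := by
  have := (J2.comp (J2.line p v) hf).unique h
  simpa using this.2.2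

theorem subLap_jets {f : Heis n → ℝ} {p : Heis n} (hf : ContDiffAt ℝ 2 f p)
    {a b c : Fin n → ℂ → ℝ}
    (h : ∀ j x, J2 (fun ε : ℝ => f (p + ε • hv p j x)) (a j x) (b j x) (c j x)) :
    subLap f p = ∑ j, (c j 1 + c j I) := by
  rw [subLap_eq hf]
  exact Finset.sum_congr rfl fun j _ => by rw [D2_line hf (h j 1), D2_line hf (h j I)]

theorem subLap_congr {f g : Heis n → ℝ} {p : Heis n} (h : f =ᶠ[𝓝 p] g) :
    subLap f p = subLap g p := by
  unfold subLap
  have h1 : ∀ j, Xop j f =ᶠ[𝓝 p] Xop j g := fun j => by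
    filter_upwards [h.fderiv (𝕜 := ℝ)] with q hq
    simp [Xop, hq]
  have h2 : ∀ j, Yop j f =ᶠ[𝓝 p] Yop j g := fun j => by
    filter_upwards [h.fderiv (𝕜 := ℝ)] with q hq
    simp [Yop, hq]
  refine Finset.sum_congr rfl fun j _ => ?_
  rw [Xop, Xop, (h1 j).fderiv_eq, Yop, Yop, (h2 j).fderiv_eq]

end

section
variable {n : ℕ}

/-! ## basic facts on w -/
theorem nsq_nonneg (z : Fin n → ℂ) : 0 ≤ nsq z := Finset.sum_nonneg fun _ _ => normSq_nonneg _

theorem nsq_eq_zero {z : Fin n → ℂ} : nsq z = 0 ↔ z = 0 := by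
  unfold nsq
  rw [Finset.sum_eq_zero_iff_of_nonneg fun _ _ => normSq_nonneg _]
  simp [funext_iff]

@[simp] theorem wC_re (p : Heis n) : (wC p).re = p.2 := by simp [wC]
@[simp] theorem wC_im (p : Heis n) : (wC p).im = nsq p.1 := by simp [wC]

theorem wC_eq_zero {p : Heis n} : wC p = 0 ↔ p = 0 := by
  rw [Complex.ext_iff, wC_re, wC_im, Prod.ext_iff]
  simp [nsq_eq_zero, and_comm]

theorem wC_ne {p : Heis n} (hp : p ≠ 0) : wC p ≠ 0 := mt wC_eq_zero.1 hp

theorem contDiff_nsq {k : WithTop ℕ∞} : ContDiff ℝ k (nsq : (Fin n → ℂ) → ℝ) := by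
  unfold nsq
  refine ContDiff.sum fun j _ => ?_
  have h : ContDiff ℝ k (fun z : Fin n → ℂ => z j) := contDiff_apply ℝ ℂ j
  have h1 := reCLM.contDiff.comp h (n := k)
  have h2 := imCLM.contDiff.comp h (n := k)
  exact (h1.mul h1).add (h2.mul h2)

theorem contDiff_wC {k : WithTop ℕ∞} : ContDiff ℝ k (wC : Heis n → ℂ) := by
  unfold wC
  have h1 : ContDiff ℝ k (fun p : Heis n => (p.2 : ℂ)) := ofRealCLM.contDiff.comp contDiff_snd
  have h2 : ContDiff ℝ k (fun p : Heis n => ((nsq p.1 : ℝ) : ℂ)) :=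
    ofRealCLM.contDiff.comp (contDiff_nsq.comp contDiff_fst)
  exact h1.add (contDiff_const.mul h2)

theorem nsq_add_single (z : Fin n → ℂ) (j : Fin n) (c : ℂ) :
    nsq (z + Pi.single j c) = nsq z + 2 * (z j * (starRingEnd ℂ) c).re + normSq c := by
  unfold nsq
  rw [← Finset.add_sum_erase _ _ (Finset.mem_univ j),
    ← Finset.add_sum_erase (f := fun k => normSq (z k)) _ (Finset.mem_univ j)]
  have : ∑ x ∈ Finset.univ.erase j, normSq ((z + Pi.single j c : Fin n → ℂ) x)
      = ∑ x ∈ Finset.univ.erase j, normSq (z x) :=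
    Finset.sum_congr rfl fun x hx => by simp [Finset.ne_of_mem_erase hx]
  rw [this]
  simp [normSq_add]
  ring

theorem wC_line (p : Heis n) (j : Fin n) (c : ℂ) (ε : ℝ) :
    wC (p + ε • hv p j c) = wC p + ε • (2 * I * ((starRingEnd ℂ) (p.1 j) * c))
      + (ε ^ 2 / 2) • (2 * I * (normSq c : ℂ)) := by
  have h1 : (p + ε • hv p j c).1 = p.1 + Pi.single j (ε • c) := by
    simp only [hv, Prod.fst_add, Prod.smul_fst, Pi.single_smul]
  apply Complex.ext
  · rw [wC_re]
    simp [hv, -Complex.ofReal_pow, ← Complex.ofReal_pow]; ring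
  · rw [wC_im, h1, nsq_add_single]
    simp [normSq_apply, -Complex.ofReal_pow, ← Complex.ofReal_pow]; ring

theorem J2_wC (p : Heis n) (j : Fin n) (c : ℂ) :
    J2 (fun ε : ℝ => wC (p + ε • hv p j c)) (wC p) (2 * I * ((starRingEnd ℂ) (p.1 j) * c))
      (2 * I * (normSq c : ℂ)) :=
  (J2.quad _ _ _).congr (Eventually.of_forall fun ε => wC_line p j c ε)

theorem J2_conj {h : ℝ → ℂ} {a b c : ℂ} (H : J2 h a b c) :
    J2 (fun ε => (starRingEnd ℂ) (h ε)) ((starRingEnd ℂ) a) ((starRingEnd ℂ) b)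
      ((starRingEnd ℂ) c) := J2.clm (F := ℂ) (G := ℂ) conjCLE.toContinuousLinearMap H

theorem J2_normSq {h : ℝ → ℂ} {a b c : ℂ} (H : J2 h a b c) :
    J2 (fun ε => normSq (h ε)) (normSq a) (2 * ((starRingEnd ℂ) a * b).re)
      (2 * normSq b + 2 * ((starRingEnd ℂ) a * c).re) := by
  have := J2.clm reCLM (H.mul (J2_conj H))
  refine (this.congr (Eventually.of_forall fun ε => ?_)).cast ?_ ?_ ?_
  · simp [normSq_apply]
  · simp [normSq_apply]
  · simp; ring
  · simp [normSq_apply]; ring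

/-- `|w|^{-n}` times L^n. -/
def rho (n : ℕ) (L : ℝ) (N : ℝ) : ℝ := L ^ n * N ^ (-(n:ℝ)/2)

theorem rho_eq {L : ℝ} (w : ℂ) : rho n L (normSq w) = (L / ‖w‖) ^ n := by
  unfold rho
  rw [normSq_eq_norm_sq, div_pow, div_eq_mul_inv]
  congr 1
  rw [← Real.rpow_natCast _ 2, ← Real.rpow_mul (norm_nonneg _), ← Real.rpow_natCast,
    ← Real.rpow_neg (norm_nonneg _)]
  congr 1; push_cast; ring

theorem rho_jet (n : ℕ) (L : ℝ) {h : ℝ → ℝ} {a b c : ℝ} (H : J2 h a b c) (ha : 0 < a) :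
    J2 (fun ε => rho n L (h ε)) (rho n L a) (-(n:ℝ)/2 * rho n L a / a * b)
      ((n:ℝ)/2 * ((n:ℝ)/2 + 1) * rho n L a / a^2 * b^2 + -(n:ℝ)/2 * rho n L a / a * c) := by
  have hd : ∀ s : ℝ, ∀ x : ℝ, 0 < x → HasDerivAt (fun y : ℝ => y ^ s) (s * x ^ (s - 1)) x :=
    fun s x hx => Real.hasDerivAt_rpow_const (Or.inl hx.ne')
  have := J2.comp_real (φ := fun x => rho n L x)
    (φ' := fun x => L ^ n * (-(n:ℝ)/2 * x ^ (-(n:ℝ)/2 - 1)))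
    (φ'' := L ^ n * (-(n:ℝ)/2 * ((-(n:ℝ)/2 - 1) * a ^ (-(n:ℝ)/2 - 1 - 1)))) H ?_ ?_
  · refine this.cast rfl ?_ ?_
    · simp only [rho]; rw [Real.rpow_sub_one ha.ne']; ring
    · simp only [rho]; rw [Real.rpow_sub_one ha.ne', Real.rpow_sub_one ha.ne']; field_simp; ring
  · filter_upwards [lt_mem_nhds ha] with x hx using (hd _ x hx).const_mul _
  · exact ((hd _ a ha).const_mul _).const_mul _

/-- horizontal lift at `q` of `g`. -/
def hl (q : Heis n) : (Fin n → ℂ) →L[ℝ] Heis n :=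
  LinearMap.toContinuousLinearMap
  { toFun := fun g => (g, 2 * (hermInner q.1 g).im)
    map_add' := fun g h => by
      ext <;> simp [hermInner, mul_add, Finset.sum_add_distrib]
    map_smul' := fun r g => by
      ext
      · simp
      · simp [Finset.mul_sum, hermInner]
        refine Finset.sum_congr rfl fun x _ => ?_
        ring }

theorem hl_apply (q : Heis n) (g : Fin n → ℂ) : hl q g = (g, 2 * (hermInner q.1 g).im) := rfl

theorem hl_single (q : Heis n) (j : Fin n) (c : ℂ) : hl q (Pi.single j c) = hv q j c := by
  have : hermInner q.1 (Pi.single j c) = q.1 j * (starRingEnd ℂ) c := by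
    unfold hermInner
    rw [Finset.sum_eq_single j] <;> simp +contextual [Pi.single_apply]
  rw [hl_apply, hv, this]

theorem vec_expand (g : Fin n → ℂ) :
    g = ∑ k, ((g k).re • (Pi.single k 1 : Fin n → ℂ) + (g k).im • (Pi.single k I : Fin n → ℂ)) := by
  ext j
  simp only [Finset.sum_apply, Pi.add_apply, Pi.smul_apply]
  rw [Finset.sum_eq_single j]
  · simp
  · intro b _ hb; simp [Pi.single_apply, hb.symm]
  · simp

theorem bil_expand (B : (Fin n → ℂ) →L[ℝ] (Fin n → ℂ) →L[ℝ] ℝ) (g : Fin n → ℂ) :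
    B g g = ∑ k, ∑ l, ((g k).re * (g l).re * B (Pi.single k 1) (Pi.single l 1)
      + (g k).re * (g l).im * B (Pi.single k 1) (Pi.single l I)
      + (g k).im * (g l).re * B (Pi.single k I) (Pi.single l 1)
      + (g k).im * (g l).im * B (Pi.single k I) (Pi.single l I)) := by
  have h1 : ∀ L : (Fin n → ℂ) →L[ℝ] ℝ, L g = ∑ l, ((g l).re * L (Pi.single l 1)
      + (g l).im * L (Pi.single l I)) := fun L => by
    conv_lhs => rw [vec_expand g]
    simp
  rw [h1 (B g)]
  have h2 : ∀ v, B g v = ∑ k, ((g k).re * B (Pi.single k 1) v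
      + (g k).im * B (Pi.single k I) v) := fun v => h1 (B.flip v)
  simp only [h2, Finset.mul_sum]
  simp only [← Finset.sum_add_distrib]
  rw [Finset.sum_comm]
  refine Finset.sum_congr rfl fun k _ => Finset.sum_congr rfl fun l _ => ?_
  ring

theorem bil_pair (B : (Fin n → ℂ) →L[ℝ] (Fin n → ℂ) →L[ℝ] ℝ) (g : Fin n → ℂ) :
    B g g + B (I • g) (I • g) = ∑ k, ∑ l, (
      (g k * (starRingEnd ℂ) (g l)).re * (B (Pi.single k 1) (Pi.single l 1)
        + B (Pi.single k I) (Pi.single l I))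
      - (g k * (starRingEnd ℂ) (g l)).im * (B (Pi.single k 1) (Pi.single l I)
        - B (Pi.single k I) (Pi.single l 1))) := by
  rw [bil_expand B g, bil_expand B (I • g)]
  simp only [← Finset.sum_add_distrib]
  refine Finset.sum_congr rfl fun k _ => Finset.sum_congr rfl fun l _ => ?_
  simp
  ring

theorem bil_unitary (B : (Fin n → ℂ) →L[ℝ] (Fin n → ℂ) →L[ℝ] ℝ) (a : Fin n → Fin n → ℂ) (μ : ℝ)
    (ha : ∀ k l, ∑ j, a j k * (starRingEnd ℂ) (a j l) = if k = l then (μ : ℂ) else 0) :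
    ∑ j, (B (a j) (a j) + B (I • a j) (I • a j)) =
      μ * ∑ k, (B (Pi.single k 1) (Pi.single k 1) + B (Pi.single k I) (Pi.single k I)) := by
  simp only [bil_pair]
  rw [Finset.sum_comm, Finset.mul_sum]
  refine Finset.sum_congr rfl fun k _ => ?_
  rw [Finset.sum_comm]
  simp only [Finset.sum_sub_distrib, ← Finset.sum_mul]
  have hre : ∀ l, ∑ j, (a j k * (starRingEnd ℂ) (a j l)).re = if k = l then μ else 0 := fun l => by
    rw [← Complex.re_sum, ha]; split_ifs <;> simp
  have him : ∀ l, ∑ j, (a j k * (starRingEnd ℂ) (a j l)).im = 0 := fun l => by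
    rw [← Complex.im_sum, ha]; split_ifs <;> simp
  simp only [hre, him]
  simp

end

section
variable {n : ℕ}

/-! ## Kelvin transform centred at the origin -/
/-- the CR inversion centred at zero. -/
def inv0 (m : Fin n → ℂ) (L : ℝ) (p : Heis n) : Heis n :=
  (fun k => -(m k) * L * ((starRingEnd ℂ) (p.1 k) * ((starRingEnd ℂ) (wC p))⁻¹),
    L ^ 2 * (((starRingEnd ℂ) (wC p))⁻¹).re)

def kel (m : Fin n → ℂ) (L : ℝ) (v : Heis n → ℝ) (p : Heis n) : ℝ :=
  rho n L (normSq (wC p)) * v (inv0 m L p)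

theorem contDiffAt_inv0 (m : Fin n → ℂ) (L : ℝ) {p : Heis n} (hp : p ≠ 0) {k : WithTop ℕ∞} :
    ContDiffAt ℝ k (inv0 m L) p := by
  have hw : ContDiffAt ℝ k (fun q : Heis n => (starRingEnd ℂ) (wC q)) p :=
    (conjCLE.toContinuousLinearMap.contDiff.comp contDiff_wC).contDiffAt
  have hwi : ContDiffAt ℝ k (fun q : Heis n => ((starRingEnd ℂ) (wC q))⁻¹) p :=
    hw.inv (by simpa using wC_ne hp)
  unfold inv0
  refine ContDiffAt.prodMk (contDiffAt_pi.2 fun j => ?_) ?_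
  · have h1 : ContDiff ℝ k (fun z : Heis n => z.1 j) := (contDiff_apply ℝ ℂ j).comp contDiff_fst
    have : ContDiffAt ℝ k (fun q : Heis n => (starRingEnd ℂ) (q.1 j)) p :=
      (conjCLE.toContinuousLinearMap.contDiff.comp h1).contDiffAt
    exact contDiffAt_const.mul (this.mul hwi)
  · exact contDiffAt_const.mul (reCLM.contDiff.contDiffAt.comp p hwi)

theorem normSq_wC_pos {p : Heis n} (hp : p ≠ 0) : 0 < normSq (wC p) := normSq_pos.2 (wC_ne hp)

theorem contDiffAt_rho (L : ℝ) {p : Heis n} (hp : p ≠ 0) {k : WithTop ℕ∞} :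
    ContDiffAt ℝ k (fun q : Heis n => rho n L (normSq (wC q))) p := by
  unfold rho
  have h : ContDiff ℝ k (fun q : Heis n => normSq (wC q)) := by
    simp only [normSq_apply, wC_re, wC_im]
    have := (contDiff_nsq (n := n) (k := k)).comp (contDiff_fst (E := Fin n → ℂ) (F := ℝ))
    exact (contDiff_snd.mul contDiff_snd).add (this.mul this)
  exact contDiffAt_const.mul (h.contDiffAt.rpow_const_of_ne (normSq_wC_pos hp).ne')

theorem contDiffAt_kel {m : Fin n → ℂ} {L : ℝ} {v : Heis n → ℝ} {p : Heis n} (hp : p ≠ 0)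
    {k : WithTop ℕ∞} (hv : ContDiffAt ℝ k v (inv0 m L p)) : ContDiffAt ℝ k (kel m L v) p :=
  (contDiffAt_rho L hp).mul (hv.comp p (contDiffAt_inv0 m L hp))

theorem hv_fst_line (p : Heis n) (j k : Fin n) (c : ℂ) (ε : ℝ) :
    (p + ε • hv p j c).1 k = p.1 k + ε • (if k = j then c else 0) := by
  simp [hv, Pi.single_apply]

theorem J2_rho (p : Heis n) (hp : p ≠ 0) (L : ℝ) (j : Fin n) (c : ℂ) :
    J2 (fun ε : ℝ => rho n L (normSq (wC (p + ε • hv p j c))))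
      (rho n L (normSq (wC p)))
      (-2 * n * rho n L (normSq (wC p)) / normSq (wC p) *
        ((starRingEnd ℂ) (wC p) * (I * ((starRingEnd ℂ) (p.1 j) * c))).re)
      (4 * n * (n + 2) * rho n L (normSq (wC p)) / (normSq (wC p))^2 *
        (((starRingEnd ℂ) (wC p) * (I * ((starRingEnd ℂ) (p.1 j) * c))).re)^2
        - n * rho n L (normSq (wC p)) / normSq (wC p)
          * (4 * normSq (p.1 j) + 2 * nsq p.1) * normSq c) := by
  have h1 := rho_jet n L (J2_normSq (J2_wC p j c)) (normSq_wC_pos hp)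
  refine h1.cast rfl ?_ ?_
  · have : ((starRingEnd ℂ) (wC p) * (2 * I * ((starRingEnd ℂ) (p.1 j) * c))).re
      = 2 * ((starRingEnd ℂ) (wC p) * (I * ((starRingEnd ℂ) (p.1 j) * c))).re := by
      rw [← re_ofReal_mul]; congr 1; push_cast; ring
    rw [this]; ring
  · have : ((starRingEnd ℂ) (wC p) * (2 * I * ((starRingEnd ℂ) (p.1 j) * c))).re
      = 2 * ((starRingEnd ℂ) (wC p) * (I * ((starRingEnd ℂ) (p.1 j) * c))).re := by
      rw [← re_ofReal_mul]; congr 1; push_cast; ring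
    rw [this]
    have h3 : normSq (2 * I * ((starRingEnd ℂ) (p.1 j) * c)) = 4 * normSq (p.1 j) * normSq c := by
      simp [normSq_mul, normSq_ofNat]; ring
    have h4 : ((starRingEnd ℂ) (wC p) * (2 * I * ↑(normSq c))).re = 2 * nsq p.1 * normSq c := by
      simp; ring
    rw [h3, h4]; ring

theorem sum_normSq (z : Fin n → ℂ) : ∑ j, normSq (z j) = nsq z := rfl

theorem sq_pair (α : ℂ) : (α * 1).re ^ 2 + (α * I).re ^ 2 = normSq α := by
  simp [normSq_apply]; ring

theorem rho_harm_sum (p : Heis n) (hp : p ≠ 0) (R : ℝ) :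
    ∑ j : Fin n, ((4 * n * (n + 2) * R / (normSq (wC p))^2 *
        (((starRingEnd ℂ) (wC p) * (I * ((starRingEnd ℂ) (p.1 j) * 1))).re)^2
        - n * R / normSq (wC p)
          * (4 * normSq (p.1 j) + 2 * nsq p.1) * normSq 1) +
        (4 * n * (n + 2) * R / (normSq (wC p))^2 *
        (((starRingEnd ℂ) (wC p) * (I * ((starRingEnd ℂ) (p.1 j) * I))).re)^2
        - n * R / normSq (wC p)
          * (4 * normSq (p.1 j) + 2 * nsq p.1) * normSq I)) = 0 := by
  have hN := (normSq_wC_pos hp).ne'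
  have : ∀ j : Fin n, ((4 * n * (n + 2) * R / (normSq (wC p))^2 *
        (((starRingEnd ℂ) (wC p) * (I * ((starRingEnd ℂ) (p.1 j) * 1))).re)^2
        - n * R / normSq (wC p)
          * (4 * normSq (p.1 j) + 2 * nsq p.1) * normSq 1) +
        (4 * n * (n + 2) * R / (normSq (wC p))^2 *
        (((starRingEnd ℂ) (wC p) * (I * ((starRingEnd ℂ) (p.1 j) * I))).re)^2
        - n * R / normSq (wC p)
          * (4 * normSq (p.1 j) + 2 * nsq p.1) * normSq I))
      = 4 * n * R / normSq (wC p) * (n * normSq (p.1 j) - nsq p.1) := by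
    intro j
    have h := sq_pair ((starRingEnd ℂ) (wC p) * (I * (starRingEnd ℂ) (p.1 j)))
    have e1 : ∀ c : ℂ, (starRingEnd ℂ) (wC p) * (I * ((starRingEnd ℂ) (p.1 j) * c))
      = (starRingEnd ℂ) (wC p) * (I * (starRingEnd ℂ) (p.1 j)) * c := fun c => by ring
    rw [e1, e1]
    have h5 : normSq ((starRingEnd ℂ) (wC p) * (I * (starRingEnd ℂ) (p.1 j)))
      = normSq (wC p) * normSq (p.1 j) := by simp [normSq_mul]
    rw [h5] at h
    simp only [normSq_one, normSq_I]
    generalize normSq (wC p) = N at *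
    generalize ((starRingEnd ℂ) (wC p) * (I * (starRingEnd ℂ) (p.1 j)) * 1).re = x at *
    generalize ((starRingEnd ℂ) (wC p) * (I * (starRingEnd ℂ) (p.1 j)) * I).re = y at *
    have hy : y ^ 2 = N * normSq (p.1 j) - x ^ 2 := by linarith
    rw [hy]; field_simp; ring
  rw [Finset.sum_congr rfl fun j _ => this j, ← Finset.mul_sum, Finset.sum_sub_distrib,
    ← Finset.mul_sum, sum_normSq]
  simp

/-- jets of the inversion. -/
theorem J2_inv0 (m : Fin n → ℂ) (L : ℝ) (p : Heis n) (hp : p ≠ 0) (j : Fin n) (c : ℂ) :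
    J2 (fun ε : ℝ => inv0 m L (p + ε • hv p j c)) (inv0 m L p)
      (fun k => -(m k) * L * ((starRingEnd ℂ) c * ((if k = j then 1 else 0) *
          ((starRingEnd ℂ) (wC p))⁻¹ + 2 * I * (starRingEnd ℂ) (p.1 k) * p.1 j *
          ((starRingEnd ℂ) (wC p))⁻¹ ^ 2)),
        L ^ 2 * (2 * I * p.1 j * (starRingEnd ℂ) c * ((starRingEnd ℂ) (wC p))⁻¹ ^ 2).re)
      (fun k => -(m k) * L * ((starRingEnd ℂ) c ^ 2 * ((if k = j then 1 else 0) *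
          (4 * I * p.1 j * ((starRingEnd ℂ) (wC p))⁻¹ ^ 2) - 8 * (starRingEnd ℂ) (p.1 k) *
          p.1 j ^ 2 * ((starRingEnd ℂ) (wC p))⁻¹ ^ 3)
          + normSq c * (2 * I * (starRingEnd ℂ) (p.1 k) * ((starRingEnd ℂ) (wC p))⁻¹ ^ 2)),
        L ^ 2 * ((starRingEnd ℂ) c ^ 2 * (- 8 * p.1 j ^ 2 * ((starRingEnd ℂ) (wC p))⁻¹ ^ 3) +
          normSq c * (2 * I * ((starRingEnd ℂ) (wC p))⁻¹ ^ 2)).re) := by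
  have hw := wC_ne hp
  have hwi := (J2_conj (J2_wC p j c)).inv (by simpa using hw)
  refine J2.prodMk (J2.pi fun k => ?_) ?_
  · have hz : J2 (fun ε : ℝ => (starRingEnd ℂ) ((p + ε • hv p j c).1 k)) ((starRingEnd ℂ) (p.1 k))
        ((starRingEnd ℂ) (if k = j then c else 0)) ((starRingEnd ℂ) 0) :=
      J2_conj ((J2.line (p.1 k) (if k = j then c else 0)).congr
        (Eventually.of_forall fun ε => hv_fst_line p j k c ε))
    refine ((J2.const (-(m k) * L)).mul (hz.mul hwi)).cast rfl ?_ ?_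
    · simp only [map_mul, Complex.conj_I, Complex.conj_conj, map_ofNat]
      split_ifs <;> (try simp only [map_zero]) <;> ring
    · have : ∀ x : ℂ, (2 * -I * x)^2 = -4 * x ^ 2 := fun x => by
        rw [mul_pow, mul_pow, neg_sq, I_sq]; ring
      simp only [map_mul, Complex.conj_I, Complex.conj_conj, map_ofNat, Complex.conj_ofReal, this]
      split_ifs <;> (try simp only [map_zero]) <;> ring
  · refine ((J2.const (L ^ 2)).mul (J2.clm reCLM hwi)).cast rfl ?_ ?_
    · simp only [zero_mul, zero_add, reCLM_apply]
      congr 2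
      simp only [map_mul, Complex.conj_I, Complex.conj_conj, map_ofNat]
      ring
    · simp only [zero_mul, zero_add, mul_zero, reCLM_apply]
      congr 2
      simp only [map_mul, Complex.conj_I, Complex.conj_conj, map_ofNat, Complex.conj_ofReal]
      have : ∀ x : ℂ, (2 * -I * x)^2 = -4 * x ^ 2 := fun x => by
        rw [mul_pow, mul_pow, neg_sq, I_sq]; ring
      rw [this]; ring
end

section
variable {n : ℕ}

/-- matrix of the differential of the inversion. -/
def amat (m : Fin n → ℂ) (L : ℝ) (p : Heis n) (j k : Fin n) : ℂ :=
  -(m k) * L * ((if k = j then 1 else 0) *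
          ((starRingEnd ℂ) (wC p))⁻¹ + 2 * I * (starRingEnd ℂ) (p.1 k) * p.1 j *
          ((starRingEnd ℂ) (wC p))⁻¹ ^ 2)

theorem sum_mul_conj (z : Fin n → ℂ) : ∑ j, z j * (starRingEnd ℂ) (z j) = (nsq z : ℂ) := by
  simp [nsq, mul_conj]

theorem wC_sub_conj (p : Heis n) : wC p = (starRingEnd ℂ) (wC p) + 2 * I * (nsq p.1 : ℂ) := by
  apply Complex.ext <;> simp; ring

theorem amat_unitary (m : Fin n → ℂ) (hm : ∀ k, normSq (m k) = 1) (L : ℝ) (p : Heis n) (hp : p ≠ 0)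
    (k l : Fin n) : ∑ j, amat m L p j k * (starRingEnd ℂ) (amat m L p j l)
      = if k = l then ((L ^ 2 / normSq (wC p) : ℝ) : ℂ) else 0 := by
  have hw := wC_ne hp
  have hwc : (starRingEnd ℂ) (wC p) ≠ 0 := by simpa using hw
  have hs := sum_mul_conj p.1
  have hd := wC_sub_conj p
  have key : ∀ j, amat m L p j k * (starRingEnd ℂ) (amat m L p j l) =
    m k * (starRingEnd ℂ) (m l) * L ^ 2 * ((if k = j then (if l = j then 1 else 0) else 0) *
      ((starRingEnd ℂ) (wC p))⁻¹ * (wC p)⁻¹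
      - 2 * I * p.1 l * ((starRingEnd ℂ) (wC p))⁻¹ * (wC p)⁻¹ ^ 2 *
        (if k = j then (starRingEnd ℂ) (p.1 j) else 0)
      + 2 * I * (starRingEnd ℂ) (p.1 k) * ((starRingEnd ℂ) (wC p))⁻¹ ^ 2 * (wC p)⁻¹ *
        (if l = j then p.1 j else 0)
      + 4 * (starRingEnd ℂ) (p.1 k) * p.1 l * ((starRingEnd ℂ) (wC p))⁻¹ ^ 2 * (wC p)⁻¹ ^ 2 *
        (p.1 j * (starRingEnd ℂ) (p.1 j))) := by
    intro j
    have hI : I * I = -1 := I_mul_I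
    simp only [amat, map_mul, map_add, map_neg, map_pow, Complex.conj_I, Complex.conj_conj,
      map_ofNat, map_inv₀, Complex.conj_ofReal]
    split_ifs <;> simp only [map_one, map_zero] <;> linear_combination
        (-4 * m k * (starRingEnd ℂ) (m l) * L ^ 2 * (starRingEnd ℂ) (p.1 k) * p.1 l *
          ((starRingEnd ℂ) (wC p))⁻¹ ^ 2 * (wC p)⁻¹ ^ 2 *
        (p.1 j * (starRingEnd ℂ) (p.1 j))) * hI
  rw [Finset.sum_congr rfl fun j _ => key j, ← Finset.mul_sum, Finset.sum_add_distrib,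
    Finset.sum_add_distrib, Finset.sum_sub_distrib, ← Finset.mul_sum, ← Finset.mul_sum,
    ← Finset.mul_sum, hs, ← Finset.sum_mul, ← Finset.sum_mul]
  simp only [Finset.sum_ite_eq, Finset.mem_univ, if_true]
  have hN : (normSq (wC p) : ℂ) = wC p * (starRingEnd ℂ) (wC p) := (mul_conj _).symm
  have hz : - 2 * I * p.1 l * ((starRingEnd ℂ) (wC p))⁻¹ * (wC p)⁻¹ ^ 2 * (starRingEnd ℂ) (p.1 k)
      + 2 * I * (starRingEnd ℂ) (p.1 k) * ((starRingEnd ℂ) (wC p))⁻¹ ^ 2 * (wC p)⁻¹ * p.1 l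
      + 4 * (starRingEnd ℂ) (p.1 k) * p.1 l * ((starRingEnd ℂ) (wC p))⁻¹ ^ 2 * (wC p)⁻¹ ^ 2 *
        (nsq p.1) = 0 := by
    field_simp
    have hI : I ^ 2 = -1 := I_sq
    linear_combination 2 * p.1 l * (starRingEnd ℂ) (p.1 k) * I * hd
      + 4 * p.1 l * (starRingEnd ℂ) (p.1 k) * (nsq p.1) * hI
  have hk : m k * (starRingEnd ℂ) (m k) = 1 := by rw [mul_conj, hm]; simp
  by_cases hkl : k = l
  · subst hkl
    simp only [if_true]
    push_cast
    rw [hN]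
    have e : (L:ℂ) ^ 2 / (wC p * (starRingEnd ℂ) (wC p)) = L ^ 2 * ((starRingEnd ℂ) (wC p))⁻¹
      * (wC p)⁻¹ := by field_simp
    rw [e]
    linear_combination m k * (starRingEnd ℂ) (m k) * L ^ 2 * hz
      + L ^ 2 * ((starRingEnd ℂ) (wC p))⁻¹ * (wC p)⁻¹ * hk
  · have hlk : ¬ l = k := fun h => hkl h.symm
    simp only [if_neg hkl, if_neg hlk]
    linear_combination m k * (starRingEnd ℂ) (m l) * L ^ 2 * hz

theorem inv0_hl (m : Fin n → ℂ) (hm : ∀ k, normSq (m k) = 1) (L : ℝ) (p : Heis n) (hp : p ≠ 0)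
    (j : Fin n) (c : ℂ) :
    ((fun k => -(m k) * L * ((starRingEnd ℂ) c * ((if k = j then 1 else 0) *
          ((starRingEnd ℂ) (wC p))⁻¹ + 2 * I * (starRingEnd ℂ) (p.1 k) * p.1 j *
          ((starRingEnd ℂ) (wC p))⁻¹ ^ 2)),
        L ^ 2 * (2 * I * p.1 j * (starRingEnd ℂ) c * ((starRingEnd ℂ) (wC p))⁻¹ ^ 2).re) : Heis n)
     = hl (inv0 m L p) ((starRingEnd ℂ) c • amat m L p j) := by
  rw [hl_apply]
  have hw := wC_ne hp
  have hwc : (starRingEnd ℂ) (wC p) ≠ 0 := by simpa using hw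
  have hs := sum_mul_conj p.1
  have hd := wC_sub_conj p
  refine Prod.ext ?_ ?_
  · funext k
    simp only [amat, Pi.smul_apply, smul_eq_mul]; ring
  · have : hermInner (inv0 m L p).1 ((starRingEnd ℂ) c • amat m L p j) =
        ((L ^ 2 : ℝ) : ℂ) * (starRingEnd ℂ) (p.1 j * (starRingEnd ℂ) c
          * ((starRingEnd ℂ) (wC p))⁻¹ ^ 2) := by
      unfold hermInner
      have key : ∀ k, (inv0 m L p).1 k * (starRingEnd ℂ) (((starRingEnd ℂ) c • amat m L p j) k) =
          L ^ 2 * c * (((starRingEnd ℂ) (wC p))⁻¹ * (wC p)⁻¹ *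
            (if k = j then (starRingEnd ℂ) (p.1 k) else 0)
            - 2 * I * (starRingEnd ℂ) (p.1 j) * ((starRingEnd ℂ) (wC p))⁻¹ * (wC p)⁻¹ ^ 2
              * (p.1 k * (starRingEnd ℂ) (p.1 k))) := by
        intro k
        have hk : m k * (starRingEnd ℂ) (m k) = 1 := by rw [mul_conj, hm]; simp
        simp only [inv0, amat, Pi.smul_apply, smul_eq_mul, map_mul, map_add, map_neg, map_pow,
          Complex.conj_I, Complex.conj_conj, map_ofNat, map_inv₀, Complex.conj_ofReal]
        split_ifs <;> simp only [map_one, map_zero]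
        · linear_combination L ^ 2 * c * (((starRingEnd ℂ) (wC p))⁻¹ * (wC p)⁻¹ *
            (starRingEnd ℂ) (p.1 k) - 2 * I * (starRingEnd ℂ) (p.1 j) * ((starRingEnd ℂ) (wC p))⁻¹
              * (wC p)⁻¹ ^ 2 * (p.1 k * (starRingEnd ℂ) (p.1 k))) * hk
        · linear_combination L ^ 2 * c * (
             - 2 * I * (starRingEnd ℂ) (p.1 j) * ((starRingEnd ℂ) (wC p))⁻¹
              * (wC p)⁻¹ ^ 2 * (p.1 k * (starRingEnd ℂ) (p.1 k))) * hk
      rw [Finset.sum_congr rfl fun j _ => key j, ← Finset.mul_sum, Finset.sum_sub_distrib,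
        ← Finset.mul_sum, ← Finset.mul_sum, hs]
      simp only [Finset.sum_ite_eq', Finset.mem_univ, if_true, map_mul, map_pow, map_inv₀,
        Complex.conj_conj]
      push_cast
      field_simp
      linear_combination L ^ 2 * c * (starRingEnd ℂ) (p.1 j) * hd
    rw [this]
    simp only [im_ofReal_mul, Complex.conj_im]
    rw [show 2 * I * p.1 j * (starRingEnd ℂ) c * ((starRingEnd ℂ) (wC p))⁻¹ ^ 2 =
      2 * I * (p.1 j * (starRingEnd ℂ) c * ((starRingEnd ℂ) (wC p))⁻¹ ^ 2) by ring]
    generalize p.1 j * (starRingEnd ℂ) c * ((starRingEnd ℂ) (wC p))⁻¹ ^ 2 = y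
    simp; ring
end

section
variable {n : ℕ}

theorem pair_re (α : ℂ) : (((α * 1).re : ℝ) : ℂ) * (starRingEnd ℂ) 1
    + (((α * I).re : ℝ) : ℂ) * (starRingEnd ℂ) I = α := by
  apply Complex.ext <;> simp

theorem pair_re' (α β : ℂ) : (α * 1).re * (β * (starRingEnd ℂ) 1).re
    + (α * I).re * (β * (starRingEnd ℂ) I).re = (α * β).re := by
  simp; ring

theorem kel_first_z (m : Fin n → ℂ) (L R : ℝ) (p : Heis n) (hp : p ≠ 0) (k : Fin n) :
   ∑ j : Fin n, (
    ((2 * (-2 * n * R / normSq (wC p) *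
        ((starRingEnd ℂ) (wC p) * (I * ((starRingEnd ℂ) (p.1 j) * 1))).re) : ℝ) : ℂ)
      * (-(m k) * L * ((starRingEnd ℂ) 1 * ((if k = j then 1 else 0) *
          ((starRingEnd ℂ) (wC p))⁻¹ + 2 * I * (starRingEnd ℂ) (p.1 k) * p.1 j *
          ((starRingEnd ℂ) (wC p))⁻¹ ^ 2)))
    + (R : ℂ) * (-(m k) * L * ((starRingEnd ℂ) 1 ^ 2 * ((if k = j then 1 else 0) *
          (4 * I * p.1 j * ((starRingEnd ℂ) (wC p))⁻¹ ^ 2) - 8 * (starRingEnd ℂ) (p.1 k) *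
          p.1 j ^ 2 * ((starRingEnd ℂ) (wC p))⁻¹ ^ 3)
          + normSq 1 * (2 * I * (starRingEnd ℂ) (p.1 k) * ((starRingEnd ℂ) (wC p))⁻¹ ^ 2)))
    + (((2 * (-2 * n * R / normSq (wC p) *
        ((starRingEnd ℂ) (wC p) * (I * ((starRingEnd ℂ) (p.1 j) * I))).re) : ℝ) : ℂ)
      * (-(m k) * L * ((starRingEnd ℂ) I * ((if k = j then 1 else 0) *
          ((starRingEnd ℂ) (wC p))⁻¹ + 2 * I * (starRingEnd ℂ) (p.1 k) * p.1 j *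
          ((starRingEnd ℂ) (wC p))⁻¹ ^ 2)))
    + (R : ℂ) * (-(m k) * L * ((starRingEnd ℂ) I ^ 2 * ((if k = j then 1 else 0) *
          (4 * I * p.1 j * ((starRingEnd ℂ) (wC p))⁻¹ ^ 2) - 8 * (starRingEnd ℂ) (p.1 k) *
          p.1 j ^ 2 * ((starRingEnd ℂ) (wC p))⁻¹ ^ 3)
          + normSq I * (2 * I * (starRingEnd ℂ) (p.1 k) * ((starRingEnd ℂ) (wC p))⁻¹ ^ 2))))) = 0 := by
  have hw := wC_ne hp
  have hwc : (starRingEnd ℂ) (wC p) ≠ 0 := by simpa using hw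
  have hs := sum_mul_conj p.1
  have hd := wC_sub_conj p
  have hN : (normSq (wC p) : ℂ) = wC p * (starRingEnd ℂ) (wC p) := (mul_conj _).symm
  refine (Finset.sum_congr (g := fun j => -(m k) * L * R * (-4 * n / normSq (wC p) * (I * (starRingEnd ℂ) (wC p))
      * (((starRingEnd ℂ) (wC p))⁻¹ * (if k = j then (starRingEnd ℂ) (p.1 j) else 0)
        + 2 * I * (starRingEnd ℂ) (p.1 k) *
          ((starRingEnd ℂ) (wC p))⁻¹ ^ 2 * (p.1 j * (starRingEnd ℂ) (p.1 j)))
      + 4 * I * (starRingEnd ℂ) (p.1 k) * ((starRingEnd ℂ) (wC p))⁻¹ ^ 2)) rfl fun j _ => ?_).trans ?_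
  · have h := pair_re ((starRingEnd ℂ) (wC p) * (I * (starRingEnd ℂ) (p.1 j)))
    have e1 : ∀ c : ℂ, (starRingEnd ℂ) (wC p) * (I * ((starRingEnd ℂ) (p.1 j) * c))
      = (starRingEnd ℂ) (wC p) * (I * (starRingEnd ℂ) (p.1 j)) * c := fun c => by ring
    have e2 : (if k = j then (starRingEnd ℂ) (p.1 j) else 0) =
      (if k = j then 1 else 0) * (starRingEnd ℂ) (p.1 j) := by split_ifs <;> simp
    rw [e1, e1, e2]
    have hI2 : (starRingEnd ℂ) I ^ 2 = -1 := by simp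
    have h12 : (starRingEnd ℂ) 1 ^ 2 = 1 := by simp
    rw [hI2, h12, normSq_one, normSq_I]
    push_cast
    generalize (if k = j then (1:ℂ) else 0) = d
    generalize ((((starRingEnd ℂ) (wC p) * (I * (starRingEnd ℂ) (p.1 j)) * 1).re : ℝ) : ℂ) = x at *
    generalize ((((starRingEnd ℂ) (wC p) * (I * (starRingEnd ℂ) (p.1 j)) * I).re : ℝ) : ℂ) = y at *
    linear_combination (-(m k) * L) * (d *
          ((starRingEnd ℂ) (wC p))⁻¹ + 2 * I * (starRingEnd ℂ) (p.1 k) * p.1 j *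
          ((starRingEnd ℂ) (wC p))⁻¹ ^ 2) * (-4 * n * R / normSq (wC p)) * h
  rw [← Finset.mul_sum, Finset.sum_add_distrib,
    ← Finset.mul_sum, Finset.sum_add_distrib, ← Finset.mul_sum, ← Finset.mul_sum, hs, hN]
  simp only [Finset.sum_ite_eq, Finset.mem_univ, if_true, Finset.sum_const, Finset.card_univ,
    Fintype.card_fin, nsmul_eq_mul]
  field_simp
  have hI : I ^ 2 = -1 := I_sq
  linear_combination -(m k) * L * R * n * I * 4 * (starRingEnd ℂ) (p.1 k) * hd

theorem kel_first_t (L R : ℝ) (p : Heis n) (hp : p ≠ 0) :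
   ∑ j : Fin n, (
    (2 * (-2 * n * R / normSq (wC p) *
        ((starRingEnd ℂ) (wC p) * (I * ((starRingEnd ℂ) (p.1 j) * 1))).re))
      * (L ^ 2 * (2 * I * p.1 j * (starRingEnd ℂ) 1 * ((starRingEnd ℂ) (wC p))⁻¹ ^ 2).re)
    + R * (L ^ 2 * ((starRingEnd ℂ) 1 ^ 2 * (- 8 * p.1 j ^ 2 * ((starRingEnd ℂ) (wC p))⁻¹ ^ 3) +
          normSq 1 * (2 * I * ((starRingEnd ℂ) (wC p))⁻¹ ^ 2)).re)
    + ((2 * (-2 * n * R / normSq (wC p) *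
        ((starRingEnd ℂ) (wC p) * (I * ((starRingEnd ℂ) (p.1 j) * I))).re))
      * (L ^ 2 * (2 * I * p.1 j * (starRingEnd ℂ) I * ((starRingEnd ℂ) (wC p))⁻¹ ^ 2).re)
    + R * (L ^ 2 * ((starRingEnd ℂ) I ^ 2 * (- 8 * p.1 j ^ 2 * ((starRingEnd ℂ) (wC p))⁻¹ ^ 3) +
          normSq I * (2 * I * ((starRingEnd ℂ) (wC p))⁻¹ ^ 2)).re))) = 0 := by
  have hw := wC_ne hp
  have hwc : (starRingEnd ℂ) (wC p) ≠ 0 := by simpa using hw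
  have hN0 := (normSq_wC_pos hp).ne'
  refine (Finset.sum_congr (g := fun j => 4 * R * L ^ 2 / normSq (wC p) ^ 2 *
      (2 * n * p.2 * normSq (p.1 j) - 2 * p.2 * nsq p.1)) rfl fun j _ => ?_).trans ?_
  · have h := pair_re' ((starRingEnd ℂ) (wC p) * (I * (starRingEnd ℂ) (p.1 j)))
      (2 * I * p.1 j * ((starRingEnd ℂ) (wC p))⁻¹ ^ 2)
    have e1 : ∀ c : ℂ, (starRingEnd ℂ) (wC p) * (I * ((starRingEnd ℂ) (p.1 j) * c))
      = (starRingEnd ℂ) (wC p) * (I * (starRingEnd ℂ) (p.1 j)) * c := fun c => by ring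
    have e2 : ∀ c : ℂ, 2 * I * p.1 j * c * ((starRingEnd ℂ) (wC p))⁻¹ ^ 2 =
      2 * I * p.1 j * ((starRingEnd ℂ) (wC p))⁻¹ ^ 2 * c := fun c => by ring
    rw [e1, e1, e2, e2]
    have hI2 : (starRingEnd ℂ) I ^ 2 = -1 := by simp
    have h12 : (starRingEnd ℂ) 1 ^ 2 = 1 := by simp
    rw [hI2, h12, normSq_one, normSq_I]
    have e3 : (starRingEnd ℂ) (wC p) * (I * (starRingEnd ℂ) (p.1 j)) *
        (2 * I * p.1 j * ((starRingEnd ℂ) (wC p))⁻¹ ^ 2) =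
        ((-2 * normSq (p.1 j) : ℝ) : ℂ) * ((starRingEnd ℂ) (wC p))⁻¹ := by
      push_cast
      rw [normSq_eq_conj_mul_self]
      field_simp
      rw [I_sq]; ring
    have e4 : ((starRingEnd ℂ) (wC p))⁻¹ = ((normSq (wC p))⁻¹ : ℝ) * wC p := by
      rw [Complex.inv_def]; simp [mul_comm]
    rw [e3, re_ofReal_mul] at h
    have e5 : (((starRingEnd ℂ) (wC p))⁻¹).re = p.2 / normSq (wC p) := by
      rw [e4, re_ofReal_mul, wC_re]; ring
    have e6 : (2 * I * ((starRingEnd ℂ) (wC p))⁻¹ ^ 2).re =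
        - 4 * p.2 * nsq p.1 / normSq (wC p) ^ 2 := by
      rw [e4, show 2 * I * (((normSq (wC p))⁻¹ : ℝ) * wC p) ^ 2 =
        ((2 * ((normSq (wC p))⁻¹)^2 : ℝ) : ℂ) * (I * wC p ^ 2) by push_cast; ring, re_ofReal_mul]
      have : (I * wC p ^ 2).re = - 2 * p.2 * nsq p.1 := by
        simp [sq]; ring
      rw [this]; field_simp; ring
    rw [e5] at h
    have e7 : ∀ s : ℂ, (1 * s + ((1:ℝ):ℂ) * (2 * I * ((starRingEnd ℂ) (wC p))⁻¹ ^ 2)).re =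
      s.re - 4 * p.2 * nsq p.1 / normSq (wC p) ^ 2 := fun s => by
        rw [add_re, ofReal_one, one_mul, one_mul, e6]; ring
    have e8 : ∀ s : ℂ, (-1 * s + ((1:ℝ):ℂ) * (2 * I * ((starRingEnd ℂ) (wC p))⁻¹ ^ 2)).re =
      - s.re - 4 * p.2 * nsq p.1 / normSq (wC p) ^ 2 := fun s => by
        rw [add_re, ofReal_one, one_mul, neg_one_mul, neg_re, e6]; ring
    rw [e7, e8]
    generalize ((starRingEnd ℂ) (wC p) * (I * (starRingEnd ℂ) (p.1 j)) * 1).re = x at *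
    generalize ((starRingEnd ℂ) (wC p) * (I * (starRingEnd ℂ) (p.1 j)) * I).re = y at *
    linear_combination (-4 * n * R / normSq (wC p)) * L ^ 2 * h
  rw [← Finset.mul_sum, Finset.sum_sub_distrib,
    ← Finset.mul_sum, sum_normSq]
  simp
  right; ring

theorem hl_bil (v : Heis n → ℝ) (q : Heis n) (a : Fin n → Fin n → ℂ) (μ : ℝ)
    (hv : ContDiffAt ℝ 2 v q)
    (ha : ∀ k l, ∑ j, a j k * (starRingEnd ℂ) (a j l) = if k = l then (μ : ℂ) else 0) :
    ∑ j, (D2 v q (hl q (a j)) (hl q (a j)) + D2 v q (hl q (I • a j)) (hl q (I • a j)))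
      = μ * subLap v q := by
  have := bil_unitary ((D2 v q).bilinearComp (hl q) (hl q)) a μ ha
  rw [subLap_eq hv]
  simpa [hl_single] using this

theorem subLap_kel (m : Fin n → ℂ) (hm : ∀ k, normSq (m k) = 1) (L : ℝ) (p : Heis n) (hp : p ≠ 0)
    (v : Heis n → ℝ) (hv : ContDiffAt ℝ 2 v (inv0 m L p)) :
    subLap (kel m L v) p = rho n L (normSq (wC p)) * (L ^ 2 / normSq (wC p))
      * subLap v (inv0 m L p) := by
  have hJ := fun j c => (J2_rho p hp L j c).mul ((J2_inv0 m L p hp j c).comp hv)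
  rw [subLap_jets (contDiffAt_kel hp hv) hJ]
  set R := rho n L (normSq (wC p)) with hR
  have hz := kel_first_z m L R p hp
  have ht := kel_first_t L R p hp
  have h0 := rho_harm_sum p hp R
  have h2 := hl_bil v (inv0 m L p) (amat m L p) _ hv (amat_unitary m hm L p hp)
  simp only [inv0_hl m hm L p hp]
  have hneg : ∀ j, D2 v (inv0 m L p) (hl (inv0 m L p) ((starRingEnd ℂ) I • amat m L p j))
      (hl (inv0 m L p) ((starRingEnd ℂ) I • amat m L p j)) =
      D2 v (inv0 m L p) (hl (inv0 m L p) (I • amat m L p j))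
      (hl (inv0 m L p) (I • amat m L p j)) := by
    intro j
    rw [conj_I, neg_smul, map_neg]; simp
  have hone : ∀ j, (starRingEnd ℂ) 1 • amat m L p j = amat m L p j := by intro j; simp
  have hvec : ∑ j : Fin n, (
    ((2 * (-2 * n * R / normSq (wC p) *
        ((starRingEnd ℂ) (wC p) * (I * ((starRingEnd ℂ) (p.1 j) * 1))).re)) •
      (hl (inv0 m L p) ((starRingEnd ℂ) 1 • amat m L p j))
    + R • ((fun k => -(m k) * L * ((starRingEnd ℂ) 1 ^ 2 * ((if k = j then 1 else 0) *
          (4 * I * p.1 j * ((starRingEnd ℂ) (wC p))⁻¹ ^ 2) - 8 * (starRingEnd ℂ) (p.1 k) *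
          p.1 j ^ 2 * ((starRingEnd ℂ) (wC p))⁻¹ ^ 3)
          + normSq 1 * (2 * I * (starRingEnd ℂ) (p.1 k) * ((starRingEnd ℂ) (wC p))⁻¹ ^ 2)),
        L ^ 2 * ((starRingEnd ℂ) 1 ^ 2 * (- 8 * p.1 j ^ 2 * ((starRingEnd ℂ) (wC p))⁻¹ ^ 3) +
          normSq 1 * (2 * I * ((starRingEnd ℂ) (wC p))⁻¹ ^ 2)).re) : Heis n)
    + ((2 * (-2 * n * R / normSq (wC p) *
        ((starRingEnd ℂ) (wC p) * (I * ((starRingEnd ℂ) (p.1 j) * I))).re)) •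
      (hl (inv0 m L p) ((starRingEnd ℂ) I • amat m L p j))
    + R • ((fun k => -(m k) * L * ((starRingEnd ℂ) I ^ 2 * ((if k = j then 1 else 0) *
          (4 * I * p.1 j * ((starRingEnd ℂ) (wC p))⁻¹ ^ 2) - 8 * (starRingEnd ℂ) (p.1 k) *
          p.1 j ^ 2 * ((starRingEnd ℂ) (wC p))⁻¹ ^ 3)
          + normSq I * (2 * I * (starRingEnd ℂ) (p.1 k) * ((starRingEnd ℂ) (wC p))⁻¹ ^ 2)),
        L ^ 2 * ((starRingEnd ℂ) I ^ 2 * (- 8 * p.1 j ^ 2 * ((starRingEnd ℂ) (wC p))⁻¹ ^ 3) +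
          normSq I * (2 * I * ((starRingEnd ℂ) (wC p))⁻¹ ^ 2)).re) : Heis n)))) = 0 := by
    simp only [← inv0_hl m hm L p hp]
    refine Prod.ext ?_ ?_
    · funext k
      rw [Prod.fst_sum, Finset.sum_apply]
      refine Eq.trans (Finset.sum_congr rfl fun j _ => ?_) (hz k)
      simp only [Prod.fst_add, Prod.smul_fst, Pi.add_apply, Pi.smul_apply, real_smul]
    · rw [Prod.snd_sum]
      refine Eq.trans (Finset.sum_congr rfl fun j _ => ?_) ht
      simp only [Prod.snd_add, Prod.smul_snd, smul_eq_mul]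
  have hvec' := congrArg (fderiv ℝ v (inv0 m L p)) hvec
  rw [map_sum, map_zero] at hvec'
  simp only [map_add, map_smul, smul_eq_mul] at hvec'
  rw [show R * (L^2/normSq (wC p)) * subLap v (inv0 m L p) = R * (L^2/normSq (wC p) * subLap v (inv0 m L p)) from mul_assoc _ _ _, ← h2]
  simp only [hone] at hvec' ⊢
  have hfin := congrArg (fun x => x * v (inv0 m L p)) h0
  simp only [zero_mul, Finset.sum_mul] at hfin
  rw [Finset.mul_sum, ← sub_eq_zero, ← Finset.sum_sub_distrib]
  rw [← add_zero (0:ℝ)]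
  nth_rw 1 [← hfin]
  rw [← hvec', ← Finset.sum_add_distrib]
  refine Finset.sum_congr rfl fun j _ => ?_
  rw [hneg]
  ring
end

section
variable {n : ℕ}

theorem hermInner_add_left (a b c : Fin n → ℂ) :
    hermInner (a + b) c = hermInner a c + hermInner b c := by
  simp [hermInner, add_mul, Finset.sum_add_distrib]
theorem hermInner_add_right (a b c : Fin n → ℂ) :
    hermInner a (b + c) = hermInner a b + hermInner a c := by
  simp [hermInner, mul_add, Finset.sum_add_distrib]
theorem hermInner_neg_left (a b : Fin n → ℂ) : hermInner (-a) b = - hermInner a b := by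
  simp [hermInner]
theorem hermInner_neg_right (a b : Fin n → ℂ) : hermInner a (-b) = - hermInner a b := by
  simp [hermInner]
theorem hermInner_zero_left (b : Fin n → ℂ) : hermInner 0 b = 0 := by simp [hermInner]
theorem hermInner_zero_right (b : Fin n → ℂ) : hermInner b 0 = 0 := by simp [hermInner]
theorem hermInner_self (a : Fin n → ℂ) : hermInner a a = (nsq a : ℂ) := sum_mul_conj a
theorem hermInner_conj (a b : Fin n → ℂ) : (starRingEnd ℂ) (hermInner a b) = hermInner b a := by
  simp [hermInner, mul_comm]

theorem hmul_assoc (a b c : Heis n) : hmul (hmul a b) c = hmul a (hmul b c) := by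
  unfold hmul
  refine Prod.ext (add_assoc _ _ _) ?_
  simp only [hermInner_add_left, hermInner_add_right, add_im]; ring
theorem hmul_zero (a : Heis n) : hmul a 0 = a := by
  simp [hmul, hermInner_zero_right]
theorem zero_hmul (a : Heis n) : hmul 0 a = a := by
  simp [hmul, hermInner_zero_left]
theorem hmul_hinv (a : Heis n) : hmul a (hinv a) = 0 := by
  simp [hmul, hinv, hermInner_neg_right, hermInner_self]
theorem hinv_hmul (a : Heis n) : hmul (hinv a) a = 0 := by
  simp [hmul, hinv, hermInner_neg_left, hermInner_self]
theorem hinv_hmul_cancel (a b : Heis n) : hmul (hinv a) (hmul a b) = b := by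
  rw [← hmul_assoc, hinv_hmul, zero_hmul]
theorem hmul_hinv_cancel (a b : Heis n) : hmul a (hmul (hinv a) b) = b := by
  rw [← hmul_assoc, hmul_hinv, zero_hmul]

theorem contDiff_hermInner_right (a : Fin n → ℂ) {k : WithTop ℕ∞} :
    ContDiff ℝ k (fun b : Fin n → ℂ => hermInner a b) := by
  unfold hermInner
  refine ContDiff.sum fun j _ => contDiff_const.mul ?_
  exact conjCLE.toContinuousLinearMap.contDiff.comp (contDiff_apply ℝ ℂ j)

theorem contDiff_hmul (a : Heis n) {k : WithTop ℕ∞} : ContDiff ℝ k (hmul a) := by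
  unfold hmul
  refine ContDiff.prodMk (contDiff_const.add contDiff_fst) ?_
  refine (contDiff_const.add contDiff_snd).add (contDiff_const.mul ?_)
  exact imCLM.contDiff.comp ((contDiff_hermInner_right a.1).comp contDiff_fst)

/-- coordinatewise multiplication. -/
def rt (m : Fin n → ℂ) (p : Heis n) : Heis n := (fun k => m k * p.1 k, p.2)

theorem contDiff_rt (m : Fin n → ℂ) {k : WithTop ℕ∞} : ContDiff ℝ k (rt m : Heis n → Heis n) := by
  unfold rt
  refine ContDiff.prodMk (contDiff_pi.2 fun j => contDiff_const.mul ?_) contDiff_snd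
  exact (contDiff_apply ℝ ℂ j).comp contDiff_fst

theorem contDiff_dil (r : ℝ) {k : WithTop ℕ∞} : ContDiff ℝ k (dil r : Heis n → Heis n) := by
  unfold dil
  refine ContDiff.prodMk (contDiff_pi.2 fun j => contDiff_const.mul ?_)
    (contDiff_const.mul contDiff_snd)
  exact (contDiff_apply ℝ ℂ j).comp contDiff_fst

theorem subLap_comp {φ : Heis n → Heis n} {f : Heis n → ℝ} {p : Heis n}
    (hφ : ContDiffAt ℝ 2 φ p) (hf : ContDiffAt ℝ 2 f (φ p)) (m : Fin n → ℂ) (μ : ℝ)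
    (hm : ∀ k, normSq (m k) = μ)
    (H : ∀ j c (ε : ℝ), φ (p + ε • hv p j c) = φ p + ε • hv (φ p) j (m j * c)) :
    subLap (fun q => f (φ q)) p = μ * subLap f (φ p) := by
  have hJ : ∀ j c, J2 (fun ε : ℝ => f (φ (p + ε • hv p j c))) _ _ _ := fun j c =>
    ((J2.line (φ p) (hv (φ p) j (m j * c))).comp hf).congr (Eventually.of_forall fun ε => by
      simp only [H])
  rw [subLap_jets (f := fun q => f (φ q)) (hf.comp p hφ) hJ]
  have := hl_bil f (φ p) (fun j => Pi.single j (m j)) μ hf ?_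
  · rw [← this]
    refine Finset.sum_congr rfl fun j _ => ?_
    have h2 : I • (Pi.single j (m j) : Fin n → ℂ) = Pi.single j (m j * I) := by
      rw [← Pi.single_smul, smul_eq_mul, mul_comm]
    rw [h2, hl_single, hl_single]
    simp
  · intro k l
    by_cases h : k = l
    · subst h
      rw [if_pos rfl, Finset.sum_eq_single k]
      · simp [mul_conj, hm]
      · intro b _ hb; simp [Pi.single_apply, hb.symm]
      · simp
    · rw [if_neg h]
      refine Finset.sum_eq_zero fun j _ => ?_
      by_cases h1 : k = j
      · subst h1; simp [Pi.single_apply, Ne.symm h]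
      · simp [Pi.single_apply, h1]

theorem subLap_hmul {f : Heis n → ℝ} (a p : Heis n) (hf : ContDiffAt ℝ 2 f (hmul a p)) :
    subLap (fun q => f (hmul a q)) p = subLap f (hmul a p) := by
  have := subLap_comp (φ := hmul a) (p := p) (contDiff_hmul a).contDiffAt hf (fun _ => 1) 1
    (by simp) ?_
  · simpa using this
  · intro j c ε
    have h1 : hermInner a.1 (Pi.single j c) = a.1 j * (starRingEnd ℂ) c := by
      unfold hermInner
      rw [Finset.sum_eq_single j] <;> simp +contextual [Pi.single_apply]
    have h2 : hermInner a.1 (p.1 + ε • (Pi.single j c : Fin n → ℂ)) = hermInner a.1 p.1 + ε * (a.1 j * (starRingEnd ℂ) c) := by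
      rw [hermInner_add_right, ← h1]; congr 1
      simp [hermInner, Finset.mul_sum]; refine Finset.sum_congr rfl fun _ _ => by ring
    refine Prod.ext ?_ ?_
    · simp [hmul, hv, add_assoc]
    · simp only [hmul, hv, Prod.fst_add, Prod.smul_fst, Prod.snd_add, Prod.smul_snd, h2, one_mul,
        Pi.add_apply, add_mul, add_im, smul_eq_mul, im_ofReal_mul]
      ring

theorem subLap_dil {f : Heis n → ℝ} (r : ℝ) (p : Heis n) (hf : ContDiffAt ℝ 2 f (dil r p)) :
    subLap (fun q => f (dil r q)) p = r ^ 2 * subLap f (dil r p) := by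
  refine subLap_comp (φ := dil r) (p := p) (contDiff_dil r).contDiffAt hf (fun _ => r) (r^2)
    (by simp [normSq_apply, sq]) ?_
  intro j c ε
  refine Prod.ext ?_ ?_
  · funext k
    by_cases h : k = j
    · subst h; simp [dil, hv]; ring
    · simp [dil, hv, h]
  · simp [dil, hv]; ring

theorem subLap_rt {f : Heis n → ℝ} (m : Fin n → ℂ) (hm : ∀ k, normSq (m k) = 1) (p : Heis n)
    (hf : ContDiffAt ℝ 2 f (rt m p)) :
    subLap (fun q => f (rt m q)) p = subLap f (rt m p) := by
  have := subLap_comp (φ := rt m) (p := p) (contDiff_rt m).contDiffAt hf m 1 hm ?_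
  · simpa using this
  intro j c ε
  refine Prod.ext ?_ ?_
  · funext k
    by_cases h : k = j
    · subst h; simp [rt, hv]; ring
    · simp [rt, hv, h]
  · simp only [rt, hv, Prod.snd_add, Prod.smul_snd, smul_eq_mul]
    have : m j * p.1 j * (starRingEnd ℂ) (m j * c) = p.1 j * (starRingEnd ℂ) c := by
      rw [map_mul]
      have h1 : m j * (starRingEnd ℂ) (m j) = 1 := by
        rw [mul_conj, hm]; simp
      linear_combination (p.1 j * (starRingEnd ℂ) c) * h1
    rw [this]
end

section
variable {n : ℕ}

/-- the first derivative of `|w|²/4` along a horizontal direction. -/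
def sg (p : Heis n) (j : Fin n) (c : ℂ) : ℝ :=
  ((starRingEnd ℂ) (wC p) * (I * ((starRingEnd ℂ) (p.1 j) * c))).re

theorem J2_rhok (k : ℕ) (p : Heis n) (hp : p ≠ 0) (L : ℝ) (j : Fin n) (c : ℂ) :
    J2 (fun ε : ℝ => rho k L (normSq (wC (p + ε • hv p j c))))
      (rho k L (normSq (wC p)))
      (-2 * k * rho k L (normSq (wC p)) / normSq (wC p) * sg p j c)
      (4 * k * (k + 2) * rho k L (normSq (wC p)) / (normSq (wC p))^2 * (sg p j c)^2
        - k * rho k L (normSq (wC p)) / normSq (wC p)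
          * (4 * normSq (p.1 j) + 2 * nsq p.1) * normSq c) := by
  have h1 := rho_jet k L (J2_normSq (J2_wC p j c)) (normSq_wC_pos hp)
  have h0 : ((starRingEnd ℂ) (wC p) * (2 * I * ((starRingEnd ℂ) (p.1 j) * c))).re
      = 2 * sg p j c := by
      rw [sg, ← re_ofReal_mul]; congr 1; push_cast; ring
  refine h1.cast rfl ?_ ?_
  · rw [h0]; ring
  · rw [h0]
    have h3 : normSq (2 * I * ((starRingEnd ℂ) (p.1 j) * c)) = 4 * normSq (p.1 j) * normSq c := by
      simp [normSq_mul, normSq_ofNat]; ring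
    have h4 : ((starRingEnd ℂ) (wC p) * (2 * I * ↑(normSq c))).re = 2 * nsq p.1 * normSq c := by
      simp; ring
    rw [h3, h4]; ring

/-- Euler and rotation vectors. -/
def Ev (p : Heis n) : Heis n := (p.1, 2 * p.2)
def Rv (p : Heis n) : Heis n := (fun k => I * p.1 k, 0)

/-- radial Kelvin transform. -/
def K0 (L : ℝ) (v : Heis n → ℝ) (q : Heis n) : ℝ :=
  rho n L (normSq (wC q)) * v (dil (rho 1 L (normSq (wC q))) q)

theorem J2_dil (k : ℕ) (p : Heis n) (j : Fin n) (c : ℂ) {κ : ℝ → ℝ} {k1 k2 : ℝ}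
    (H : J2 κ 1 k1 k2) :
    J2 (fun ε : ℝ => dil (κ ε) (p + ε • hv p j c)) p (hv p j c + k1 • Ev p)
      (k2 • Ev p + (2 * k1) • hv p j c +
        (2 * k1 * (2 * (p.1 j * (starRingEnd ℂ) c).im) + 2 * p.2 * k1 ^ 2) • ((0, 1) : Heis n)) := by
  unfold dil
  have hz : J2 (fun ε : ℝ => fun k => ((κ ε : ℝ) : ℂ) * (p + ε • hv p j c).1 k) p.1
      (hv p j c + k1 • Ev p).1 (k2 • Ev p + (2 * k1) • hv p j c).1 := by
    refine J2.pi fun k => ?_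
    have := (H.clm ofRealCLM).mul ((J2.line (F := ℂ) (p.1 k) (if k = j then c else 0)).congr
      (Eventually.of_forall fun ε => hv_fst_line p j k c ε))
    refine this.cast ?_ ?_ ?_
    · simp
    · simp [hv, Ev, Pi.single_apply]; ring
    · by_cases h : k = j
      · subst h; simp [hv, Ev]
      · simp [hv, Ev, h]
  have ht : J2 (fun ε : ℝ => κ ε ^ 2 * (p + ε • hv p j c).2) p.2
      (hv p j c + k1 • Ev p).2 (k2 • Ev p + (2 * k1) • hv p j c +
        (2 * k1 * (2 * (p.1 j * (starRingEnd ℂ) c).im) + 2 * p.2 * k1 ^ 2) • ((0, 1) : Heis n)).2 := by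
    have := (H.mul H).mul (J2.line p.2 (2 * (p.1 j * (starRingEnd ℂ) c).im))
    refine (this.congr (Eventually.of_forall fun ε => ?_)).cast ?_ ?_ ?_
    · simp [hv, sq]
    · simp
    · simp [hv, Ev]; ring
    · simp [hv, Ev]; ring
  have := hz.prodMk ht
  refine this.cast rfl rfl ?_
  refine Prod.ext ?_ rfl
  simp

theorem sg_sq_sum (p : Heis n) :
    ∑ j, (sg p j 1 ^ 2 + sg p j I ^ 2) = normSq (wC p) * nsq p.1 := by
  rw [← sum_normSq p.1, Finset.mul_sum]
  refine Finset.sum_congr rfl fun j _ => ?_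
  have h := sq_pair ((starRingEnd ℂ) (wC p) * (I * (starRingEnd ℂ) (p.1 j)))
  have e1 : ∀ c : ℂ, (starRingEnd ℂ) (wC p) * (I * ((starRingEnd ℂ) (p.1 j) * c))
      = (starRingEnd ℂ) (wC p) * (I * (starRingEnd ℂ) (p.1 j)) * c := fun c => by ring
  simp only [sg, e1]
  rw [h]; simp [normSq_mul]

theorem sg_vec_sum (p : Heis n) :
    ∑ j, (sg p j 1 • hv p j 1 + sg p j I • hv p j I) = nsq p.1 • Ev p - p.2 • Rv p := by
  refine Prod.ext ?_ ?_
  · funext k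
    rw [Prod.fst_sum, Finset.sum_apply, Finset.sum_eq_single k]
    · simp only [sg, hv, Ev, Rv, Prod.fst_add, Prod.smul_fst, Pi.add_apply, Pi.smul_apply,
        Pi.single_eq_same, Prod.fst_sub, Pi.sub_apply, real_smul]
      apply Complex.ext <;> simp <;> ring
    · intro b _ hb
      simp [hv, Ne.symm hb]
    · simp
  · rw [Prod.snd_sum]
    have : ∀ j, (sg p j 1 • hv p j 1 + sg p j I • hv p j I).2 = 2 * p.2 * normSq (p.1 j) := by
      intro j
      simp [sg, hv, normSq_apply]; ring
    rw [Finset.sum_congr rfl fun j _ => this j, ← Finset.mul_sum, sum_normSq]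
    simp [Ev, Rv]; ring

theorem contDiffAt_K0 {L : ℝ} {v : Heis n → ℝ} {p : Heis n} (hp : p ≠ 0)
    {k : WithTop ℕ∞} (hv : ContDiffAt ℝ k v (dil (rho 1 L (normSq (wC p))) p)) :
    ContDiffAt ℝ k (K0 L v) p := by
  have h1 : ContDiffAt ℝ k (fun q : Heis n => rho 1 L (normSq (wC q))) p := by
    unfold rho
    have h : ContDiff ℝ k (fun q : Heis n => normSq (wC q)) := by
      simp only [normSq_apply, wC_re, wC_im]
      exact (contDiff_snd.mul contDiff_snd).add
        ((contDiff_nsq.comp contDiff_fst).mul (contDiff_nsq.comp contDiff_fst))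
    exact contDiffAt_const.mul (h.contDiffAt.rpow_const_of_ne (normSq_wC_pos hp).ne')
  refine (contDiffAt_rho L hp).mul (ContDiffAt.comp p hv ?_)
  unfold dil
  refine ContDiffAt.prodMk (contDiffAt_pi.2 fun j => ?_) ((h1.pow 2).mul contDiffAt_snd)
  exact (ofRealCLM.contDiff.contDiffAt.comp p h1).mul
    ((contDiff_apply ℝ ℂ j).contDiffAt.comp p contDiffAt_fst)

theorem rho_one {k : ℕ} {L : ℝ} (hL : 0 < L) {p : Heis n} (h : ‖wC p‖ = L) :
    rho k L (normSq (wC p)) = 1 := by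
  rw [rho_eq, h, div_self hL.ne', one_pow]

theorem dil_one (p : Heis n) : dil 1 p = p := by
  simp [dil]

theorem subLap_K0 {L : ℝ} (hL : 0 < L) {v : Heis n → ℝ} {p : Heis n} (h : ‖wC p‖ = L)
    (hf : ContDiffAt ℝ 2 v p) :
    subLap (K0 L v) p = subLap v p + (4 * p.2 / normSq (wC p)) *
      (D2 v p (Rv p) (Ev p) + (n + 1) * fderiv ℝ v p (Rv p)) := by
  have hp : p ≠ 0 := by
    rintro rfl
    rw [wC_eq_zero.2 rfl, norm_zero] at h; exact hL.ne h
  have hN := (normSq_wC_pos hp).ne'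
  have hr1 : rho 1 L (normSq (wC p)) = 1 := rho_one hL h
  have hrn : rho n L (normSq (wC p)) = 1 := rho_one hL h
  have hκ := fun j c => J2_rhok 1 p hp L j c
  have hρ := fun j c => J2_rhok n p hp L j c
  simp only [hr1, hrn] at hκ hρ
  have hJ := fun j c => (hρ j c).mul ((J2_dil 1 p j c (hκ j c)).comp hf)
  rw [subLap_jets (f := K0 L v) (contDiffAt_K0 hp (by rw [hr1, dil_one]; exact hf)) hJ,
    subLap_eq hf]
  have h0 := congrArg (fun x => x * v p) (rho_harm_sum p hp 1)
  simp only [zero_mul, Finset.sum_mul] at h0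
  have hs := sg_sq_sum p
  have hV1 := congrArg (fderiv ℝ v p) (sg_vec_sum p)
  have hV2 := congrArg (fun x => D2 v p x (Ev p)) (sg_vec_sum p)
  have hV3 := congrArg (Prod.snd) (sg_vec_sum p)
  simp only [map_sum, map_add, map_smul, map_sub, ContinuousLinearMap.sum_apply,
    ContinuousLinearMap.add_apply, ContinuousLinearMap.smul_apply, ContinuousLinearMap.sub_apply,
    smul_eq_mul] at hV1 hV2
  rw [Prod.snd_sum] at hV3
  simp only [Prod.snd_add, Prod.smul_snd, Prod.snd_sub, smul_eq_mul] at hV3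
  have hV3' : ∑ j, (sg p j 1 * (2 * (p.1 j * (starRingEnd ℂ) 1).im) +
      sg p j I * (2 * (p.1 j * (starRingEnd ℂ) I).im)) = nsq p.1 * (2 * p.2) := by
    have := hV3
    simp only [hv, Ev, Rv] at this
    linarith
  have hz : ∑ j, normSq (p.1 j) = nsq p.1 := rfl
  have hc : ∑ j : Fin n, nsq p.1 = n * nsq p.1 := by simp
  have hsym : ∀ j c, D2 v p (Ev p) (hv p j c) = D2 v p (hv p j c) (Ev p) := fun j c =>
    D2_symm hf _ _
  set N := normSq (wC p) with hNdef
  set a := fderiv ℝ v p (Ev p)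
  set b := fderiv ℝ v p ((0, 1) : Heis n)
  set e := D2 v p (Ev p) (Ev p)
  simp only [map_add, map_smul, ContinuousLinearMap.add_apply, ContinuousLinearMap.smul_apply,
    smul_eq_mul, hsym] 
  have e1 : ∀ x, 4 * p.2 / N * x = - (4 / N) * (nsq p.1 * 0 - p.2 * x) := fun x => by ring
  -- linear combination of sums
  have key : ∀ j : Fin n, _ := fun j => True.intro
  clear key
  have tot : ∑ j : Fin n, 
      ((4 * n * (n + 2) * 1 / N^2 * (sg p j 1)^2 - n * 1 / N * (4 * normSq (p.1 j) + 2 * nsq p.1) * normSq 1) + (4 * n * (n + 2) * 1 / N^2 * (sg p j I)^2 - n * 1 / N * (4 * normSq (p.1 j) + 2 * nsq p.1) * normSq I)) * v p = 0 := h0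
  trans (∑ j, (D2 v p (hv p j 1) (hv p j 1) + D2 v p (hv p j I) (hv p j I)))
    + (∑ j : Fin n, 
      ((4 * n * (n + 2) * 1 / N^2 * (sg p j 1)^2 - n * 1 / N * (4 * normSq (p.1 j) + 2 * nsq p.1) * normSq 1) + (4 * n * (n + 2) * 1 / N^2 * (sg p j I)^2 - n * 1 / N * (4 * normSq (p.1 j) + 2 * nsq p.1) * normSq I)) * v p)
    + (-4 * (n + 1) / N) * (∑ j, (sg p j 1 * fderiv ℝ v p (hv p j 1) + sg p j I * fderiv ℝ v p (hv p j I)))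
    + (-4 / N) * (∑ j, (sg p j 1 * D2 v p (hv p j 1) (Ev p) + sg p j I * D2 v p (hv p j I) (Ev p)))
    + (4 / N ^ 2 * e + (8 * n + 12) / N ^ 2 * a + 8 * p.2 / N ^ 2 * b) * (∑ j, (sg p j 1 ^ 2 + sg p j I ^ 2))
    - (8 / N * a) * (∑ j, normSq (p.1 j)) - (4 / N * a) * (∑ j : Fin n, nsq p.1)
    - (4 / N * b) * ∑ j, (sg p j 1 * (2 * (p.1 j * (starRingEnd ℂ) 1).im) +
      sg p j I * (2 * (p.1 j * (starRingEnd ℂ) I).im))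
  · simp only [Finset.mul_sum]
    simp only [← Finset.sum_add_distrib, ← Finset.sum_sub_distrib]
    refine Finset.sum_congr rfl fun j _ => ?_
    simp only [normSq_one, normSq_I]
    push_cast
    field_simp
    ring
  · rw [tot, hV1, hV2, hs, hz, hc, hV3']
    field_simp
    ring
end

section
variable {n : ℕ}

theorem conj_wC_inv (p : Heis n) : ((starRingEnd ℂ) (wC p))⁻¹ = ((normSq (wC p))⁻¹ : ℝ) * wC p := by
  rw [Complex.inv_def]; simp [mul_comm]

theorem inv0_snd (m : Fin n → ℂ) (L : ℝ) (p : Heis n) :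
    (inv0 m L p).2 = L ^ 2 * p.2 / normSq (wC p) := by
  simp only [inv0]
  rw [conj_wC_inv, re_ofReal_mul, wC_re]; ring

theorem nsq_inv0 (m : Fin n → ℂ) (hm : ∀ k, normSq (m k) = 1) (L : ℝ) (p : Heis n) :
    nsq (inv0 m L p).1 = L ^ 2 * nsq p.1 / normSq (wC p) := by
  simp only [inv0, nsq]
  rw [Finset.mul_sum, Finset.sum_div]
  refine Finset.sum_congr rfl fun j _ => ?_
  simp [normSq_mul, hm, normSq_neg]; ring

theorem wC_inv0 (m : Fin n → ℂ) (hm : ∀ k, normSq (m k) = 1) (L : ℝ) (p : Heis n) :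
    wC (inv0 m L p) = ((L ^ 2 : ℝ) : ℂ) * ((starRingEnd ℂ) (wC p))⁻¹ := by
  rw [conj_wC_inv]
  apply Complex.ext
  · rw [wC_re, inv0_snd, re_ofReal_mul, re_ofReal_mul, wC_re]; ring
  · rw [wC_im, nsq_inv0 m hm, im_ofReal_mul, im_ofReal_mul, wC_im]; ring

theorem inv0_inv0 (m : Fin n → ℂ) (hm : ∀ k, normSq (m k) = 1) {L : ℝ} (hL : L ≠ 0) {p : Heis n}
    (hp : p ≠ 0) : inv0 m L (inv0 m L p) = p := by
  have hw := wC_ne hp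
  have hwc : (starRingEnd ℂ) (wC p) ≠ 0 := by simpa using hw
  have hL' : (L : ℂ) ≠ 0 := by exact_mod_cast hL
  have h1 : ((starRingEnd ℂ) (wC (inv0 m L p)))⁻¹ = wC p / L ^ 2 := by
    rw [wC_inv0 m hm]; simp
    field_simp
  refine Prod.ext ?_ ?_
  · funext k
    have h2 : m k * (starRingEnd ℂ) (m k) = 1 := by rw [mul_conj, hm]; simp
    change -(m k) * L * ((starRingEnd ℂ) ((inv0 m L p).1 k) * ((starRingEnd ℂ) (wC (inv0 m L p)))⁻¹) = _
    rw [h1]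
    simp only [inv0, map_mul, map_neg, conj_ofReal, map_inv₀, conj_conj]
    field_simp
    linear_combination (p.1 k) * h2
  · change L ^ 2 * (((starRingEnd ℂ) (wC (inv0 m L p)))⁻¹).re = _
    rw [h1]
    have : wC p / (L:ℂ) ^ 2 = (((L ^ 2)⁻¹ : ℝ) : ℂ) * wC p := by push_cast; field_simp
    rw [this, re_ofReal_mul, wC_re]; field_simp

theorem nsq_dil (r : ℝ) (p : Heis n) : nsq (dil r p).1 = r ^ 2 * nsq p.1 := by
  simp [dil, nsq, normSq_mul, Finset.mul_sum, sq]

theorem wC_dil (r : ℝ) (p : Heis n) : wC (dil r p) = ((r ^ 2 : ℝ) : ℂ) * wC p := by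
  apply Complex.ext
  · rw [wC_re, re_ofReal_mul, wC_re]; rfl
  · rw [wC_im, im_ofReal_mul, wC_im, nsq_dil]

theorem norm_wC_dil (r : ℝ) (p : Heis n) : ‖wC (dil r p)‖ = r ^ 2 * ‖wC p‖ := by
  rw [wC_dil, norm_mul, norm_real, Real.norm_of_nonneg (sq_nonneg r)]

theorem dil_dil (r s : ℝ) (p : Heis n) : dil r (dil s p) = dil (r * s) p := by
  refine Prod.ext (funext fun j => ?_) ?_
  · simp [dil]; ring
  · simp [dil]; ring

theorem dil_zero_left (p : Heis n) : dil 0 p = 0 := by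
  refine Prod.ext (funext fun j => ?_) ?_ <;> simp [dil]

theorem dil_zero_right (r : ℝ) : dil r (0 : Heis n) = 0 := by
  refine Prod.ext (funext fun j => ?_) ?_ <;> simp [dil]

theorem dil_ne {r : ℝ} (hr : r ≠ 0) {p : Heis n} (hp : p ≠ 0) : dil r p ≠ 0 := by
  intro h
  apply hp
  have := congrArg (dil r⁻¹) h
  rwa [dil_dil, inv_mul_cancel₀ hr, dil_one, dil_zero_right] at this

theorem norm_wC_inv0 (m : Fin n → ℂ) (hm : ∀ k, normSq (m k) = 1) (L : ℝ) (p : Heis n) :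
    ‖wC (inv0 m L p)‖ = L ^ 2 / ‖wC p‖ := by
  rw [wC_inv0 m hm, norm_mul, norm_real, Real.norm_of_nonneg (sq_nonneg L), norm_inv, RCLike.norm_conj]
  rfl

theorem inv0_smul (m : Fin n → ℂ) (L r : ℝ) (p : Heis n) :
    inv0 m (r * L) p = dil r (inv0 m L p) := by
  refine Prod.ext (funext fun j => ?_) ?_
  · simp [dil, inv0]; ring
  · simp [dil, inv0]; ring

theorem inv0_dil (m : Fin n → ℂ) (L : ℝ) {r : ℝ} (hr : r ≠ 0) (p : Heis n) :
    inv0 m L (dil r p) = dil r⁻¹ (inv0 m L p) := by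
  have hr' : (r : ℂ) ≠ 0 := by exact_mod_cast hr
  refine Prod.ext (funext fun j => ?_) ?_
  · simp only [inv0, wC_dil]
    simp [dil]; field_simp
  · rw [inv0_snd, wC_dil]
    simp only [dil]; rw [inv0_snd]
    simp [normSq_mul]; field_simp

/-- the sphere-preserving involution. -/
def Sm (m : Fin n → ℂ) (p : Heis n) : Heis n := inv0 m ‖wC p‖ p

theorem Sm_dil (m : Fin n → ℂ) {r : ℝ} (hr : r ≠ 0) (p : Heis n) :
    Sm m (dil r p) = dil r (Sm m p) := by
  unfold Sm
  rw [norm_wC_dil, inv0_dil _ _ hr, inv0_smul, dil_dil]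
  congr 1; field_simp

theorem norm_wC_pos {p : Heis n} (hp : p ≠ 0) : 0 < ‖wC p‖ := norm_pos_iff.2 (wC_ne hp)

theorem norm_wC_Sm (m : Fin n → ℂ) (hm : ∀ k, normSq (m k) = 1) {p : Heis n} (hp : p ≠ 0) :
    ‖wC (Sm m p)‖ = ‖wC p‖ := by
  rw [Sm, norm_wC_inv0 m hm]; have := norm_wC_pos hp; field_simp

theorem Sm_Sm (m : Fin n → ℂ) (hm : ∀ k, normSq (m k) = 1) {p : Heis n} (hp : p ≠ 0) :
    Sm m (Sm m p) = p := by
  rw [Sm, norm_wC_Sm m hm hp, Sm, inv0_inv0 m hm (norm_wC_pos hp).ne' hp]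

theorem inv0_eq_dil_Sm (m : Fin n → ℂ) (L : ℝ) {p : Heis n} (hp : p ≠ 0) :
    inv0 m L p = dil (L / ‖wC p‖) (Sm m p) := by
  rw [Sm, ← inv0_smul]; congr 1; have := norm_wC_pos hp; field_simp

theorem kel_eq (m : Fin n → ℂ) (L : ℝ) (v : Heis n → ℝ) {p : Heis n} (hp : p ≠ 0) :
    kel m L v p = (L / ‖wC p‖) ^ n * v (dil (L / ‖wC p‖) (Sm m p)) := by
  rw [kel, rho_eq, inv0_eq_dil_Sm m L hp]

theorem K0_eq (L : ℝ) (v : Heis n → ℝ) (p : Heis n) :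
    K0 L v p = (L / ‖wC p‖) ^ n * v (dil (L / ‖wC p‖) p) := by
  rw [K0, rho_eq, rho_eq, pow_one]

theorem Sm_ne (m : Fin n → ℂ) (hm : ∀ k, normSq (m k) = 1) {p : Heis n} (hp : p ≠ 0) :
    Sm m p ≠ 0 := by
  intro h
  have := norm_wC_Sm m hm hp
  rw [h, wC_eq_zero.2 rfl, norm_zero] at this
  exact (norm_wC_pos hp).ne this

theorem continuous_dil_left (p : Heis n) : Continuous fun r : ℝ => dil r p := by
  unfold dil
  fun_prop

theorem partC_S (m : Fin n → ℂ) (hm : ∀ k, normSq (m k) = 1) (v : Heis n → ℝ) (hc : Continuous v)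
    (M : ℝ) (H : ∀ L ∈ Set.Ioo 0 M, ∀ p : Heis n, p ≠ 0 → ‖wC p‖ < L → v p ≤ kel m L v p)
    {p : Heis n} (hp : p ≠ 0) (hM : ‖wC p‖ < M) : v (Sm m p) = v p := by
  have key : ∀ p : Heis n, p ≠ 0 → ‖wC p‖ < M → v p ≤ v (Sm m p) := by
    intro p hp hM
    have hpos := norm_wC_pos hp
    have t1 : Tendsto (fun r : ℝ => v (dil r p)) (𝓝[<] 1) (𝓝 (v p)) := by
      have := (hc.comp (continuous_dil_left p)).tendsto 1
      simp only [Function.comp, dil_one] at this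
      exact this.mono_left nhdsWithin_le_nhds
    have t2 : Tendsto (fun r : ℝ => (1 / r ^ 2) ^ n * v (dil (1 / r) (Sm m p))) (𝓝[<] 1)
        (𝓝 (v (Sm m p))) := by
      have h1 : Tendsto (fun r : ℝ => 1 / r) (𝓝 1) (𝓝 1) := by
        have : ContinuousAt (fun r : ℝ => 1 / r) 1 := by fun_prop (disch := norm_num)
        simpa [ContinuousAt] using this
      have h2 := (hc.comp (continuous_dil_left (Sm m p))).tendsto 1
      simp only [Function.comp, dil_one] at h2
      have h3 := h2.comp h1
      have h4 : Tendsto (fun r : ℝ => (1 / r ^ 2) ^ n) (𝓝 1) (𝓝 1) := by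
        have : ContinuousAt (fun r : ℝ => (1 / r ^ 2) ^ n) 1 := by fun_prop (disch := norm_num)
        simpa [ContinuousAt] using this
      have := (h4.mul h3).mono_left (nhdsWithin_le_nhds (s := Set.Iio 1))
      simpa using this
    refine le_of_tendsto_of_tendsto t1 t2 ?_
    have : Set.Ioo (0:ℝ) 1 ∈ 𝓝[<] (1:ℝ) := Ioo_mem_nhdsLT (by norm_num)
    filter_upwards [this] with r hr
    have hr0 : r ≠ 0 := hr.1.ne'
    have h := H ‖wC p‖ ⟨hpos, hM⟩ (dil r p) (dil_ne hr0 hp) (by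
      rw [norm_wC_dil]
      have : r ^ 2 < 1 := by nlinarith [hr.1, hr.2]
      nlinarith)
    rw [kel_eq _ _ _ (dil_ne hr0 hp), norm_wC_dil, Sm_dil m hr0, dil_dil] at h
    have e1 : ‖wC p‖ / (r ^ 2 * ‖wC p‖) = 1 / r ^ 2 := by field_simp
    have e2 : 1 / r ^ 2 * r = 1 / r := by field_simp
    rw [e1, e2] at h
    exact h
  refine le_antisymm ?_ (key p hp hM)
  have := key (Sm m p) (Sm_ne m hm hp) (by rw [norm_wC_Sm m hm hp]; exact hM)
  rwa [Sm_Sm m hm hp] at this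

theorem kel_eq_K0 (m : Fin n → ℂ) (v : Heis n → ℝ) (M L : ℝ) (hL : 0 < L)
    (hS : ∀ p : Heis n, p ≠ 0 → ‖wC p‖ < M → v (Sm m p) = v p) {p : Heis n} (hp : p ≠ 0)
    (h : L ^ 2 / ‖wC p‖ < M) : kel m L v p = K0 L v p := by
  have hpos := norm_wC_pos hp
  have hk : L / ‖wC p‖ ≠ 0 := (div_pos hL hpos).ne'
  rw [kel_eq m L v hp, K0_eq, ← Sm_dil m hk, hS _ (dil_ne hk hp)]
  rw [norm_wC_dil]
  convert h using 1
  field_simp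

theorem partC_R0 (m : Fin n → ℂ) (hm : ∀ k, normSq (m k) = 1) (v : Heis n → ℝ)
    (hc : ContDiff ℝ 2 v) (P : ℝ → ℝ) (hsol : ∀ q, -subLap v q = P (v q)) (M : ℝ)
    (hS : ∀ p : Heis n, p ≠ 0 → ‖wC p‖ < M → v (Sm m p) = v p) {p : Heis n} (hp : p ≠ 0)
    (hM : ‖wC p‖ < M) (ht : p.2 ≠ 0) :
    D2 v p (Rv p) (Ev p) + (n + 1) * fderiv ℝ v p (Rv p) = 0 := by
  set L := ‖wC p‖ with hL
  have hpos : 0 < L := norm_wC_pos hp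
  have h1 := subLap_K0 hpos hL.symm hc.contDiffAt
  have h2 := subLap_kel m hm L p hp v hc.contDiffAt
  rw [rho_one hpos hL.symm] at h2
  have h3 : kel m L v =ᶠ[𝓝 p] K0 L v := by
    have hcw : Continuous fun q : Heis n => ‖wC q‖ := (contDiff_wC (k := 0)).continuous.norm
    have hca : ContinuousAt (fun q : Heis n => L ^ 2 / ‖wC q‖) p :=
      continuousAt_const.div hcw.continuousAt hpos.ne'
    have : ∀ᶠ q in 𝓝 p, L ^ 2 / ‖wC q‖ < M := by
      refine hca.eventually (gt_mem_nhds ?_)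
      show L ^ 2 / L < M
      rwa [sq, mul_div_assoc, div_self hpos.ne', mul_one]
    filter_upwards [this, isOpen_ne.mem_nhds hp] with q hq hq0
    exact kel_eq_K0 m v M L hpos hS hq0 hq
  have h4 := subLap_congr h3
  have h5 : v (inv0 m L p) = v p := hS p hp hM
  have h6 : subLap v (inv0 m L p) = subLap v p := by
    have a := hsol (inv0 m L p)
    have b := hsol p
    rw [h5] at a; linarith
  rw [h2, h1, h6] at h4
  have hN : normSq (wC p) = L ^ 2 := by rw [normSq_eq_norm_sq]
  rw [hN, div_self (by positivity)] at h4
  have h7 : 4 * p.2 / L ^ 2 ≠ 0 := by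
    refine div_ne_zero (mul_ne_zero (by norm_num) ht) (by positivity)
  have h8 : 4 * p.2 / L ^ 2 * (D2 v p (Rv p) (Ev p) + (n + 1) * fderiv ℝ v p (Rv p)) = 0 := by
    linarith
  exact (mul_eq_zero.1 h8).resolve_left h7

theorem continuous_Rv : Continuous (Rv : Heis n → Heis n) := by unfold Rv; fun_prop
theorem continuous_Ev : Continuous (Ev : Heis n → Heis n) := by unfold Ev; fun_prop

theorem partC_R1 (m : Fin n → ℂ) (hm : ∀ k, normSq (m k) = 1) (v : Heis n → ℝ)
    (hc : ContDiff ℝ 2 v) (P : ℝ → ℝ) (hsol : ∀ q, -subLap v q = P (v q)) (M : ℝ)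
    (hS : ∀ p : Heis n, p ≠ 0 → ‖wC p‖ < M → v (Sm m p) = v p) {p : Heis n} (hM : ‖wC p‖ < M) :
    D2 v p (Rv p) (Ev p) + (n + 1) * fderiv ℝ v p (Rv p) = 0 := by
  have hd1 : Continuous (fderiv ℝ v) := hc.continuous_fderiv (by norm_num)
  have hd2 : Continuous (D2 v) := (hc.fderiv_right (m := 1) (by norm_num)).continuous_fderiv (by norm_num)
  have hG : Continuous fun q : Heis n => D2 v q (Rv q) (Ev q) + (n + 1) * fderiv ℝ v q (Rv q) :=
    ((hd2.clm_apply continuous_Rv).clm_apply continuous_Ev).add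
      (continuous_const.mul (hd1.clm_apply continuous_Rv))
  by_cases ht : p.2 = 0
  · have hl : Continuous fun ε : ℝ => ((p.1, ε) : Heis n) := by fun_prop
    have hp0 : ((p.1, (0:ℝ)) : Heis n) = p := Prod.ext rfl ht.symm
    have t1 : Tendsto (fun ε : ℝ => (fun q : Heis n => D2 v q (Rv q) (Ev q) + (n + 1) * fderiv ℝ v q (Rv q)) (p.1, ε))
        (𝓝[≠] 0) (𝓝 ((fun q : Heis n => D2 v q (Rv q) (Ev q) + (n + 1) * fderiv ℝ v q (Rv q)) p)) := by
      have := (hG.comp hl).tendsto 0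
      simp only [Function.comp, hp0] at this
      exact this.mono_left nhdsWithin_le_nhds
    have hcw : Continuous fun q : Heis n => ‖wC q‖ := (contDiff_wC (k := 0)).continuous.norm
    have hev : ∀ᶠ ε in 𝓝[≠] (0:ℝ), (fun q : Heis n => D2 v q (Rv q) (Ev q) + (n + 1) * fderiv ℝ v q (Rv q)) (p.1, ε) = 0 := by
      have h1 : ∀ᶠ ε in 𝓝 (0:ℝ), ‖wC ((p.1, ε) : Heis n)‖ < M :=
        (hcw.comp hl).continuousAt.eventually (gt_mem_nhds (by simpa [Function.comp, hp0] using hM))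
      filter_upwards [nhdsWithin_le_nhds h1, self_mem_nhdsWithin] with ε h1 h2
      refine partC_R0 m hm v hc P hsol M hS ?_ h1 h2
      intro h
      exact h2 (congrArg Prod.snd h)
    have t2 : Tendsto (fun ε : ℝ => (fun q : Heis n => D2 v q (Rv q) (Ev q) + (n + 1) * fderiv ℝ v q (Rv q)) (p.1, ε))
        (𝓝[≠] 0) (𝓝 0) := (tendsto_congr' hev).2 tendsto_const_nhds
    exact tendsto_nhds_unique t1 t2
  · refine partC_R0 m hm v hc P hsol M hS ?_ hM ht
    rintro rfl; exact ht rfl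

/-- `Rv` as a continuous linear map. -/
def RvL : Heis n →L[ℝ] Heis n :=
  LinearMap.toContinuousLinearMap
  { toFun := Rv
    map_add' := fun g h => by ext <;> simp [Rv, mul_add]
    map_smul' := fun r g => by ext <;> simp [Rv, mul_left_comm] }

theorem RvL_apply (p : Heis n) : RvL p = Rv p := rfl

theorem hasDerivAt_dil (p : Heis n) (r : ℝ) :
    HasDerivAt (fun r : ℝ => dil r p) (p.1, 2 * r * p.2) r := by
  unfold dil
  refine HasDerivAt.prodMk (hasDerivAt_pi.2 fun j => ?_) ?_
  · simpa using ((hasDerivAt_id r).ofReal_comp).mul_const (p.1 j)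
  · simpa using ((hasDerivAt_id r).pow 2).mul_const p.2

theorem partC_R (hn : 1 ≤ n) (m : Fin n → ℂ) (hm : ∀ k, normSq (m k) = 1) (v : Heis n → ℝ)
    (hc : ContDiff ℝ 2 v) (P : ℝ → ℝ) (hsol : ∀ q, -subLap v q = P (v q)) (M : ℝ)
    (hS : ∀ p : Heis n, p ≠ 0 → ‖wC p‖ < M → v (Sm m p) = v p) {p : Heis n} (hM : ‖wC p‖ < M) :
    fderiv ℝ v p (Rv p) = 0 := by
  set f : ℝ → ℝ := fun r => r ^ n * fderiv ℝ v (dil r p) (Rv (dil r p)) with hf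
  have hd : ∀ r : ℝ, HasDerivAt f (n * r ^ (n - 1) * fderiv ℝ v (dil r p) (Rv (dil r p)) +
      r ^ n * (D2 v (dil r p) (p.1, 2 * r * p.2) (Rv (dil r p)) +
        fderiv ℝ v (dil r p) (Rv (p.1, 2 * r * p.2)))) r := by
    intro r
    have h1 : DifferentiableAt ℝ (fun q => fderiv ℝ v q (Rv q)) (dil r p) := by
      have h2 : DifferentiableAt ℝ (fderiv ℝ v) (dil r p) :=
        (hc.fderiv_right (m := 1) (by norm_num)).contDiffAt.differentiableAt (by norm_num)
      exact h2.clm_apply RvL.differentiableAt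
    have h3 := h1.hasFDerivAt.comp_hasDerivAt r (hasDerivAt_dil p r)
    have h4 := fderiv_field (f := v) hc.contDiffAt (V := Rv) (V' := RvL)
      (RvL.hasFDerivAt (x := dil r p)) (p.1, 2 * r * p.2)
    rw [h4] at h3
    exact (hasDerivAt_pow n r).mul h3
  have hz : ∀ r ∈ Set.Ico (0:ℝ) 1, HasDerivWithinAt f 0 (Set.Ici r) r := by
    intro r hr
    have h0 := (hd r).hasDerivWithinAt (s := Set.Ici r)
    refine h0.congr_deriv ?_
    rcases eq_or_lt_of_le hr.1 with h | h
    · rw [← h, dil_zero_left]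
      have : Rv (0 : Heis n) = 0 := map_zero RvL
      have hn0 : n ≠ 0 := by omega
      rw [this, zero_pow hn0]; simp
    · have hM' : ‖wC (dil r p)‖ < M := by
        rw [norm_wC_dil]
        have : r ^ 2 ≤ 1 := by nlinarith [hr.1, hr.2]
        nlinarith [norm_nonneg (wC p)]
      have h4 := partC_R1 m hm v hc P hsol M hS hM'
      rw [D2_symm hc.contDiffAt] at h4
      have e1 : Ev (dil r p) = r • ((p.1, 2 * r * p.2) : Heis n) := by
        refine Prod.ext (funext fun j => ?_) ?_
        · simp [Ev, dil]
        · simp [Ev, dil]; ring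
      have e2 : Rv (dil r p) = r • Rv ((p.1, 2 * r * p.2) : Heis n) := by
        refine Prod.ext (funext fun j => ?_) ?_
        · simp [Rv, dil]; ring
        · simp [Rv]
      have e3 : (r:ℝ) ^ n = r ^ (n - 1) * r := by
        rw [← pow_succ]; congr 1; omega
      have e4 : fderiv ℝ v (dil r p) (Rv (dil r p)) = r * fderiv ℝ v (dil r p) (Rv (p.1, 2 * r * p.2)) := by
        rw [e2, map_smul, smul_eq_mul]
      rw [e1, map_smul, ContinuousLinearMap.smul_apply, smul_eq_mul] at h4
      rw [e3]
      have := congrArg (fun x => r ^ (n - 1) * x) h4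
      simp only [mul_zero] at this
      rw [e4] at this ⊢
      linear_combination this
  have := constant_of_has_deriv_right_zero (f := f) (a := 0) (b := 1)
    (fun r _ => (hd r).continuousAt.continuousWithinAt) hz 1 (by simp)
  simp only [hf, dil_one, one_pow, one_mul] at this
  rw [this, zero_pow (by omega), zero_mul]
end

section
variable {n : ℕ}

theorem norm_wC_rt (m : Fin n → ℂ) (hm : ∀ k, normSq (m k) = 1) (p : Heis n) :
    wC (rt m p) = wC p := by
  simp [wC, rt, nsq, normSq_mul, hm]

theorem rt_hasDerivAt (p : Heis n) (θ : ℝ) :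
    HasDerivAt (fun θ : ℝ => rt (fun _ => exp (I * θ)) p) (Rv (rt (fun _ => exp (I * θ)) p)) θ := by
  unfold rt Rv
  refine HasDerivAt.prodMk (hasDerivAt_pi.2 fun j => ?_) (hasDerivAt_const _ _)
  have h1 : HasDerivAt (fun θ : ℝ => I * (θ:ℂ)) I θ := by
    simpa using ((hasDerivAt_id θ).ofReal_comp).const_mul I
  have h2 := (h1.cexp).mul_const (p.1 j)
  refine h2.congr_deriv ?_
  ring

theorem normSq_exp_I (θ : ℝ) : normSq (exp (I * θ)) = 1 := by
  rw [normSq_eq_norm_sq, mul_comm, norm_exp_ofReal_mul_I, one_pow]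

theorem rot_inv {v : Heis n → ℝ} (hv : ContDiff ℝ 2 v) (p : Heis n)
    (h : ∀ q, ‖wC q‖ = ‖wC p‖ → fderiv ℝ v q (Rv q) = 0) (θ : ℝ) :
    v (rt (fun _ => exp (I * θ)) p) = v p := by
  have hd : ∀ θ : ℝ, HasDerivAt (fun θ : ℝ => v (rt (fun _ => exp (I * θ)) p)) 0 θ := by
    intro θ
    have h1 := (hv.contDiffAt.differentiableAt (by norm_num)).hasFDerivAt.comp_hasDerivAt θ
      (rt_hasDerivAt p θ)
    rwa [h] at h1
    rw [norm_wC_rt _ (fun _ => normSq_exp_I θ)]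
  have := is_const_of_deriv_eq_zero (fun x => (hd x).differentiableAt) (fun x => (hd x).deriv) θ 0
  simp only [this]
  congr 1
  simp [rt]

theorem rot_deriv {v : Heis n → ℝ} (hv : ContDiff ℝ 2 v)
    (h : ∀ (θ : ℝ) p, v (rt (fun _ => exp (I * θ)) p) = v p) (p : Heis n) :
    fderiv ℝ v p (Rv p) = 0 := by
  have h0 : rt (fun _ => exp (I * (0:ℝ))) p = p := by simp [rt]
  have h1 := rt_hasDerivAt p 0
  have h3 : HasFDerivAt v (fderiv ℝ v p) (rt (fun _ => exp (I * (0:ℝ))) p) := by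
    rw [h0]; exact (hv.contDiffAt.differentiableAt (by norm_num)).hasFDerivAt
  have h4 := h3.comp_hasDerivAt (0:ℝ) h1
  rw [h0] at h4
  have h2 : HasDerivAt (v ∘ fun θ : ℝ => rt (fun _ => exp (I * θ)) p) 0 0 := by
    have : (v ∘ fun θ : ℝ => rt (fun _ => exp (I * θ)) p) = fun _ => v p := funext fun θ => h θ p
    rw [this]; exact hasDerivAt_const _ _
  exact h4.unique h2

/-- coordinate conjugation. -/
def cj (p : Heis n) : Heis n := (fun k => (starRingEnd ℂ) (p.1 k), p.2)

theorem contDiff_cj {k : WithTop ℕ∞} : ContDiff ℝ k (cj : Heis n → Heis n) := by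
  unfold cj
  refine ContDiff.prodMk (contDiff_pi.2 fun j => ?_) contDiff_snd
  exact conjCLE.toContinuousLinearMap.contDiff.comp ((contDiff_apply ℝ ℂ j).comp contDiff_fst)

theorem Rv_sum (q : Heis n) : ∑ j, ((q.1 j).im • hv q j 1 - (q.1 j).re • hv q j I)
     = - Rv q + (2 * nsq q.1) • ((0, 1) : Heis n) := by
  refine Prod.ext ?_ ?_
  · funext k
    rw [Prod.fst_sum, Finset.sum_apply, Finset.sum_eq_single k]
    · simp only [hv, Rv, Prod.fst_sub, Prod.smul_fst, Pi.sub_apply, Pi.smul_apply,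
        Pi.single_eq_same]
      apply Complex.ext <;> simp
    · intro b _ hb
      simp [hv, Ne.symm hb]
    · simp
  · rw [Prod.snd_sum]
    have : ∀ j, ((q.1 j).im • hv q j 1 - (q.1 j).re • hv q j I).2 = 2 * normSq (q.1 j) := by
      intro j
      simp [hv, normSq_apply]; ring
    rw [Finset.sum_congr rfl fun j _ => this j, ← Finset.mul_sum, sum_normSq]
    simp [Rv]

theorem subLap_cj {f : Heis n → ℝ} (hf : ContDiff ℝ 2 f) (hR : ∀ q, fderiv ℝ f q (Rv q) = 0)
    (p : Heis n) : subLap (fun q => f (cj q)) p = subLap f (cj p) := by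
  set q := cj p with hq
  have hT : D2 f q (Rv q) ((0, 1) : Heis n) = 0 := by
    have h4 := fderiv_field (f := f) (p := q) hf.contDiffAt (V := Rv) (V' := RvL)
      (RvL.hasFDerivAt (x := q)) (0, 1)
    have h5 : (fun q => fderiv ℝ f q (Rv q)) = fun _ => 0 := funext hR
    rw [h5] at h4
    have h6 : RvL ((0, 1) : Heis n) = 0 := by
      rw [RvL_apply]; ext <;> simp [Rv]
    rw [h6, D2_symm hf.contDiffAt] at h4
    simpa using h4.symm
  have hl : ∀ j c (ε : ℝ), cj (p + ε • hv p j c) = q + ε • ((Pi.single j ((starRingEnd ℂ) c),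
      2 * (p.1 j * (starRingEnd ℂ) c).im) : Heis n) := by
    intro j c ε
    refine Prod.ext (funext fun k => ?_) ?_
    · by_cases h : k = j
      · subst h; simp [cj, hv, hq]
      · simp [cj, hv, hq, h]
    · simp [cj, hv, hq]
  have hJ : ∀ j c, J2 (fun ε : ℝ => f (cj (p + ε • hv p j c))) _ _ _ := fun j c =>
    ((J2.line q ((Pi.single j ((starRingEnd ℂ) c),
      2 * (p.1 j * (starRingEnd ℂ) c).im) : Heis n)).comp hf.contDiffAt).congr
        (Eventually.of_forall fun ε => by simp only [hl])
  rw [subLap_jets (f := fun q => f (cj q)) (hf.contDiffAt.comp p contDiff_cj.contDiffAt) hJ,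
    subLap_eq hf.contDiffAt]
  have hs := congrArg (fun x => D2 f q x ((0, 1) : Heis n)) (Rv_sum q)
  simp only [map_sum, map_add, map_smul, map_sub, map_neg, ContinuousLinearMap.sum_apply,
    ContinuousLinearMap.add_apply, ContinuousLinearMap.smul_apply, ContinuousLinearMap.sub_apply,
    ContinuousLinearMap.neg_apply, smul_eq_mul, hT] at hs
  have e1 : ∀ j, ((Pi.single j ((starRingEnd ℂ) 1), 2 * (p.1 j * (starRingEnd ℂ) 1).im) : Heis n)
      = hv q j 1 - (4 * (q.1 j).im) • ((0, 1) : Heis n) := by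
    intro j
    refine Prod.ext ?_ ?_
    · simp [hv]
    · simp [hv, hq, cj]; ring
  have e2 : ∀ j, ((Pi.single j ((starRingEnd ℂ) I), 2 * (p.1 j * (starRingEnd ℂ) I).im) : Heis n)
      = -(hv q j I + (4 * (q.1 j).re) • ((0, 1) : Heis n)) := by
    intro j
    refine Prod.ext ?_ ?_
    · simp [hv, Pi.single_neg]
    · simp [hv, hq, cj]; ring
  simp only [e1, e2, map_zero, add_zero]
  have hsym : ∀ x, D2 f q ((0, 1) : Heis n) x = D2 f q x ((0, 1) : Heis n) := fun x =>
    D2_symm hf.contDiffAt _ _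
  simp only [map_add, map_smul, map_sub, map_neg, 
    ContinuousLinearMap.add_apply, ContinuousLinearMap.smul_apply, ContinuousLinearMap.sub_apply,
    ContinuousLinearMap.neg_apply, smul_eq_mul, hsym, neg_neg]
  rw [← sub_eq_zero, ← Finset.sum_sub_distrib]
  set e := D2 f q ((0, 1) : Heis n) ((0, 1) : Heis n)
  have hz : ∑ j, normSq (q.1 j) = nsq q.1 := rfl
  trans (-8) * ∑ j, ((q.1 j).im * D2 f q (hv q j 1) ((0, 1) : Heis n) - (q.1 j).re * D2 f q (hv q j I) ((0, 1) : Heis n))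
    + 16 * e * ∑ j, normSq (q.1 j)
  · rw [Finset.mul_sum, Finset.mul_sum, ← Finset.sum_add_distrib]
    refine Finset.sum_congr rfl fun j _ => ?_
    rw [normSq_apply]; ring
  · rw [hs, hz]; ring

/-- unique continuation (proved below). -/
def UCprop (n : ℕ) (P : ℝ → ℝ) : Prop :=
  ∀ v₁ v₂ : Heis n → ℝ, ContDiff ℝ (⊤ : ℕ∞) v₁ → ContDiff ℝ (⊤ : ℕ∞) v₂ →
    (∀ q, 0 < v₁ q) → (∀ q, 0 < v₂ q) → (∀ q, -subLap v₁ q = P (v₁ q)) →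
    (∀ q, -subLap v₂ q = P (v₂ q)) → v₁ =ᶠ[𝓝 0] v₂ → v₁ = v₂

theorem Sm_eq_rt (m : Fin n → ℂ) {p : Heis n} (hp : p ≠ 0) :
    ∃ θ : ℝ, Sm m p = rt (fun _ => exp (I * θ)) (rt (fun k => -(m k)) (cj p)) := by
  have hw := norm_wC_pos hp
  set a : ℂ := ‖wC p‖ * ((starRingEnd ℂ) (wC p))⁻¹
  have ha : ‖a‖ = 1 := by
    simp only [a, norm_mul, norm_inv, RCLike.norm_conj, norm_real, norm_norm]
    field_simp
  refine ⟨a.arg, ?_⟩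
  have h1 : exp (I * a.arg) = a := by
    have := norm_mul_exp_arg_mul_I a
    rw [ha, ofReal_one, one_mul, mul_comm] at this; exact this
  refine Prod.ext (funext fun k => ?_) ?_
  · simp only [Sm, inv0, rt, cj, h1, a]; ring
  · simp only [Sm, rt, cj]
    rw [inv0_snd, normSq_eq_norm_sq]; field_simp

theorem global_S (hn : 1 ≤ n) (P : ℝ → ℝ) (UC : UCprop n P) (m : Fin n → ℂ)
    (hm : ∀ k, normSq (m k) = 1) (v : Heis n → ℝ)
    (hc : ContDiff ℝ (⊤ : ℕ∞) v) (hpos : ∀ q, 0 < v q) (hsol : ∀ q, -subLap v q = P (v q)) (M : ℝ)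
    (hM : 0 < M)
    (hS : ∀ p : Heis n, p ≠ 0 → ‖wC p‖ < M → v (Sm m p) = v p) {p : Heis n} (hp : p ≠ 0) :
    v (Sm m p) = v p := by
  have hc2 : ContDiff ℝ 2 v := contDiff_infty.1 hc 2
  have hm' : ∀ k, normSq (-(m k)) = 1 := fun k => by rw [normSq_neg, hm]
  have hcw : Continuous fun q : Heis n => ‖wC q‖ := (contDiff_wC (k := 0)).continuous.norm
  have hball : ∀ᶠ q in 𝓝 (0 : Heis n), ‖wC q‖ < M := by
    refine hcw.continuousAt.eventually (gt_mem_nhds ?_)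
    simpa [wC_eq_zero.2 rfl] using hM
  have hrot0 : ∀ (θ : ℝ) (q : Heis n), ‖wC q‖ < M → v (rt (fun _ => exp (I * θ)) q) = v q := by
    intro θ q hq
    refine rot_inv hc2 q (fun q' hq' => ?_) θ
    exact partC_R hn m hm v hc2 P hsol M hS (by rw [hq']; exact hq)
  have hrot : ∀ (θ : ℝ) (q : Heis n), v (rt (fun _ => exp (I * θ)) q) = v q := by
    intro θ
    have := UC (fun q => v (rt (fun _ => exp (I * θ)) q)) v (hc.comp (contDiff_rt _)) hc
      (fun q => hpos _) hpos (fun q => by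
        rw [subLap_rt _ (fun _ => normSq_exp_I θ) q hc2.contDiffAt]; exact hsol _) hsol
        (by filter_upwards [hball] with q hq using hrot0 θ q hq)
    intro q
    exact congrFun this q
  have hS0 : ∀ q : Heis n, q ≠ 0 → v (Sm m q) = v (rt (fun k => -(m k)) (cj q)) := by
    intro q hq
    obtain ⟨θ, hθ⟩ := Sm_eq_rt m hq
    rw [hθ, hrot]
  set v1 : Heis n → ℝ := fun q => v (rt (fun k => -(m k)) q) with hv1
  have hv1c : ContDiff ℝ (⊤ : ℕ∞) v1 := hc.comp (contDiff_rt _)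
  have hv1c2 : ContDiff ℝ 2 v1 := hc2.comp (contDiff_rt _)
  have hv1R : ∀ q, fderiv ℝ v1 q (Rv q) = 0 := by
    refine rot_deriv hv1c2 fun θ q => ?_
    have : rt (fun k => -(m k)) (rt (fun _ => exp (I * θ)) q) =
        rt (fun _ => exp (I * θ)) (rt (fun k => -(m k)) q) := by
      refine Prod.ext (funext fun k => ?_) rfl
      simp only [rt]; ring
    simp only [hv1]; rw [this, hrot]
  have := UC (fun q => v1 (cj q)) v (hv1c.comp contDiff_cj) hc (fun q => hpos _) hpos
    (fun q => by
      rw [subLap_cj hv1c2 hv1R, hv1, subLap_rt _ hm' _ hc2.contDiffAt]; exact hsol _) hsol (by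
      filter_upwards [hball] with q hq
      by_cases h0 : q = 0
      · subst h0
        simp only [hv1]; congr 1
        ext <;> simp [rt, cj]
      · rw [hv1, ← hS q h0 hq, hS0 q h0])
  rw [hS0 p hp]
  exact congrFun this p
end

section
variable {n : ℕ}

theorem J2.nonneg_of_min {h : ℝ → ℝ} {a b c : ℝ} (H : J2 h a b c) (hm : IsLocalMin h 0) :
    0 ≤ c := by
  by_contra hc
  push Not at hc
  obtain ⟨h0, k, k0, k1, k2⟩ := H
  have hd : deriv h =ᶠ[𝓝 0] k := by filter_upwards [k1] with x hx using hx.deriv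
  have hdd : deriv (deriv h) 0 = c := by rw [hd.deriv_eq, k2.deriv]
  have h1 : deriv h 0 = 0 := hm.deriv_eq_zero
  have hM := isLocalMax_of_deriv_deriv_neg (by rw [hdd]; exact hc) h1
    k1.self_of_nhds.continuousAt
  have : h =ᶠ[𝓝 0] fun _ => h 0 := by
    filter_upwards [hm, hM] with x hx hy using le_antisymm hy hx
  have h3 : deriv h =ᶠ[𝓝 0] fun _ => 0 := by
    filter_upwards [this.eventually_nhds] with x hx
    rw [Filter.EventuallyEq.deriv_eq hx]; simp
  rw [h3.deriv_eq] at hdd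
  simp at hdd
  linarith

theorem subLap_nonneg_of_min {f : Heis n → ℝ} {p : Heis n} (hf : ContDiffAt ℝ 2 f p)
    (hm : IsLocalMin f p) : 0 ≤ subLap f p := by
  rw [subLap_eq hf]
  have key : ∀ v : Heis n, 0 ≤ D2 f p v v := by
    intro v
    have hJ := J2.comp (J2.line p v) hf
    have := hJ.nonneg_of_min (by
      have hc : ContinuousAt (fun ε : ℝ => p + ε • v) 0 := by fun_prop
      have h2 : Tendsto (fun ε : ℝ => p + ε • v) (𝓝 0) (𝓝 p) := by simpa [ContinuousAt] using hc
      have h3 := h2.eventually hm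
      show ∀ᶠ ε in 𝓝 (0:ℝ), _
      filter_upwards [h3] with ε hε
      simpa using hε)
    simpa using this
  exact Finset.sum_nonneg fun j _ => add_nonneg (key _) (key _)

theorem D2_add {f g : Heis n → ℝ} {p : Heis n} (hf : ContDiffAt ℝ 2 f p) (hg : ContDiffAt ℝ 2 g p)
    (v : Heis n) : D2 (fun q => f q + g q) p v v = D2 f p v v + D2 g p v v := by
  have h1 := J2.comp (J2.line p v) hf
  have h2 := J2.comp (J2.line p v) hg
  have := D2_line (hf.add hg) (h1.add h2)
  simpa using this

theorem D2_smul {f : Heis n → ℝ} {p : Heis n} (hf : ContDiffAt ℝ 2 f p) (a : ℝ)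
    (v : Heis n) : D2 (fun q => a * f q) p v v = a * D2 f p v v := by
  have h1 := J2.comp (J2.line p v) hf
  have := D2_line (contDiffAt_const.mul hf) ((J2.const a).mul h1)
  simpa using this

theorem subLap_add {f g : Heis n → ℝ} {p : Heis n} (hf : ContDiffAt ℝ 2 f p)
    (hg : ContDiffAt ℝ 2 g p) : subLap (fun q => f q + g q) p = subLap f p + subLap g p := by
  rw [subLap_eq hf, subLap_eq hg, subLap_eq (hf.add hg), ← Finset.sum_add_distrib]
  refine Finset.sum_congr rfl fun j _ => ?_
  rw [D2_add hf hg, D2_add hf hg]; ring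

theorem subLap_smul {f : Heis n → ℝ} {p : Heis n} (hf : ContDiffAt ℝ 2 f p) (a : ℝ) :
    subLap (fun q => a * f q) p = a * subLap f p := by
  rw [subLap_eq hf, subLap_eq (contDiffAt_const.mul hf), Finset.mul_sum]
  refine Finset.sum_congr rfl fun j _ => ?_
  rw [D2_smul hf, D2_smul hf]; ring

theorem subLap_const (a : ℝ) (p : Heis n) : subLap (fun _ => a) p = 0 := by
  rw [subLap_jets contDiffAt_const (a := fun _ _ => a) (b := fun _ _ => 0) (c := fun _ _ => 0)
    (fun j x => J2.const a)]
  simp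

theorem subLap_nsq (p : Heis n) : subLap (fun q : Heis n => nsq q.1) p = 4 * n := by
  have hc : ContDiffAt ℝ 2 (fun q : Heis n => nsq q.1) p := (contDiff_nsq.comp contDiff_fst).contDiffAt
  rw [subLap_jets hc (a := fun _ _ => nsq p.1) (b := fun j c => 2 * (p.1 j * (starRingEnd ℂ) c).re)
    (c := fun j c => 2 * normSq c)]
  · simp; ring
  · intro j c
    have h := J2.quad (nsq p.1) (2 * (p.1 j * (starRingEnd ℂ) c).re) (2 * normSq c)
    refine h.congr (Eventually.of_forall fun ε => ?_)
    have : (p + ε • hv p j c).1 = p.1 + Pi.single j (ε • c) := by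
      show p.1 + ε • (Pi.single j c : Fin n → ℂ) = _
      rw [← Pi.single_smul]
    simp only [this]
    rw [nsq_add_single]
    simp
    ring

theorem continuous_N : Continuous fun q : Heis n => ‖wC q‖ := (contDiff_wC (k := 0)).continuous.norm

theorem nsq_le_N (p : Heis n) : nsq p.1 ≤ ‖wC p‖ := by
  have := abs_im_le_norm (wC p)
  rw [wC_im] at this
  exact (le_abs_self _).trans this

theorem abs_snd_le_N (p : Heis n) : |p.2| ≤ ‖wC p‖ := by
  have := abs_re_le_norm (wC p)
  rwa [wC_re] at this

theorem normSq_le_nsq (z : Fin n → ℂ) (j : Fin n) : normSq (z j) ≤ nsq z :=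
  Finset.single_le_sum (f := fun k => normSq (z k)) (fun k _ => normSq_nonneg _) (Finset.mem_univ j)

theorem isCompact_N (R : ℝ) : IsCompact {p : Heis n | ‖wC p‖ ≤ R} := by
  refine Metric.isCompact_of_isClosed_isBounded (isClosed_le continuous_N continuous_const) ?_
  refine (Metric.isBounded_closedBall (x := (0 : Heis n)) (r := max (Real.sqrt R) R)).subset ?_
  intro p hp
  rw [Set.mem_setOf_eq] at hp
  rw [mem_closedBall_zero_iff, Prod.norm_def]
  refine max_le_max ?_ ((Real.norm_eq_abs p.2).trans_le ((abs_snd_le_N p).trans hp))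
  refine (pi_norm_le_iff_of_nonneg (Real.sqrt_nonneg _)).2 fun j => ?_
  refine Real.le_sqrt_of_sq_le ?_
  rw [← normSq_eq_norm_sq]
  exact (normSq_le_nsq p.1 j).trans ((nsq_le_N p).trans hp)

theorem wmp (hn : 1 ≤ n) {K U : Set (Heis n)} (hK : IsCompact K) (hU : IsOpen U) (hUK : U ⊆ K)
    {f : Heis n → ℝ} (hf : ContinuousOn f K) (hf2 : ∀ p ∈ U, ContDiffAt ℝ 2 f p)
    (hL : ∀ p ∈ U, subLap f p ≤ 0) (hb : ∀ p ∈ K, p ∉ U → 0 ≤ f p) : ∀ p ∈ K, 0 ≤ f p := by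
  intro p0 hp0
  by_contra hneg
  push Not at hneg
  have hnc : Continuous fun q : Heis n => nsq q.1 := (contDiff_nsq (k := 0)).continuous.comp continuous_fst
  obtain ⟨C, hC⟩ := hK.exists_bound_of_continuousOn hnc.continuousOn
  set ε : ℝ := -f p0 / (2 * (|C| + 1)) with hε
  have hpos : 0 < |C| + 1 := by positivity
  have hε0 : 0 < ε := by rw [hε]; apply div_pos <;> linarith
  have hεC : ε * (|C| + 1) = - f p0 / 2 := by rw [hε]; field_simp
  set g : Heis n → ℝ := fun q => f q + (-ε) * nsq q.1 with hg
  obtain ⟨p1, hp1, hmin⟩ := hK.exists_isMinOn ⟨p0, hp0⟩ (f := g)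
    (hf.add (continuous_const.mul hnc).continuousOn)
  have hlt : g p1 ≤ f p0 := (hmin hp0).trans (by
    have := mul_nonneg hε0.le (nsq_nonneg p0.1)
    simp only [hg]; linarith)
  have hp1U : p1 ∈ U := by
    by_contra h
    have h1 := hb p1 hp1 h
    have h2 := hC p1 hp1
    rw [Real.norm_eq_abs] at h2
    have h3 : nsq p1.1 ≤ |C| + 1 := (le_abs_self _).trans (h2.trans ((le_abs_self C).trans (by linarith)))
    have h4 := mul_le_mul_of_nonneg_left h3 hε0.le
    simp only [hg] at hlt
    nlinarith
  have hloc : IsLocalMin g p1 := hmin.isLocalMin (mem_of_superset (hU.mem_nhds hp1U) hUK)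
  have hnsq : ContDiffAt ℝ 2 (fun q : Heis n => nsq q.1) p1 :=
    (contDiff_nsq.comp contDiff_fst).contDiffAt
  have h1 := subLap_nonneg_of_min ((hf2 p1 hp1U).add (contDiffAt_const.mul hnsq)) hloc
  rw [subLap_add (hf2 p1 hp1U) (contDiffAt_const.mul hnsq), subLap_smul hnsq, subLap_nsq] at h1
  have h2 := hL p1 hp1U
  have h3 : (1:ℝ) ≤ n := by exact_mod_cast hn
  nlinarith

theorem hermInner_abs (a b : Fin n → ℂ) : ‖hermInner a b‖ ^ 2 ≤ nsq a * nsq b := by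
  have h1 : ‖hermInner a b‖ ≤ ∑ j, ‖a j‖ * ‖b j‖ := by
    refine (norm_sum_le _ _).trans_eq (Finset.sum_congr rfl fun j _ => ?_)
    rw [norm_mul, RCLike.norm_conj]
  have h2 := Finset.sum_mul_sq_le_sq_mul_sq Finset.univ (fun j => ‖a j‖) (fun j => ‖b j‖)
  have h0 : 0 ≤ ‖hermInner a b‖ := norm_nonneg _
  calc ‖hermInner a b‖ ^ 2 ≤ (∑ j, ‖a j‖ * ‖b j‖) ^ 2 := by gcongr
    _ ≤ _ := h2
    _ = nsq a * nsq b := by simp [nsq, normSq_eq_norm_sq]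

theorem nsq_add (a b : Fin n → ℂ) : nsq (a + b) = nsq a + nsq b + 2 * (hermInner a b).re := by
  have := hermInner_self (a + b)
  rw [hermInner_add_left, hermInner_add_right, hermInner_add_right, hermInner_self, hermInner_self,
    ← hermInner_conj a b] at this
  have := congrArg Complex.re this
  simp at this
  linarith

theorem wC_hmul (a b : Heis n) : wC (hmul a b) = wC a + wC b + 2 * I * (starRingEnd ℂ) (hermInner a.1 b.1) := by
  apply Complex.ext
  · simp [hmul]
  · simp [hmul, nsq_add]

theorem N_hmul (a b : Heis n) : ‖wC (hmul a b)‖ ≤ 2 * (‖wC a‖ + ‖wC b‖) := by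
  rw [wC_hmul]
  have h1 := hermInner_abs a.1 b.1
  have h2 : ‖hermInner a.1 b.1‖ ^ 2 ≤ ‖wC a‖ * ‖wC b‖ :=
    h1.trans (mul_le_mul (nsq_le_N a) (nsq_le_N b) (nsq_nonneg _) (norm_nonneg _))
  have ha := norm_nonneg (wC a)
  have hb := norm_nonneg (wC b)
  have h3 : 2 * ‖hermInner a.1 b.1‖ ≤ ‖wC a‖ + ‖wC b‖ := by
    nlinarith [sq_nonneg (‖wC a‖ - ‖wC b‖), norm_nonneg (hermInner a.1 b.1)]
  have h4 : ‖2 * I * (starRingEnd ℂ) (hermInner a.1 b.1)‖ = 2 * ‖hermInner a.1 b.1‖ := by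
    simp
  have := norm_add₃_le (a := wC a) (b := wC b) (c := 2 * I * (starRingEnd ℂ) (hermInner a.1 b.1))
  linarith

theorem N_hinv (a : Heis n) : ‖wC (hinv a)‖ = ‖wC a‖ := by
  have : wC (hinv a) = - (starRingEnd ℂ) (wC a) := by
    apply Complex.ext
    · simp [hinv]
    · simp [hinv, nsq]
  rw [this, norm_neg, RCLike.norm_conj]

/-- the fundamental solution `N^{-n}` -/
def Gm (p : Heis n) : ℝ := rho n 1 (normSq (wC p))

theorem Gm_eq (p : Heis n) : Gm p = (1 / ‖wC p‖) ^ n := rho_eq _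

theorem contDiffAt_Gm {p : Heis n} (hp : p ≠ 0) {k : WithTop ℕ∞} : ContDiffAt ℝ k (Gm : Heis n → ℝ) p :=
  contDiffAt_rho 1 hp

theorem subLap_Gm {p : Heis n} (hp : p ≠ 0) : subLap (Gm : Heis n → ℝ) p = 0 := by
  have := subLap_kel (fun _ => 1) (by simp) 1 p hp (fun _ => (1:ℝ)) contDiffAt_const
  rw [subLap_const, mul_zero] at this
  rw [← this]
  congr 1
  funext q
  simp [kel, Gm]
end

section
variable {n : ℕ}

theorem ne_of_N_pos {p : Heis n} (h : 0 < ‖wC p‖) : p ≠ 0 := by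
  rintro rfl
  rw [wC_eq_zero.2 rfl] at h
  simp at h

theorem isCompact_shell (r R : ℝ) : IsCompact {p : Heis n | r ≤ ‖wC p‖ ∧ ‖wC p‖ ≤ R} :=
  (isCompact_N R).of_isClosed_subset ((isClosed_le continuous_const continuous_N).inter
    (isClosed_le continuous_N continuous_const)) fun _ h => h.2

theorem isOpen_shell (r R : ℝ) : IsOpen {p : Heis n | r < ‖wC p‖ ∧ ‖wC p‖ < R} :=
  (isOpen_lt continuous_const continuous_N).inter (isOpen_lt continuous_N continuous_const)

theorem exists_lb {K : Set (Heis n)} (hK : IsCompact K) {f : Heis n → ℝ} (hf : ContinuousOn f K)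
    (hp : ∀ p ∈ K, 0 < f p) : ∃ m > 0, ∀ p ∈ K, m ≤ f p := by
  rcases K.eq_empty_or_nonempty with h | h
  · exact ⟨1, one_pos, by simp [h]⟩
  · obtain ⟨x, hx, hm⟩ := hK.exists_isMinOn h hf
    exact ⟨f x, hp x hx, fun p hp => hm hp⟩

theorem hopf_barrier (hn : 1 ≤ n) {r R : ℝ} (hr : 0 < r) (hrR : r < R) {f : Heis n → ℝ}
    (hf : ContinuousOn f {p | r ≤ ‖wC p‖ ∧ ‖wC p‖ ≤ R})
    (hf2 : ∀ p, r < ‖wC p‖ → ‖wC p‖ < R → ContDiffAt ℝ 2 f p)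
    (hL : ∀ p, r < ‖wC p‖ → ‖wC p‖ < R → subLap f p ≤ 0)
    (hR : ∀ p, ‖wC p‖ = R → 0 ≤ f p) (hr0 : ∀ p, ‖wC p‖ = r → 0 < f p) :
    ∃ c > 0, ∀ p, r ≤ ‖wC p‖ → ‖wC p‖ ≤ R → c * ((1 / ‖wC p‖) ^ n - (1 / R) ^ n) ≤ f p := by
  obtain ⟨m, hm, hmf⟩ := exists_lb (f := f) (K := {p : Heis n | r ≤ ‖wC p‖ ∧ ‖wC p‖ ≤ r})
    (isCompact_shell r r) (hf.mono fun p hp => ⟨hp.1, hp.2.trans hrR.le⟩)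
    (fun p hp => hr0 p (le_antisymm hp.2 hp.1))
  have hd : 0 < (1 / r) ^ n - (1 / R) ^ n := by
    have : (1 / R) ^ n < (1 / r) ^ n := by
      apply pow_lt_pow_left₀ _ (by have := hr.trans hrR; positivity) (by omega)
      exact one_div_lt_one_div_of_lt hr hrR
    linarith
  set c := m / ((1 / r) ^ n - (1 / R) ^ n) with hc
  have hc0 : 0 < c := div_pos hm hd
  refine ⟨c, hc0, fun p h1 h2 => ?_⟩
  have hcG : ∀ p : Heis n, 0 < ‖wC p‖ → ContDiffAt ℝ 2 (fun q : Heis n => (-c) * Gm q + c * (1/R)^n) p :=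
    fun p hp => (contDiffAt_const.mul (contDiffAt_Gm (ne_of_N_pos hp))).add contDiffAt_const
  have key := wmp hn (isCompact_shell r R) (isOpen_shell (n := n) r R)
    (fun p hp => ⟨hp.1.le, hp.2.le⟩) (f := fun q => f q + ((-c) * Gm q + c * (1/R)^n))
    (hf.add fun p hp => (hcG p (hr.trans_le hp.1)).continuousAt.continuousWithinAt)
    (fun p hp => (hf2 p hp.1 hp.2).add (hcG p (hr.trans hp.1)))
    (fun p hp => by
      have h0 := hr.trans hp.1
      rw [subLap_add (hf2 p hp.1 hp.2) (hcG p h0), subLap_add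
        (contDiffAt_const.mul (contDiffAt_Gm (ne_of_N_pos h0))) contDiffAt_const,
        subLap_smul (contDiffAt_Gm (ne_of_N_pos h0)), subLap_Gm (ne_of_N_pos h0), subLap_const]
      simpa using hL p hp.1 hp.2)
    (fun p hp hp' => by
      rw [Gm_eq]
      rcases lt_or_eq_of_le hp.1 with h | h
      · have h3 : ‖wC p‖ = R := le_antisymm hp.2 (not_lt.1 fun h' => hp' ⟨h, h'⟩)
        rw [h3]; have := hR p h3; linarith
      · have h3 := hmf p ⟨h.le, h.ge⟩
        rw [← h]
        have : c * ((1 / r) ^ n - (1 / R) ^ n) = m := by rw [hc]; field_simp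
        linarith) p ⟨h1, h2⟩
  rw [Gm_eq] at key
  linarith

/-- Hopf contradiction at a zero on the sphere about the origin -/
theorem hopf_contra (hn : 1 ≤ n) {R : ℝ} (hR : 0 < R) {f : Heis n → ℝ}
    (hf2 : ∀ p, ‖wC p‖ ≤ R → ContDiffAt ℝ 2 f p)
    (hL : ∀ p, ‖wC p‖ ≤ R → subLap f p ≤ 0)
    (hpos : ∀ p, ‖wC p‖ < R → 0 < f p) {p0 : Heis n} (hp0 : ‖wC p0‖ = R)
    (hf0 : f p0 = 0) (hmin : IsLocalMin f p0) (hnn : ∀ p, ‖wC p‖ = R → 0 ≤ f p) : False := by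
  obtain ⟨c, hc, hcb⟩ := hopf_barrier hn (half_pos hR) (half_lt_self hR) (f := f)
    (fun p hp => (hf2 p hp.2).continuousAt.continuousWithinAt)
    (fun p _ h => hf2 p h.le) (fun p _ h => hL p h.le) hnn
    (fun p h => hpos p (by rw [h]; linarith))
  have hd0 := hmin.fderiv_eq_zero
  have hfd : HasFDerivAt f (0 : Heis n →L[ℝ] ℝ) p0 := by
    rw [← hd0]; exact ((hf2 p0 hp0.le).differentiableAt (by norm_num)).hasFDerivAt
  have hdil := hasDerivAt_dil p0 1
  have h1 : HasDerivAt (fun s : ℝ => f (dil s p0)) 0 1 := by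
    have : HasFDerivAt f (0 : Heis n →L[ℝ] ℝ) (dil 1 p0) := by rw [dil_one]; exact hfd
    exact this.comp_hasDerivAt 1 hdil
  have h2 : HasDerivAt (fun s : ℝ => c * ((1 / (s ^ 2 * R)) ^ n - (1 / R) ^ n))
      (-(c * (2 * n * (1 / R) ^ n))) 1 := by
    have e : HasDerivAt (fun s : ℝ => (s ^ 2 * R)⁻¹) (-(2 * R) / (1 ^ 2 * R) ^ 2) 1 := by
      have := (((hasDerivAt_id (1:ℝ)).pow 2).mul_const R).inv (by simp [hR.ne'])
      refine this.congr_deriv ?_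
      simp
    have := ((e.pow n).sub_const ((1/R)^n)).const_mul c
    have e2 : (fun s : ℝ => c * ((1 / (s ^ 2 * R)) ^ n - (1 / R) ^ n)) =
        fun s : ℝ => c * (((s ^ 2 * R)⁻¹) ^ n - (1 / R) ^ n) := by simp only [one_div]
    rw [e2]
    refine this.congr_deriv ?_
    obtain ⟨k, rfl⟩ : ∃ k, n = k + 1 := ⟨n - 1, by omega⟩
    simp
    field_simp
    ring
  have h3 := h1.sub h2
  have h4 : 0 < (0 : ℝ) - (-(c * (2 * n * (1 / R) ^ n))) := by
    have : (0:ℝ) < n := by exact_mod_cast hn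
    simp; positivity
  have h5 := (hasDerivAt_iff_tendsto_slope_left_right.1 h3).1
  have h6 := h5.eventually (lt_mem_nhds h4)
  have h7 : ∀ᶠ s in 𝓝[<] (1:ℝ), 1/2 < s^2 ∧ 0 < s := by
    apply nhdsWithin_le_nhds
    have : ContinuousAt (fun s : ℝ => s ^ 2) 1 := by fun_prop
    exact (this.eventually (lt_mem_nhds (by norm_num))).and (lt_mem_nhds one_pos)
  obtain ⟨s, h8, h9, hs⟩ := (h6.and (h7.and self_mem_nhdsWithin)).exists
  have hs1 : s < 1 := hs
  have hN : ‖wC (dil s p0)‖ = s ^ 2 * R := by rw [norm_wC_dil, hp0]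
  have hb := hcb (dil s p0) (by rw [hN]; nlinarith) (by rw [hN]; nlinarith [h9.2, mul_nonneg hR.le (sub_nonneg.2 hs1.le), mul_pos hR h9.2, mul_nonneg (mul_pos hR h9.2).le (sub_nonneg.2 hs1.le)])
  rw [hN] at hb
  rw [slope_def_field] at h8
  simp only [Pi.sub_apply, dil_one, hf0] at h8
  have h10 : s - 1 < 0 := by linarith
  refine absurd h8 (not_lt.2 (div_nonpos_of_nonneg_of_nonpos ?_ h10.le))
  simp only [one_pow, one_mul]
  linarith

theorem smp (hn : 1 ≤ n) {Ω : Set (Heis n)} (hO : IsOpen Ω) (hconn : IsPreconnected Ω)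
    {f : Heis n → ℝ} (hf2 : ∀ p ∈ Ω, ContDiffAt ℝ 2 f p) (hL : ∀ p ∈ Ω, subLap f p ≤ 0)
    (hnn : ∀ p ∈ Ω, 0 ≤ f p) {p0 : Heis n} (hp0 : p0 ∈ Ω) (h0 : f p0 = 0) : ∀ p ∈ Ω, f p = 0 := by
  -- local step
  have loc : ∀ p ∈ Ω, f p = 0 → f =ᶠ[𝓝 p] fun _ => 0 := by
    intro a ha hfa
    have hct : Continuous fun q : Heis n => ‖wC (hmul (hinv a) q)‖ :=
      continuous_N.comp (contDiff_hmul (k := 0) _).continuous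
    -- find rho
    obtain ⟨ρ, hρ, hball⟩ : ∃ ρ > 0, ∀ q, ‖wC (hmul (hinv a) q)‖ ≤ ρ → q ∈ Ω := by
      have hO' : IsOpen ((hmul a) ⁻¹' Ω) := hO.preimage (contDiff_hmul (k := 0) _).continuous
      have hmem : (0 : Heis n) ∈ (hmul a) ⁻¹' Ω := by simpa [hmul_zero] using ha
      by_contra hcon
      push Not at hcon
      obtain ⟨m, hm, hm2⟩ := exists_lb (K := {q : Heis n | ‖wC q‖ ≤ 1} \ ((hmul a) ⁻¹' Ω))
        ((isCompact_N 1).diff hO') (f := fun q => ‖wC q‖) continuous_N.continuousOn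
        (fun q hq => norm_wC_pos (by rintro rfl; exact hq.2 hmem))
      obtain ⟨q, hq1, hq2⟩ := hcon (min 1 (m/2)) (by positivity)
      have := hm2 (hmul (hinv a) q) ⟨hq1.trans (min_le_left _ _), by
        rw [Set.mem_preimage, hmul_hinv_cancel]; exact hq2⟩
      have := hq1.trans (min_le_right _ _)
      linarith
    have hev : ∀ᶠ q in 𝓝 a, ‖wC (hmul (hinv a) q)‖ < ρ / 16 := by
      refine hct.continuousAt.eventually (gt_mem_nhds ?_)
      simp only [hinv_hmul, wC_eq_zero.2 rfl]; simpa using hρ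
    filter_upwards [hev] with q hq
    by_contra hfq
    have hqΩ := hball q (by linarith)
    have hqa : ‖wC (hmul (hinv q) a)‖ = ‖wC (hmul (hinv a) q)‖ := by
      rw [← N_hinv (hmul (hinv a) q)]; congr 2
      refine Prod.ext (by simp [hmul, hinv]) ?_
      simp only [hmul, hinv, hermInner_neg_left]
      rw [← hermInner_conj a.1 q.1]; simp; ring
    have hcq : Continuous fun x : Heis n => ‖wC (hmul (hinv q) x)‖ :=
      continuous_N.comp (contDiff_hmul (k := 0) _).continuous
    have hKc : IsCompact {x | x ∈ Ω ∧ f x = 0 ∧ ‖wC (hmul (hinv a) x)‖ ≤ ρ} := by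
      have hc1 : IsCompact {x : Heis n | ‖wC (hmul (hinv a) x)‖ ≤ ρ} := by
        have := (isCompact_N (n := n) ρ).image (contDiff_hmul (k := 0) a).continuous
        refine (congrArg IsCompact ?_).mpr this
        ext x
        constructor
        · intro hx; exact ⟨_, hx, hmul_hinv_cancel a x⟩
        · rintro ⟨y, hy, rfl⟩; simpa [hinv_hmul_cancel] using hy
      have hcl := ContinuousOn.preimage_isClosed_of_isClosed
        (f := f) (s := {x : Heis n | ‖wC (hmul (hinv a) x)‖ ≤ ρ})
        (fun x hx => (hf2 x (hball x hx)).continuousAt.continuousWithinAt) hc1.isClosed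
        (isClosed_singleton (x := (0:ℝ)))
      refine (congrArg IsCompact ?_).mpr (hc1.of_isClosed_subset hcl Set.inter_subset_left)
      ext x
      exact ⟨fun h => ⟨h.2.2, h.2.1⟩, fun h => ⟨hball x h.1, h.2, h.1⟩⟩
    obtain ⟨b, hb, hbm⟩ := hKc.exists_isMinOn ⟨a, ha, hfa, by
      rw [hinv_hmul, wC_eq_zero.2 rfl]; simpa using hρ.le⟩ hcq.continuousOn
    set R := ‖wC (hmul (hinv q) b)‖ with hRdef
    have hRle : R ≤ ρ / 16 := by
      have : R ≤ ‖wC (hmul (hinv q) a)‖ := hbm ⟨ha, hfa, by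
        rw [hinv_hmul, wC_eq_zero.2 rfl]; simpa using hρ.le⟩
      rw [hqa] at this; linarith
    have hRpos : 0 < R := by
      apply norm_wC_pos
      intro h
      have : b = q := by
        have := congrArg (hmul q) h
        rwa [hmul_hinv_cancel, hmul_zero] at this
      exact hfq (this ▸ hb.2.1)
    have hin : ∀ x : Heis n, ‖wC x‖ ≤ R → ‖wC (hmul (hinv a) (hmul q x))‖ ≤ ρ := by
      intro x hx
      rw [← hmul_assoc]
      have := N_hmul (hmul (hinv a) q) x
      linarith
    have hcd : ∀ x : Heis n, ‖wC x‖ ≤ R → ContDiffAt ℝ 2 f (hmul q x) := fun x hx =>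
      hf2 _ (hball _ (hin x hx))
    refine hopf_contra hn hRpos (f := fun x => f (hmul q x)) (p0 := hmul (hinv q) b)
      (fun x hx => (hcd x hx).comp x (contDiff_hmul q).contDiffAt)
      (fun x hx => by rw [subLap_hmul q x (hcd x hx)]; exact hL _ (hball _ (hin x hx)))
      (fun x hx => ?_) rfl (by rw [hmul_hinv_cancel]; exact hb.2.1) ?_
      (fun x hx => hnn _ (hball _ (hin x hx.le)))
    · refine lt_of_le_of_ne (hnn _ (hball _ (hin x hx.le))) fun h => ?_
      have : R ≤ ‖wC (hmul (hinv q) (hmul q x))‖ :=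
        hbm ⟨hball _ (hin x hx.le), h.symm, hin x hx.le⟩
      rw [hinv_hmul_cancel] at this
      linarith
    · have hcont : ContinuousAt (hmul q) (hmul (hinv q) b) :=
        (contDiff_hmul (k := 0) q).continuous.continuousAt
      have hΩ : ∀ᶠ x in 𝓝 (hmul (hinv q) b), hmul q x ∈ Ω :=
        hcont.eventually (by rw [hmul_hinv_cancel]; exact hO.mem_nhds hb.1)
      show ∀ᶠ x in 𝓝 (hmul (hinv q) b), _
      filter_upwards [hΩ] with x hx
      rw [hmul_hinv_cancel, hb.2.1]; exact hnn _ hx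
  -- global step
  have hUo : IsOpen {p | f =ᶠ[𝓝 p] fun _ => 0} := isOpen_iff_eventually.2 fun p hp =>
    hp.eventually_nhds
  have hVo : IsOpen (Ω ∩ f ⁻¹' {0}ᶜ) := by
    have hcf : ContinuousOn f Ω := fun p hp => (hf2 p hp).continuousAt.continuousWithinAt
    exact hcf.isOpen_inter_preimage hO isOpen_compl_singleton
  by_contra hcon
  push Not at hcon
  obtain ⟨p1, hp1, hf1⟩ := hcon
  obtain ⟨x, hx, hx1, hx2⟩ := hconn _ _ hUo hVo (fun p hp => by
    by_cases h : f p = 0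
    · exact Or.inl (loc p hp h)
    · exact Or.inr ⟨hp, h⟩) ⟨p0, hp0, loc p0 hp0 h0⟩ ⟨p1, hp1, hp1, hf1⟩
  have hx3 : ∀ᶠ y in 𝓝 x, f y = 0 := hx1
  exact hx2.2 hx3.self_of_nhds
end

section
variable {n : ℕ}

theorem continuous_dil2 : Continuous fun x : ℝ × Heis n => dil x.1 x.2 := by
  unfold dil
  fun_prop

theorem preconn_shell (hn : 1 ≤ n) {L : ℝ} (hL : 0 < L) :
    IsPreconnected {p : Heis n | 0 < ‖wC p‖ ∧ ‖wC p‖ < L} := by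
  have hrank : 1 < Module.rank ℝ (Heis n) := by
    have : Module.finrank ℝ (Heis n) = 2 * n + 1 := by
      rw [Module.finrank_prod, Module.finrank_pi_fintype]
      simp [Complex.finrank_real_complex]; ring
    rw [← Module.finrank_eq_rank, this]
    exact_mod_cast (by omega : 1 < 2 * n + 1)
  have h1 := (isConnected_compl_singleton_of_one_lt_rank hrank (0 : Heis n)).isPreconnected
  have hcont : Continuous fun p : Heis n => dil (Real.sqrt (L / (1 + ‖wC p‖))) p := by
    refine continuous_dil2.comp (Continuous.prodMk ?_ continuous_id)
    refine Real.continuous_sqrt.comp (continuous_const.div (continuous_const.add continuous_N) ?_)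
    intro p; positivity
  have h2 := h1.image _ hcont.continuousOn
  refine (congrArg IsPreconnected ?_).mpr h2
  ext q
  constructor
  · rintro ⟨h0, hq⟩
    have hd : 0 < L - ‖wC q‖ := by linarith
    have hs := Real.sqrt_pos.2 hd
    refine ⟨dil (1 / Real.sqrt (L - ‖wC q‖)) q, dil_ne (by positivity) (ne_of_N_pos h0), ?_⟩
    simp only [norm_wC_dil, dil_dil]
    have : Real.sqrt (L / (1 + (1 / Real.sqrt (L - ‖wC q‖)) ^ 2 * ‖wC q‖)) = Real.sqrt (L - ‖wC q‖) := by
      congr 1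
      rw [div_pow, Real.sq_sqrt hd.le]
      field_simp
      ring
    rw [this, mul_one_div_cancel hs.ne', dil_one]
  · rintro ⟨p, hp, rfl⟩
    have hN := norm_wC_pos hp
    show 0 < ‖wC _‖ ∧ ‖wC _‖ < L
    rw [norm_wC_dil, Real.sq_sqrt (by positivity)]
    refine ⟨by positivity, ?_⟩
    rw [div_mul_eq_mul_div, div_lt_iff₀ (by positivity)]
    nlinarith

theorem kel_K0' (m : Fin n → ℂ) (v : Heis n → ℝ) (hS : ∀ p : Heis n, p ≠ 0 → v (Sm m p) = v p) {L : ℝ} (hL : 0 < L) {p : Heis n}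
    (hp : p ≠ 0) : kel m L v p = K0 L v p :=
  kel_eq_K0 m v (L ^ 2 / ‖wC p‖ + 1) L hL (fun p hp _ => hS p hp) hp (by linarith)

theorem subLap_K0' {m : Fin n → ℂ} (hm : ∀ k, normSq (m k) = 1) {P : ℝ → ℝ}
    (hhom : ∀ s a, 0 < s → 0 < a → s ^ (n + 2) * P a = P (s ^ n * a))
    {v : Heis n → ℝ} (hc : ContDiff ℝ 2 v) (hpos : ∀ q, 0 < v q) (hsol : ∀ q, -subLap v q = P (v q))
    (hS : ∀ p : Heis n, p ≠ 0 → v (Sm m p) = v p) {L : ℝ} (hL : 0 < L) {p : Heis n} (hp : p ≠ 0) :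
    subLap (K0 L v) p = - P (K0 L v p) := by
  have h1 : K0 L v =ᶠ[𝓝 p] kel m L v := by
    filter_upwards [isOpen_compl_singleton.mem_nhds hp] with q hq
    exact (kel_K0' m v hS hL hq).symm
  rw [subLap_congr h1, subLap_kel m hm L p hp v hc.contDiffAt, ← kel_K0' m v hS hL hp, kel, rho_eq,
    normSq_eq_norm_sq]
  have hN := norm_wC_pos hp
  rw [← hhom (L / ‖wC p‖) _ (by positivity) (hpos _), ← hsol]
  rw [pow_add]
  field_simp

theorem K0_dil (L : ℝ) (v : Heis n → ℝ) {p : Heis n} (hL : 0 < L) (hp : ‖wC p‖ = L) {s : ℝ} (hs : 0 < s) (κ : ℝ) :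
    K0 (κ * L) v (dil s p) = (κ / s ^ 2) ^ n * v (dil (κ / s) p) := by
  rw [K0_eq, norm_wC_dil, hp, dil_dil]
  have : κ * L / (s ^ 2 * L) = κ / s ^ 2 := by field_simp
  rw [this]
  congr 3
  field_simp

theorem exists_polar {L : ℝ} (hL : 0 < L) {q : Heis n} (hq : q ≠ 0) :
    ∃ s > 0, ∃ p : Heis n, ‖wC p‖ = L ∧ q = dil s p ∧ ‖wC q‖ = s ^ 2 * L := by
  have hN := norm_wC_pos hq
  have hs : 0 < Real.sqrt (‖wC q‖ / L) := Real.sqrt_pos.2 (by positivity)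
  refine ⟨_, hs, dil (Real.sqrt (‖wC q‖ / L))⁻¹ q, ?_, ?_, ?_⟩
  · rw [norm_wC_dil, inv_pow, Real.sq_sqrt (by positivity)]; field_simp
  · rw [dil_dil, mul_inv_cancel₀ hs.ne', dil_one]
  · rw [Real.sq_sqrt (by positivity)]; field_simp

theorem hasDerivAt_g {v : Heis n → ℝ} (hc : ContDiff ℝ 2 v) (p : Heis n) {s : ℝ} (hs : 0 < s) :
    HasDerivAt (fun s : ℝ => s ^ n * v (dil s p))
      (s ^ n / s * (n * v (dil s p) + fderiv ℝ v (dil s p) (Ev (dil s p)))) s := by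
  have h1 := (hc.differentiable (by norm_num)).differentiableAt.hasFDerivAt (x := dil s p)
  have h2 : HasDerivAt (fun s => v (dil s p)) _ s := h1.comp_hasDerivAt s (hasDerivAt_dil p s)
  have h3 := (hasDerivAt_pow n s).mul h2
  refine h3.congr_deriv ?_
  have e : (p.1, 2 * s * p.2) = s⁻¹ • Ev (dil s p) := by
    refine Prod.ext (funext fun j => ?_) ?_
    · have : (s:ℂ) ≠ 0 := by exact_mod_cast hs.ne'
      simp [Ev, dil]; field_simp
    · simp [Ev, dil]; field_simp
  rw [e, map_smul, smul_eq_mul]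
  rcases Nat.eq_zero_or_pos n with h | h
  · subst h; simp
  · obtain ⟨k, rfl⟩ : ∃ k, n = k + 1 := ⟨n - 1, by omega⟩
    simp
    field_simp
    ring

end

section
variable {n : ℕ}

theorem deriv_nonpos_left {h : ℝ → ℝ} {h' : ℝ} (H : HasDerivAt h h' 1) (h1 : h 1 = 0)
    (hn : ∀ᶠ s in 𝓝[<] (1:ℝ), 0 ≤ h s) : h' ≤ 0 := by
  have h5 := (hasDerivAt_iff_tendsto_slope_left_right.1 H).1
  refine le_of_tendsto h5 ?_
  filter_upwards [hn, self_mem_nhdsWithin] with s hs hs1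
  rw [slope_def_field, h1, sub_zero]
  exact div_nonpos_of_nonneg_of_nonpos hs (by have : s < 1 := hs1; linarith)

theorem inner_lb (hn : 1 ≤ n) {R m0 : ℝ} (hm0 : 0 < m0) {w : Heis n → ℝ}
    (hw2 : ∀ p, p ≠ 0 → ContDiffAt ℝ 2 w p)
    (hL : ∀ p, 0 < ‖wC p‖ → ‖wC p‖ < R → subLap w p ≤ 0)
    (hnn : ∀ p, 0 < ‖wC p‖ → ‖wC p‖ ≤ R → 0 ≤ w p)
    (hR : ∀ p, ‖wC p‖ = R → m0 ≤ w p) {p : Heis n} (hp : 0 < ‖wC p‖) (hpR : ‖wC p‖ ≤ R) :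
    m0 ≤ w p := by
  refine le_of_forall_pos_le_add fun δ hδ => ?_
  set ε := δ * ‖wC p‖ ^ n with hε
  have hε0 : 0 < ε := by positivity
  set r := min ‖wC p‖ (min 1 (ε / m0)) with hr
  have hr0 : 0 < r := lt_min hp (lt_min one_pos (by positivity))
  have hr1 : r ≤ 1 := (min_le_right _ _).trans (min_le_left _ _)
  have hr2 : r ≤ ε / m0 := (min_le_right _ _).trans (min_le_right _ _)
  have hrp : r ≤ ‖wC p‖ := min_le_left _ _
  have hcG : ∀ p : Heis n, 0 < ‖wC p‖ → ContDiffAt ℝ 2 (fun q : Heis n => ε * Gm q + (-m0)) p :=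
    fun p hp => (contDiffAt_const.mul (contDiffAt_Gm (ne_of_N_pos hp))).add contDiffAt_const
  have key := wmp hn (isCompact_shell r R) (isOpen_shell (n := n) r R)
    (fun p hp => ⟨hp.1.le, hp.2.le⟩) (f := fun q => w q + (ε * Gm q + (-m0)))
    (fun p hp => ((hw2 p (ne_of_N_pos (hr0.trans_le hp.1))).add
      (hcG p (hr0.trans_le hp.1))).continuousAt.continuousWithinAt)
    (fun p hp => (hw2 p (ne_of_N_pos (hr0.trans hp.1))).add (hcG p (hr0.trans hp.1)))
    (fun p hp => by
      have h0 := hr0.trans hp.1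
      rw [subLap_add (hw2 p (ne_of_N_pos h0)) (hcG p h0), subLap_add
        (contDiffAt_const.mul (contDiffAt_Gm (ne_of_N_pos h0))) contDiffAt_const,
        subLap_smul (contDiffAt_Gm (ne_of_N_pos h0)), subLap_Gm (ne_of_N_pos h0), subLap_const]
      simpa using hL p h0 hp.2)
    (fun p hp hp' => by
      rw [Gm_eq]
      have h0 := hr0.trans_le hp.1
      rcases lt_or_eq_of_le hp.1 with h | h
      · have h3 : ‖wC p‖ = R := le_antisymm hp.2 (not_lt.1 fun h' => hp' ⟨h, h'⟩)
        have := hR p h3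
        have : 0 ≤ ε * (1 / ‖wC p‖) ^ n := by positivity
        linarith
      · rw [← h]
        have h1 : 1 / r ≤ (1 / r) ^ n := le_self_pow₀ ((one_le_div hr0).2 hr1) (by omega)
        have h2 : m0 ≤ ε * (1 / r) := by
          rw [mul_one_div, le_div_iff₀ hr0]
          rw [le_div_iff₀ hm0] at hr2; linarith
        have h3 := hnn p h0 hp.2
        nlinarith) p ⟨hrp, hpR⟩
  rw [Gm_eq] at key
  have : ε * (1 / ‖wC p‖) ^ n = δ := by
    rw [hε, mul_assoc, ← mul_pow, mul_one_div_cancel hp.ne', one_pow, mul_one]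
  linarith

theorem moving_F (hn : 1 ≤ n) {m : Fin n → ℂ} (hm : ∀ k, normSq (m k) = 1) {P : ℝ → ℝ}
    (hmono : ∀ a b, 0 < a → a ≤ b → P a ≤ P b)
    (hhom : ∀ s a, 0 < s → 0 < a → s ^ (n + 2) * P a = P (s ^ n * a))
    {v : Heis n → ℝ} (hc : ContDiff ℝ 2 v) (hpos : ∀ q, 0 < v q) (hsol : ∀ q, -subLap v q = P (v q))
    (hS : ∀ p : Heis n, p ≠ 0 → v (Sm m p) = v p) {L : ℝ} (hL : 0 < L)
    (H : ∀ l ∈ Set.Ioo 0 L, ∀ p : Heis n, p ≠ 0 → ‖wC p‖ < l → v p ≤ K0 l v p)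
    (Hfail : ∀ κ1 > 1, ∃ κ, 1 ≤ κ ∧ κ < κ1 ∧ ∃ p : Heis n, p ≠ 0 ∧ ‖wC p‖ < κ * L ∧
      K0 (κ * L) v p < v p) : ∀ p : Heis n, p ≠ 0 → K0 L v p = v p := by
  set w : Heis n → ℝ := fun q => K0 L v q + (-1) * v q with hwdef
  have hvc : Continuous v := hc.continuous
  have hK2 : ∀ p : Heis n, p ≠ 0 → ContDiffAt ℝ 2 (K0 L v) p := fun p hp =>
    contDiffAt_K0 hp hc.contDiffAt
  have hw2 : ∀ p, p ≠ 0 → ContDiffAt ℝ 2 w p := fun p hp =>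
    (hK2 p hp).add (contDiffAt_const.mul hc.contDiffAt)
  have hKdil : ∀ p : Heis n, ‖wC p‖ = L → ∀ s > 0,
      K0 L v (dil s p) = (1 / s ^ 2) ^ n * v (dil (1 / s) p) := by
    intro p hp s hs
    have := K0_dil L v hL hp hs 1
    rwa [one_mul] at this
  have hwnn : ∀ p : Heis n, 0 < ‖wC p‖ → ‖wC p‖ < L → 0 ≤ w p := by
    intro p h0 h1
    have hpne := ne_of_N_pos h0
    have ht : Tendsto (fun l => K0 l v p) (𝓝[<] L) (𝓝 (K0 L v p)) := by
      have : Continuous fun l => K0 l v p := by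
        simp only [K0_eq]
        refine ((continuous_id.div_const _).pow n).mul (hvc.comp ?_)
        exact continuous_dil2.comp ((continuous_id.div_const _).prodMk continuous_const)
      exact (this.tendsto L).mono_left nhdsWithin_le_nhds
    have : v p ≤ K0 L v p := by
      refine ge_of_tendsto ht ?_
      filter_upwards [Ioo_mem_nhdsLT h1] with l hl
      exact H l ⟨h0.trans hl.1, hl.2⟩ p hpne hl.1
    simp only [hwdef]; linarith
  have hwL : ∀ p : Heis n, 0 < ‖wC p‖ → ‖wC p‖ < L → subLap w p ≤ 0 := by
    intro p h0 h1
    have hpne := ne_of_N_pos h0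
    rw [hwdef, subLap_add (hK2 p hpne) (contDiffAt_const.mul hc.contDiffAt),
      subLap_smul hc.contDiffAt, subLap_K0' hm hhom hc hpos hsol hS hL hpne]
    have h2 := hwnn p h0 h1
    simp only [hwdef] at h2
    have h3 := hmono (v p) (K0 L v p) (hpos p) (by linarith)
    have h4 := hsol p
    linarith
  have hwR : ∀ p : Heis n, ‖wC p‖ = L → w p = 0 := by
    intro p hp
    have := hKdil p hp 1 one_pos
    simp only [dil_one] at this
    simp only [hwdef, this]; simp [dil_one]
  by_cases hz : ∃ p0 : Heis n, (0 < ‖wC p0‖ ∧ ‖wC p0‖ < L) ∧ w p0 = 0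
  · obtain ⟨p0, hp0, hw0⟩ := hz
    have hall := smp hn (isOpen_shell 0 L) (preconn_shell hn hL)
      (fun p hp => hw2 p (ne_of_N_pos hp.1)) (fun p hp => hwL p hp.1 hp.2)
      (fun p hp => hwnn p hp.1 hp.2) hp0 hw0
    have hin : ∀ p : Heis n, 0 < ‖wC p‖ → ‖wC p‖ < L → K0 L v p = v p := by
      intro p h0 h1
      have := hall p ⟨h0, h1⟩
      simp only [hwdef] at this; linarith
    intro q hq
    obtain ⟨s, hs, p, hp, rfl, hN⟩ := exists_polar hL hq
    rcases lt_trichotomy s 1 with h | h | h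
    · refine hin _ (norm_wC_pos hq) ?_
      have h2 : s ^ 2 < 1 := by nlinarith
      rw [hN]; nlinarith
    · subst h
      have := hwR p hp
      rw [dil_one]
      simp only [hwdef] at this; linarith
    · have hs1 : 0 < 1 / s := by positivity
      have h1 := hin (dil (1 / s) p) (by rw [norm_wC_dil, hp]; positivity) (by
        rw [norm_wC_dil, hp]
        have h2 : 1 / s < 1 := by rw [div_lt_one hs]; exact h
        have : (1 / s) ^ 2 < 1 := by nlinarith
        nlinarith)
      rw [hKdil p hp _ hs1, one_div_one_div] at h1
      rw [hKdil p hp s hs, ← h1, ← mul_assoc, ← mul_pow]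
      have : (1 / s ^ 2 * (1 / (1 / s) ^ 2)) = 1 := by field_simp
      rw [this]; simp
  · exfalso
    push Not at hz
    have hwpos : ∀ p : Heis n, 0 < ‖wC p‖ → ‖wC p‖ < L → 0 < w p := fun p h0 h1 =>
      lt_of_le_of_ne (hwnn p h0 h1) (hz p ⟨h0, h1⟩).symm
    have hcont : ∀ a b : ℝ, 0 < a → ContinuousOn w {p | a ≤ ‖wC p‖ ∧ ‖wC p‖ ≤ b} := fun a b ha p hp =>
      (hw2 p (ne_of_N_pos (ha.trans_le hp.1))).continuousAt.continuousWithinAt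
    have hL2 : 0 < L / 2 := half_pos hL
    have hL2' : L / 2 < L := half_lt_self hL
    -- (a)
    obtain ⟨m0, hm0, hm0'⟩ := exists_lb (isCompact_shell (n := n) (L/2) (L/2)) (hcont _ _ hL2)
      (fun p hp => hwpos p (hL2.trans_le hp.1) (hp.2.trans_lt hL2'))
    have ha : ∀ p : Heis n, 0 < ‖wC p‖ → ‖wC p‖ ≤ L / 2 → m0 ≤ w p := fun p h0 h1 =>
      inner_lb hn hm0 hw2 (fun p h0 h1 => hwL p h0 (h1.trans hL2'))
        (fun p h0 h1 => hwnn p h0 (h1.trans_lt hL2')) (fun p hp => hm0' p ⟨hp.ge, hp.le⟩) h0 h1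
    -- (b)
    obtain ⟨c, hc0, hcb⟩ := hopf_barrier hn hL2 hL2' (f := w) (hcont _ _ hL2)
      (fun p h _ => hw2 p (ne_of_N_pos (hL2.trans h))) (fun p h h' => hwL p (hL2.trans h) h')
      (fun p hp => (hwR p hp).ge) (fun p hp => hwpos p (by rw [hp]; exact hL2) (by rw [hp]; exact hL2'))
    -- (c)
    set ψ : Heis n → ℝ := fun q => n * v q + fderiv ℝ v q (Ev q) with hψ
    have hψc : Continuous ψ := by
      refine (continuous_const.mul hvc).add ?_
      exact (hc.continuous_fderiv (by norm_num)).clm_apply continuous_Ev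
    have hc1 : ∀ p : Heis n, ‖wC p‖ = L → 0 < ψ p := by
      intro p hp
      set c' := c * (1 / L) ^ n with hc'
      have hc'0 : 0 < c' := by positivity
      have hG : ∀ s : ℝ, 0 < s → HasDerivAt (fun s : ℝ => s ^ n * v (dil s p) - c' * s ^ n)
          (s ^ n / s * ψ (dil s p) - c' * (n * s ^ (n - 1))) s := fun s hs =>
        (hasDerivAt_g hc p hs).sub ((hasDerivAt_pow n s).const_mul c')
      have hG1 := hG 1 one_pos
      have hinv : HasDerivAt (fun s : ℝ => s⁻¹) (-1) 1 := by
        simpa using hasDerivAt_inv (one_ne_zero (α := ℝ))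
      have hG2 : HasDerivAt (fun s : ℝ => (s⁻¹) ^ n * v (dil s⁻¹ p) - c' * (s⁻¹) ^ n)
          ((1 ^ n / 1 * ψ (dil 1 p) - c' * (n * 1 ^ (n - 1))) * (-1)) 1 := by
        have := HasDerivAt.comp (h₂ := fun s : ℝ => s ^ n * v (dil s p) - c' * s ^ n)
          (h := fun s : ℝ => s⁻¹) (1:ℝ) (by simpa using hG1) hinv
        simpa [Function.comp_def] using this
      have hd := deriv_nonpos_left (hG2.sub hG1) (by simp) (by
        have h7 : ∀ᶠ s in 𝓝[<] (1:ℝ), 1/2 < s^2 ∧ 0 < s := by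
          apply nhdsWithin_le_nhds
          have : ContinuousAt (fun s : ℝ => s ^ 2) 1 := by fun_prop
          exact (this.eventually (lt_mem_nhds (by norm_num))).and (lt_mem_nhds one_pos)
        filter_upwards [h7, self_mem_nhdsWithin] with s hs hs1
        have hs1 : s < 1 := hs1
        have hN : ‖wC (dil s p)‖ = s ^ 2 * L := by rw [norm_wC_dil, hp]
        have hs2 : s ^ 2 ≤ 1 := by nlinarith [hs.2]
        have hb := hcb (dil s p) (by rw [hN]; nlinarith) (by rw [hN]; nlinarith [hs.2])
        rw [hN] at hb
        simp only [hwdef] at hb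
        rw [hKdil p hp s hs.2] at hb
        have hsn : 0 < s ^ n := pow_pos hs.2 n
        have hb2 := mul_le_mul_of_nonneg_left hb hsn.le
        have e1 : s ^ n * (c * ((1 / (s ^ 2 * L)) ^ n - (1 / L) ^ n)) = c' * (s⁻¹) ^ n - c' * s ^ n := by
          have : 1 / (s ^ 2 * L) = s⁻¹ * s⁻¹ * (1 / L) := by field_simp
          rw [this, mul_pow, mul_pow, hc']
          have h2 : s ^ n * (s⁻¹) ^ n = 1 := by rw [← mul_pow, mul_inv_cancel₀ hs.2.ne', one_pow]
          linear_combination (c * (1 / L) ^ n * (s⁻¹) ^ n) * h2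
        have e2 : s ^ n * ((1 / s ^ 2) ^ n * v (dil (1 / s) p) + -1 * v (dil s p)) =
            (s⁻¹) ^ n * v (dil s⁻¹ p) - s ^ n * v (dil s p) := by
          have : 1 / s ^ 2 = s⁻¹ * s⁻¹ := by field_simp
          rw [this, mul_pow, one_div]
          have h2 : s ^ n * (s⁻¹) ^ n = 1 := by rw [← mul_pow, mul_inv_cancel₀ hs.2.ne', one_pow]
          linear_combination ((s⁻¹) ^ n * v (dil s⁻¹ p)) * h2
        rw [e1, e2] at hb2
        simp only [Pi.sub_apply]
        linarith)
      rw [dil_one] at hd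
      simp at hd
      have hn0 : (0:ℝ) < n := by exact_mod_cast hn
      have : 0 < c' * n := by positivity
      linarith
    -- (d)
    have hSc : IsCompact {p : Heis n | L ≤ ‖wC p‖ ∧ ‖wC p‖ ≤ L} := isCompact_shell L L
    have hev1 : ∀ᶠ s in 𝓝 (1:ℝ), ∀ p ∈ {p : Heis n | L ≤ ‖wC p‖ ∧ ‖wC p‖ ≤ L}, 0 < ψ (dil s p) := by
      refine hSc.eventually_forall_of_forall_eventually fun p hp => ?_
      have : Continuous fun z : ℝ × Heis n => ψ (dil z.1 z.2) := hψc.comp continuous_dil2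
      refine this.continuousAt.eventually (lt_mem_nhds ?_)
      simp only [dil_one]
      exact hc1 p (le_antisymm hp.2 hp.1)
    obtain ⟨η', hη', hball⟩ := Metric.eventually_nhds_iff.1 hev1
    set η := min η' (1/2) with hη
    have hη0 : 0 < η := by positivity
    have hη2 : η ≤ 1/2 := min_le_right _ _
    have hmonoG : ∀ p : Heis n, ‖wC p‖ = L →
        MonotoneOn (fun s : ℝ => s ^ n * v (dil s p)) (Set.Ioo (1 - η) (1 + η)) := by
      intro p hp
      have hpos' : ∀ s ∈ Set.Ioo (1 - η) (1 + η), 0 < s := fun s hs => by linarith [hs.1]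
      refine monotoneOn_of_deriv_nonneg (convex_Ioo _ _)
        (fun s hs => (hasDerivAt_g hc p (hpos' s hs)).continuousAt.continuousWithinAt)
        (fun s hs => (hasDerivAt_g hc p (hpos' s (interior_subset hs))).differentiableAt.differentiableWithinAt)
        (fun s hs => ?_)
      have hs := interior_subset hs
      rw [(hasDerivAt_g hc p (hpos' s hs)).deriv]
      have h0 := hpos' s hs
      have : 0 < ψ (dil s p) := hball (by
        rw [Real.dist_eq, abs_lt]
        have := min_le_left η' (1/2)
        constructor <;> linarith [hs.1, hs.2]) p ⟨hp.ge, hp.le⟩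
      exact mul_nonneg (by positivity) this.le
    -- (e)
    set s0 := 1 - η / 2 with hs0
    have hs00 : 0 < s0 := by rw [hs0]; linarith
    have hs01 : s0 < 1 := by rw [hs0]; linarith
    obtain ⟨m2, hm2, hm2'⟩ := exists_lb (isCompact_shell (n := n) (L/2) (s0 ^ 2 * L)) (hcont _ _ hL2)
      (fun p hp => hwpos p (hL2.trans_le hp.1) (hp.2.trans_lt (by
        have : s0 ^ 2 < 1 := by nlinarith
        nlinarith)))
    set m1 := min m0 m2 with hm1
    have hm10 : 0 < m1 := lt_min hm0 hm2
    have hwm1 : ∀ p : Heis n, 0 < ‖wC p‖ → ‖wC p‖ ≤ s0 ^ 2 * L → m1 ≤ w p := by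
      intro p h0 h1
      rcases le_total ‖wC p‖ (L/2) with h | h
      · exact (min_le_left _ _).trans (ha p h0 h)
      · exact (min_le_right _ _).trans (hm2' p ⟨h, h1⟩)
    have hev2 : ∀ᶠ κ in 𝓝 (1:ℝ), ∀ x ∈ (Set.Icc (0:ℝ) s0) ×ˢ {p : Heis n | L ≤ ‖wC p‖ ∧ ‖wC p‖ ≤ L},
        v (dil x.1 x.2) < (κ⁻¹) ^ n * (v (dil (x.1 * κ⁻¹) x.2) + m1) := by
      refine (isCompact_Icc.prod hSc).eventually_forall_of_forall_eventually fun x hx => ?_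
      have hκ : ContinuousAt (fun z : ℝ × (ℝ × Heis n) => (z.1)⁻¹) (1, x) :=
        continuousAt_fst.inv₀ (by simp)
      have hl : ContinuousAt (fun z : ℝ × (ℝ × Heis n) => v (dil z.2.1 z.2.2)) (1, x) :=
        (hvc.comp (continuous_dil2.comp continuous_snd)).continuousAt
      have h3 : ContinuousAt (fun z : ℝ × (ℝ × Heis n) => v (dil (z.2.1 * (z.1)⁻¹) z.2.2)) (1, x) := by
        have h4 : ContinuousAt (fun z : ℝ × (ℝ × Heis n) => ((z.2.1 * (z.1)⁻¹, z.2.2) : ℝ × Heis n)) (1, x) :=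
          ((continuous_fst.comp continuous_snd).continuousAt.mul hκ).prodMk
            (continuous_snd.comp continuous_snd).continuousAt
        exact (hvc.comp continuous_dil2).continuousAt.comp h4
      have h5 := (hκ.pow n).mul (h3.add (continuousAt_const (y := m1)))
      refine hl.eventually_lt h5 ?_
      simp [hm10]
    have hev3 : ∀ᶠ κ in 𝓝 (1:ℝ), κ < (1 + η) * s0 := gt_mem_nhds (by rw [hs0]; nlinarith)
    obtain ⟨δ, hδ, hδb⟩ := Metric.eventually_nhds_iff.1 (hev2.and hev3)
    obtain ⟨κ, hκ1, hκ2, q, hq, hqN, hqlt⟩ := Hfail (1 + δ) (by linarith)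
    obtain ⟨hE2, hE3⟩ := hδb (y := κ) (by rw [Real.dist_eq, abs_lt]; constructor <;> linarith)
    refine absurd hqlt (not_lt.2 ?_)
    obtain ⟨s, hs, p, hp, rfl, hN⟩ := exists_polar hL hq
    have hκ0 : 0 < κ := by linarith
    rw [hN] at hqN
    have hs2 : s ^ 2 < κ := lt_of_mul_lt_mul_right hqN hL.le
    rw [K0_dil L v hL hp hs κ]
    rcases le_or_gt s s0 with h | h
    · have h1 := hE2 (s, p) ⟨⟨hs.le, h⟩, hp.ge, hp.le⟩
      simp only at h1
      have hsk : 0 < s * κ⁻¹ := by positivity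
      have hsk1 : s * κ⁻¹ ≤ s0 := by
        have : κ⁻¹ ≤ 1 := inv_le_one_of_one_le₀ hκ1
        nlinarith
      have h2 := hwm1 (dil (s * κ⁻¹) p) (by rw [norm_wC_dil, hp]; positivity) (by
        rw [norm_wC_dil, hp]; gcongr)
      simp only [hwdef] at h2
      rw [hKdil p hp _ hsk] at h2
      have h3 : (κ⁻¹) ^ n * (v (dil (s * κ⁻¹) p) + m1) ≤
          (κ⁻¹) ^ n * ((1 / (s * κ⁻¹) ^ 2) ^ n * v (dil (1 / (s * κ⁻¹)) p)) := by
        gcongr; linarith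
      have e1 : 1 / (s * κ⁻¹) = κ / s := by field_simp
      have e2 : κ⁻¹ * (1 / (s * κ⁻¹) ^ 2) = κ / s ^ 2 := by field_simp
      rw [← mul_assoc, ← mul_pow, e1, e2] at h3
      linarith
    · have hsκ : s < κ / s := by rw [lt_div_iff₀ hs]; nlinarith
      have hu : κ / s < 1 + η := by
        rw [div_lt_iff₀ hs]; nlinarith
      have h1 := hmonoG p hp (a := s) (b := κ / s) ⟨by linarith, by linarith⟩
        ⟨by linarith, hu⟩ hsκ.le
      simp only at h1
      have e : κ / s ^ 2 = (κ / s) * s⁻¹ := by field_simp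
      rw [e, mul_pow]
      have h2 : s ^ n * (s⁻¹) ^ n = 1 := by rw [← mul_pow, mul_inv_cancel₀ hs.ne', one_pow]
      have h3 : 0 < (s⁻¹) ^ n := by positivity
      have h4 := mul_le_mul_of_nonneg_right h1 h3.le
      calc v (dil s p) = s ^ n * v (dil s p) * s⁻¹ ^ n := by
            linear_combination -(v (dil s p)) * h2
        _ ≤ _ := h4
        _ = _ := by ring
end

section
variable {n : ℕ}

theorem korNorm_sq (p : Heis n) : korNorm p ^ 2 = ‖wC p‖ := by
  have h : ‖wC p‖ ^ 2 = nsq p.1 ^ 2 + p.2 ^ 2 := by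
    rw [← normSq_eq_norm_sq, normSq_apply, wC_re, wC_im]; ring
  rw [korNorm, ← h, ← Real.rpow_natCast, ← Real.rpow_mul (by positivity), ← Real.rpow_natCast,
    ← Real.rpow_mul (by positivity)]
  norm_num

theorem korNorm_nonneg (p : Heis n) : 0 ≤ korNorm p := by unfold korNorm; positivity

theorem wC_iota (p : Heis n) : wC (iota p) = -(starRingEnd ℂ) (wC p) := by
  have : nsq (fun j => (starRingEnd ℂ) (p.1 j)) = nsq p.1 := by
    unfold nsq; simp [normSq_conj]
  apply Complex.ext <;> simp [iota, this]

theorem phi_core (θ : Fin n → ℝ) (L : ℝ) (p : Heis n) :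
    rot (Matrix.diagonal fun k => Complex.exp (Complex.I * ((θ k : ℝ) : ℂ)))
      (dil L (crInv (iota p))) =
    inv0 (fun k => Complex.exp (Complex.I * ((θ k : ℝ) : ℂ))) L p := by
  unfold rot dil crInv
  rw [wC_iota]
  refine Prod.ext ?_ ?_
  · funext k
    simp only [Matrix.mulVec_diagonal, inv0, iota]
    rw [div_eq_mul_inv, inv_neg]; ring
  · simp only [inv0, iota]
    rw [normSq_neg, normSq_conj, inv_re, normSq_conj, conj_re, wC_re]
    ring

theorem kelvin_eq (u : Heis n → ℝ) (ξ : Heis n) (lam β : ℝ) (p : Heis n) :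
    kelvin u ξ lam β (hmul ξ p) =
      kel (fun k => Complex.exp (Complex.I * ((theta ξ β k : ℝ) : ℂ))) (lam ^ 2)
        (fun q => u (hmul ξ q)) p := by
  unfold kelvin kel Phi dH Mmat tau
  rw [hinv_hmul_cancel, phi_core, rho_eq, pow_mul, div_pow, korNorm_sq]

theorem mem_ball_iff (ξ : Heis n) {lam : ℝ} (hl : 0 < lam) (p : Heis n) :
    hmul ξ p ∈ ball ξ lam ↔ ‖wC p‖ < lam ^ 2 := by
  have : dH ξ (hmul ξ p) ^ 2 = ‖wC p‖ := by
    unfold dH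
    rw [korNorm_sq, ← N_hinv]
    congr 1
    congr 1
    have h1 : hinv (hmul (hinv (hmul ξ p)) ξ) = hmul (hinv ξ) (hmul ξ p) := by
      refine Prod.ext ?_ ?_
      · simp only [hinv, hmul]; abel
      · simp only [hinv, hmul]
        have := congrArg Complex.im (hermInner_conj (ξ.1 + p.1) ξ.1)
        simp only [conj_im] at this
        simp only [hermInner_neg_left, hermInner_neg_right, hermInner_add_left, hermInner_add_right, neg_im, add_im] at *
        linarith
    rw [h1, hinv_hmul_cancel]
  show dH ξ (hmul ξ p) < lam ↔ _
  rw [← this]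
  exact (pow_lt_pow_iff_left₀ (korNorm_nonneg _) hl.le two_ne_zero).symm

theorem assembly (hn : 1 ≤ n) (Q : ℝ) (hQ : Q = 2 * n + 2)
    (UC : UCprop n (fun a => a ^ ((Q + 2) / (Q - 2))))
    (u : Heis n → ℝ) (hsmooth : ContDiff ℝ (⊤ : ℕ∞) u) (hpos : ∀ q, 0 < u q)
    (heq : ∀ q, -subLap u q = u q ^ ((Q + 2) / (Q - 2)))
    (β : ℝ) (ξ₀ : Heis n)
    (hne : ({μ : ℝ | 0 < μ ∧ ∀ lam ∈ Set.Ioo 0 μ,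
      ∀ ζ ∈ ball ξ₀ lam \ {ξ₀}, u ζ ≤ kelvin u ξ₀ lam β ζ} : Set ℝ).Nonempty)
    (hbdd : BddAbove {μ : ℝ | 0 < μ ∧ ∀ lam ∈ Set.Ioo 0 μ,
      ∀ ζ ∈ ball ξ₀ lam \ {ξ₀}, u ζ ≤ kelvin u ξ₀ lam β ζ}) :
    ∀ ζ : Heis n, ζ ≠ ξ₀ →
      kelvin u ξ₀ (sSup {μ : ℝ | 0 < μ ∧ ∀ lam ∈ Set.Ioo 0 μ,
        ∀ ζ' ∈ ball ξ₀ lam \ {ξ₀}, u ζ' ≤ kelvin u ξ₀ lam β ζ'}) β ζ = u ζ := by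
  set S := {μ : ℝ | 0 < μ ∧ ∀ lam ∈ Set.Ioo 0 μ,
      ∀ ζ ∈ ball ξ₀ lam \ {ξ₀}, u ζ ≤ kelvin u ξ₀ lam β ζ} with hS
  set v : Heis n → ℝ := fun q => u (hmul ξ₀ q) with hv
  set m : Fin n → ℂ := fun k => Complex.exp (Complex.I * ((theta ξ₀ β k : ℝ) : ℂ)) with hmdef
  have hm : ∀ k, normSq (m k) = 1 := fun k => normSq_exp_I _
  have hvc : ContDiff ℝ (⊤ : ℕ∞) v := hsmooth.comp (contDiff_hmul ξ₀)
  have hvc2 : ContDiff ℝ 2 v := contDiff_infty.1 hvc 2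
  have hvpos : ∀ q, 0 < v q := fun q => hpos _
  have hsol : ∀ q, -subLap v q = (fun a : ℝ => a ^ ((Q + 2) / (Q - 2))) (v q) := by
    intro q
    rw [hv, subLap_hmul ξ₀ q (contDiff_infty.1 hsmooth 2).contDiffAt]
    exact heq _
  have hn0 : (0:ℝ) < n := by exact_mod_cast hn
  have hexp : (Q + 2) / (Q - 2) = ((n:ℝ) + 2) / n := by
    have h2 : (2 * (n:ℝ) + 2 - 2) ≠ 0 := by linarith
    rw [hQ, div_eq_div_iff h2 hn0.ne']; ring
  have hne0 : ∀ p : Heis n, p ≠ 0 → hmul ξ₀ p ≠ ξ₀ := by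
    intro p hp h
    apply hp
    have := congrArg (hmul (hinv ξ₀)) h
    rwa [hinv_hmul_cancel, hinv_hmul] at this
  have hmono : ∀ a b : ℝ, 0 < a → a ≤ b → (fun a : ℝ => a ^ ((Q + 2) / (Q - 2))) a ≤
      (fun a : ℝ => a ^ ((Q + 2) / (Q - 2))) b := by
    intro a b ha hab
    exact Real.rpow_le_rpow ha.le hab (by rw [hexp]; positivity)
  have hhom : ∀ s a : ℝ, 0 < s → 0 < a → s ^ (n + 2) * (fun a : ℝ => a ^ ((Q + 2) / (Q - 2))) a =
      (fun a : ℝ => a ^ ((Q + 2) / (Q - 2))) (s ^ n * a) := by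
    intro s a hs ha
    simp only
    rw [Real.mul_rpow (by positivity) ha.le, hexp, ← Real.rpow_natCast s n, ← Real.rpow_mul hs.le,
      ← Real.rpow_natCast s (n + 2)]
    congr 2
    push_cast; field_simp
  obtain ⟨μ0, hμ0⟩ := hne
  set l0 := sSup S with hl0
  have hl0pos : 0 < l0 := lt_of_lt_of_le hμ0.1 (le_csSup hbdd hμ0)
  have Hk : ∀ L ∈ Set.Ioo 0 (l0 ^ 2), ∀ p : Heis n, p ≠ 0 → ‖wC p‖ < L → v p ≤ kel m L v p := by
    intro L hL p hp hlt
    have h1 : √L < l0 := by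
      rw [Real.sqrt_lt' hl0pos]; exact hL.2
    obtain ⟨μ, hμ, hlm⟩ := exists_lt_of_lt_csSup ⟨μ0, hμ0⟩ h1
    have h2 := hμ.2 (√L) ⟨Real.sqrt_pos.2 hL.1, hlm⟩ (hmul ξ₀ p)
      ⟨(mem_ball_iff ξ₀ (Real.sqrt_pos.2 hL.1) p).2 (by rw [Real.sq_sqrt hL.1.le]; exact hlt),
        hne0 p hp⟩
    rw [kelvin_eq, Real.sq_sqrt hL.1.le] at h2
    exact h2
  have hSm : ∀ p : Heis n, p ≠ 0 → v (Sm m p) = v p := by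
    intro p hp
    refine global_S hn _ UC m hm v hvc hvpos hsol (l0 ^ 2) (by positivity) ?_ hp
    intro q hq hqM
    exact partC_S m hm v hvc.continuous _ Hk hq hqM
  have HF := moving_F hn hm hmono hhom hvc2 hvpos hsol hSm (L := l0 ^ 2) (by positivity)
    (by
      intro l hl p hp hlt
      rw [← kel_K0' m v hSm hl.1 hp]
      exact Hk l hl p hp hlt)
    (by
      intro κ1 hκ1
      have h1 : l0 < √κ1 * l0 := by
        have : 1 < √κ1 := by rw [Real.lt_sqrt (by norm_num)]; simpa using hκ1
        nlinarith
      have h2 : √κ1 * l0 ∉ S := fun h => absurd (le_csSup hbdd h) (not_le.2 h1)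
      simp only [hS, Set.mem_ofPred_eq, not_and, not_forall] at h2
      obtain ⟨lam, hlam, ζ, hζ, hlt⟩ := h2 (by linarith)
      push Not at hlt
      obtain ⟨p, rfl⟩ : ∃ p, ζ = hmul ξ₀ p := ⟨hmul (hinv ξ₀) ζ, (hmul_hinv_cancel _ _).symm⟩
      have hp : p ≠ 0 := by
        rintro rfl
        exact hζ.2 (by rw [hmul_zero]; rfl)
      have hN := (mem_ball_iff ξ₀ hlam.1 p).1 hζ.1
      rw [kelvin_eq] at hlt
      have e : (lam / l0) ^ 2 * l0 ^ 2 = lam ^ 2 := by field_simp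
      refine ⟨(lam / l0) ^ 2, ?_, ?_, p, hp, ?_, ?_⟩
      · by_contra hcon
        push Not at hcon
        have : lam ^ 2 < l0 ^ 2 := by
          rw [← e]; nlinarith [pow_pos hl0pos 2]
        exact absurd (Hk (lam ^ 2) ⟨pow_pos hlam.1 2, this⟩ p hp hN) (not_le.2 hlt)
      · have h3 : lam / l0 < √κ1 := by rw [div_lt_iff₀ hl0pos]; exact hlam.2
        have h4 : 0 < lam / l0 := div_pos hlam.1 hl0pos
        calc (lam / l0) ^ 2 < √κ1 ^ 2 := by gcongr
          _ = κ1 := Real.sq_sqrt (by linarith)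
      · rw [e]; exact hN
      · rw [e, ← kel_K0' m v hSm (pow_pos hlam.1 2) hp]; exact hlt)
  intro ζ hζ
  obtain ⟨p, rfl⟩ : ∃ p, ζ = hmul ξ₀ p := ⟨hmul (hinv ξ₀) ζ, (hmul_hinv_cancel _ _).symm⟩
  have hp : p ≠ 0 := by
    rintro rfl
    exact hζ (hmul_zero _)
  rw [kelvin_eq, kel_K0' m v hSm (pow_pos hl0pos 2) hp]
  exact HF p hp

end

section
variable {n : ℕ}

theorem holo_integral {X : Type*} [MeasurableSpace X] {μ : Measure X} {δ : ℝ} (G : ℂ → X → ℂ)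
    (b : X → ℝ) (hb : Integrable b μ)
    (hm : ∀ τ ∈ Metric.ball (0:ℂ) δ, AEStronglyMeasurable (G τ) μ)
    (hd : ∀ x, DifferentiableOn ℂ (fun τ => G τ x) (Metric.ball 0 δ))
    (hbd : ∀ τ ∈ Metric.ball (0:ℂ) δ, ∀ x, ‖G τ x‖ ≤ b x) :
    DifferentiableOn ℂ (fun τ => ∫ x, G τ x ∂μ) (Metric.ball 0 δ) := by
  intro τ0 hτ0
  obtain ⟨ρ, hρ, hsub⟩ : ∃ ρ > 0, Metric.closedBall τ0 (2 * ρ) ⊆ Metric.ball 0 δ := by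
    obtain ⟨ε, hε, h⟩ := Metric.isOpen_iff.1 Metric.isOpen_ball τ0 hτ0
    exact ⟨ε / 4, by positivity, (Metric.closedBall_subset_ball (by linarith)).trans h⟩
  have hopen : ∀ τ ∈ Metric.ball (0:ℂ) δ, ∀ x, HasDerivAt (fun τ => G τ x) (deriv (fun τ => G τ x) τ) τ :=
    fun τ hτ x => ((hd x).differentiableAt (Metric.isOpen_ball.mem_nhds hτ)).hasDerivAt
  have key := hasDerivAt_integral_of_dominated_loc_of_deriv_le (μ := μ) (F := G) (x₀ := τ0)
    (s := Metric.ball τ0 ρ) (bound := fun x => b x / ρ)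
    (F' := fun τ x => deriv (fun τ => G τ x) τ)
    (Metric.ball_mem_nhds _ hρ)
    (by filter_upwards [Metric.isOpen_ball.mem_nhds hτ0] with τ hτ using hm τ hτ)
    (hb.mono' (hm _ hτ0) (ae_of_all _ (hbd _ hτ0)))
    (by
      set s : ℕ → ℂ := fun k => (((δ - ‖τ0‖) / 2 : ℝ) / (k + 1) : ℂ) with hs
      have hpos : 0 < δ - ‖τ0‖ := by
        have := mem_ball_zero_iff.1 hτ0; linarith
      have hs0 : ∀ k, s k ≠ 0 := by
        intro k
        have h1 : (((δ - ‖τ0‖) / 2 : ℝ) : ℂ) ≠ 0 := ofReal_ne_zero.2 (by positivity)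
        have h2 : ((k:ℂ) + 1) ≠ 0 := Nat.cast_add_one_ne_zero k
        exact div_ne_zero h1 h2
      have hst : Tendsto s atTop (𝓝 0) := by
        have h := (tendsto_one_div_add_atTop_nhds_zero_nat (𝕜 := ℂ)).const_mul (((δ - ‖τ0‖) / 2 : ℝ) : ℂ)
        simp only [mul_zero] at h
        refine h.congr fun k => ?_
        simp only [hs]; ring
      have hsn : ∀ k, τ0 + s k ∈ Metric.ball (0:ℂ) δ := by
        intro k
        rw [mem_ball_zero_iff]
        have h1 : ‖s k‖ ≤ (δ - ‖τ0‖) / 2 := by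
          simp only [hs]
          have : ((k:ℂ) + 1) = ((k + 1 : ℝ) : ℂ) := by push_cast; rfl
          rw [this, ← ofReal_div, norm_real, Real.norm_of_nonneg (by positivity)]
          apply div_le_self (by linarith)
          have : (0:ℝ) ≤ k := Nat.cast_nonneg k
          linarith
        have := norm_add_le τ0 (s k)
        linarith
      refine aestronglyMeasurable_of_tendsto_ae atTop
        (f := fun k x => (s k)⁻¹ • (G (τ0 + s k) x - G τ0 x)) (fun k => ?_) (ae_of_all _ fun x => ?_)
      · exact AEStronglyMeasurable.const_smul ((hm _ (hsn k)).sub (hm _ hτ0)) ((s k)⁻¹ : ℂ)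
      · have h := hasDerivAt_iff_tendsto_slope_zero.1 (hopen τ0 hτ0 x)
        exact h.comp (tendsto_nhdsWithin_iff.2 ⟨hst, Eventually.of_forall hs0⟩))
    (ae_of_all _ fun x τ hτ => by
      refine norm_deriv_le_of_forall_mem_sphere_norm_le hρ ?_ ?_
      · refine ((hd x).mono ?_).diffContOnCl
        refine (Metric.closure_ball_subset_closedBall).trans (subset_trans ?_ hsub)
        apply Metric.closedBall_subset_closedBall'
        have := Metric.mem_ball.1 hτ; linarith
      · intro w hw
        apply hbd
        apply hsub
        rw [Metric.mem_closedBall]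
        have h1 := Metric.mem_sphere.1 hw
        have h2 := Metric.mem_ball.1 hτ
        linarith [dist_triangle w τ τ0])
    (hb.div_const ρ)
    (ae_of_all _ fun x τ hτ => hopen τ (hsub (by
      rw [Metric.mem_closedBall]; have := Metric.mem_ball.1 hτ; linarith)) x)
  exact key.2.differentiableAt.differentiableWithinAt

open Classical in
/-- the Picard map -/
def picT {X : Type*} [MeasurableSpace X] (μ : Measure X) (E : Set X) (H0 : X → X → ℝ)
    (Q : X → X → ℂ) (φ : ℂ → ℂ) (Y : X → ℂ) (ζ : X) : ℂ :=
  ∫ η, (H0 ζ η : ℂ) * (Q ζ η * E.piecewise (fun η => φ (Y η)) (fun _ => 1) η) ∂μ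

theorem picard {X : Type*} [MeasurableSpace X] (μ : Measure X) [SFinite μ] (E : Set X)
    (hE : MeasurableSet E) (H0 : X → X → ℝ) (hH0 : Measurable (Function.uncurry H0))
    (Q : ℂ → X → X → ℂ) (hQ : ∀ τ, Measurable (Function.uncurry (Q τ))) (δ C ε L κ : ℝ)
    (hInteg : ∀ ζ ∈ E, Integrable (H0 ζ) μ) (hC : ∀ ζ ∈ E, ∫ η, |H0 ζ η| ∂μ ≤ C)
    (hε : ∀ ζ ∈ E, ∫ η in E, |H0 ζ η| ∂μ ≤ ε)
    (h1 : ∀ ζ ∈ E, ∫ η, H0 ζ η ∂μ = 1)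
    (hQd : ∀ ζ ∈ E, ∀ η, DifferentiableOn ℂ (fun τ => Q τ ζ η) (Metric.ball 0 δ))
    (hQ1 : ∀ ζ ∈ E, ∀ η, ∀ τ ∈ Metric.ball (0:ℂ) δ, ‖Q τ ζ η - 1‖ ≤ κ) (hκ : κ ≤ 1) (hκ0 : 0 ≤ κ)
    (φ : ℂ → ℂ) (hφm : Measurable φ)
    (hφd : ∀ w ∈ Metric.closedBall (1:ℂ) (1/4), DifferentiableAt ℂ φ w) (hL : 0 ≤ L)
    (hφL : ∀ a ∈ Metric.closedBall (1:ℂ) (1/4), ∀ b ∈ Metric.closedBall (1:ℂ) (1/4),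
      ‖φ a - φ b‖ ≤ L * ‖a - b‖) (hφ1 : φ 1 = 1)
    (s1 : 2 * ε * L ≤ 1/2) (s2 : κ * (1 + L/4) * C + ε * (L/4) ≤ 1/4) :
    ∀ ζ ∈ E, ∃ g : ℂ → ℂ, DifferentiableOn ℂ g (Metric.ball 0 δ) ∧
      ∀ τ ∈ Metric.ball (0:ℂ) δ, ∀ y : X → ℂ, Measurable y →
        (∀ η ∈ E, y η ∈ Metric.closedBall (1:ℂ) (1/4)) →
        (∀ ζ ∈ E, y ζ = picT μ E H0 (Q τ) φ y ζ) → y ζ = g τ := by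
  classical
  set U := Metric.ball (0:ℂ) δ with hU
  set B := Metric.closedBall (1:ℂ) (1/4) with hB
  have one_mem : (1:ℂ) ∈ B := by simp [hB]
  -- bounds on Z
  have hZ : ∀ Y : X → ℂ, (∀ η ∈ E, Y η ∈ B) → ∀ η,
      ‖E.piecewise (fun η => φ (Y η)) (fun _ => (1:ℂ)) η - 1‖ ≤ E.indicator (fun _ => L/4) η := by
    intro Y hY η
    by_cases h : η ∈ E
    · rw [Set.piecewise_eq_of_mem _ _ _ h, Set.indicator_of_mem h]
      have := hφL _ (hY η h) 1 one_mem
      rw [hφ1] at this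
      have h2 := hY η h
      rw [hB, mem_closedBall_iff_norm] at h2
      nlinarith
    · rw [Set.piecewise_eq_of_notMem _ _ _ h, Set.indicator_of_notMem h]; simp
  have hind : ∀ η, E.indicator (fun _ => L/4) η ≤ L/4 := fun η => by
    by_cases h : η ∈ E
    · rw [Set.indicator_of_mem h]
    · rw [Set.indicator_of_notMem h]; positivity
  have hZ' : ∀ Y : X → ℂ, (∀ η ∈ E, Y η ∈ B) → ∀ η,
      ‖E.piecewise (fun η => φ (Y η)) (fun _ => (1:ℂ)) η‖ ≤ 1 + L/4 := by
    intro Y hY η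
    have h2 := (hZ Y hY η).trans (hind η)
    have := norm_add_le (E.piecewise (fun η => φ (Y η)) (fun _ => (1:ℂ)) η - 1) 1
    simp only [sub_add_cancel, norm_one] at this
    linarith
  have hQ2 : ∀ ζ ∈ E, ∀ η, ∀ τ ∈ U, ‖Q τ ζ η‖ ≤ 2 := by
    intro ζ hζ η τ hτ
    have := norm_add_le (Q τ ζ η - 1) 1
    simp only [sub_add_cancel, norm_one] at this
    linarith [hQ1 ζ hζ η τ hτ]
  have hmeasInt : ∀ Y : X → ℂ, Measurable Y → ∀ τ, Measurable (Function.uncurry fun ζ η =>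
      (H0 ζ η : ℂ) * (Q τ ζ η * E.piecewise (fun η => φ (Y η)) (fun _ => (1:ℂ)) η)) := by
    intro Y hY τ
    refine (measurable_ofReal.comp hH0).mul ((hQ τ).mul ?_)
    exact (Measurable.piecewise hE (hφm.comp hY) measurable_const).comp measurable_snd
  have hbd : ∀ Y : X → ℂ, (∀ η ∈ E, Y η ∈ B) → ∀ τ ∈ U, ∀ ζ ∈ E, ∀ η,
      ‖(H0 ζ η : ℂ) * (Q τ ζ η * E.piecewise (fun η => φ (Y η)) (fun _ => (1:ℂ)) η)‖ ≤
        |H0 ζ η| * (2 * (1 + L/4)) := by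
    intro Y hY τ hτ ζ hζ η
    rw [norm_mul, norm_mul, norm_real, Real.norm_eq_abs]
    have a1 := hQ2 ζ hζ η τ hτ
    have a2 := hZ' Y hY η
    gcongr
  have hintb : ∀ ζ ∈ E, Integrable (fun η => |H0 ζ η| * (2 * (1 + L/4))) μ :=
    fun ζ hζ => ((hInteg ζ hζ).abs).mul_const _
  have hInt : ∀ Y : X → ℂ, Measurable Y → (∀ η ∈ E, Y η ∈ B) → ∀ τ ∈ U, ∀ ζ ∈ E, Integrable
      (fun η => (H0 ζ η : ℂ) * (Q τ ζ η * E.piecewise (fun η => φ (Y η)) (fun _ => (1:ℂ)) η)) μ := by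
    intro Y hYm hY τ hτ ζ hζ
    refine (hintb ζ hζ).mono' ?_ (ae_of_all _ (hbd Y hY τ hτ ζ hζ))
    exact ((hmeasInt Y hYm τ).comp measurable_prodMk_left).aestronglyMeasurable
  have hmemB : ∀ Y : X → ℂ, Measurable Y → (∀ η ∈ E, Y η ∈ B) → ∀ τ ∈ U, ∀ ζ ∈ E,
      picT μ E H0 (Q τ) φ Y ζ ∈ B := by
    intro Y hYm hY τ hτ ζ hζ
    rw [hB, mem_closedBall_iff_norm]
    have e : picT μ E H0 (Q τ) φ Y ζ - 1 = ∫ η, ((H0 ζ η : ℂ) * (Q τ ζ η *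
        E.piecewise (fun η => φ (Y η)) (fun _ => (1:ℂ)) η) - (H0 ζ η : ℂ)) ∂μ := by
      have hiR : Integrable (fun η => (H0 ζ η : ℂ)) μ := (hInteg ζ hζ).ofReal
      rw [integral_sub (hInt Y hYm hY τ hτ ζ hζ) hiR, integral_complex_ofReal, h1 ζ hζ]
      simp [picT]
    rw [e]
    have hb2 : ∀ η, ‖(H0 ζ η : ℂ) * (Q τ ζ η *
        E.piecewise (fun η => φ (Y η)) (fun _ => (1:ℂ)) η) - (H0 ζ η : ℂ)‖ ≤
        |H0 ζ η| * (κ * (1 + L/4)) + E.indicator (fun η => |H0 ζ η| * (L/4)) η := by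
      intro η
      set Z := E.piecewise (fun η => φ (Y η)) (fun _ => (1:ℂ)) η with hZd
      have e2 : (H0 ζ η : ℂ) * (Q τ ζ η * Z) - (H0 ζ η : ℂ) =
          (H0 ζ η : ℂ) * ((Q τ ζ η - 1) * Z) + (H0 ζ η : ℂ) * (Z - 1) := by ring
      rw [e2]
      refine (norm_add_le _ _).trans (add_le_add ?_ ?_)
      · rw [norm_mul, norm_mul, norm_real, Real.norm_eq_abs]
        have a1 := hQ1 ζ hζ η τ hτ
        have a2 := hZ' Y hY η
        gcongr
      · rw [norm_mul, norm_real, Real.norm_eq_abs]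
        have := hZ Y hY η
        by_cases h : η ∈ E
        · rw [Set.indicator_of_mem h] at this ⊢
          gcongr
        · rw [Set.indicator_of_notMem h] at this ⊢
          have h0 : ‖Z - 1‖ = 0 := le_antisymm this (norm_nonneg _)
          rw [h0, mul_zero]
    have hi2 : Integrable (E.indicator (fun η => |H0 ζ η| * (L/4))) μ :=
      (((hInteg ζ hζ).abs).mul_const _).indicator hE
    have hi1 : Integrable (fun η => |H0 ζ η| * (κ * (1 + L/4))) μ := ((hInteg ζ hζ).abs).mul_const _
    refine (norm_integral_le_of_norm_le (hi1.add hi2) (ae_of_all _ hb2)).trans ?_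
    simp only [Pi.add_apply]
    rw [integral_add hi1 hi2, integral_indicator hE,
      integral_mul_const, integral_mul_const]
    have c1 := hC ζ hζ
    have c2 := hε ζ hζ
    have : 0 ≤ κ * (1 + L/4) := by positivity
    nlinarith
  have hcontr : ∀ Y Y' : X → ℂ, Measurable Y → (∀ η ∈ E, Y η ∈ B) → Measurable Y' →
      (∀ η ∈ E, Y' η ∈ B) → ∀ d : ℝ, (∀ η ∈ E, ‖Y η - Y' η‖ ≤ d) → ∀ τ ∈ U, ∀ ζ ∈ E,
      ‖picT μ E H0 (Q τ) φ Y ζ - picT μ E H0 (Q τ) φ Y' ζ‖ ≤ d / 2 := by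
    intro Y Y' hYm hY hYm' hY' d hd τ hτ ζ hζ
    unfold picT
    have hd0 : 0 ≤ d := (norm_nonneg _).trans (hd ζ hζ)
    rw [← integral_sub (hInt Y hYm hY τ hτ ζ hζ) (hInt Y' hYm' hY' τ hτ ζ hζ)]
    have hi2 : Integrable (E.indicator (fun η => |H0 ζ η| * (2 * (L * d)))) μ :=
      (((hInteg ζ hζ).abs).mul_const _).indicator hE
    refine (norm_integral_le_of_norm_le hi2 (ae_of_all _ fun η => ?_)).trans ?_
    · rw [← mul_sub, ← mul_sub, norm_mul, norm_mul, norm_real, Real.norm_eq_abs]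
      by_cases h : η ∈ E
      · rw [Set.indicator_of_mem h, Set.piecewise_eq_of_mem _ _ _ h, Set.piecewise_eq_of_mem _ _ _ h]
        have a1 := hQ2 ζ hζ η τ hτ
        have a2 := hφL _ (hY η h) _ (hY' η h)
        have a3 := hd η h
        have a4 : ‖φ (Y η) - φ (Y' η)‖ ≤ L * d := a2.trans (by gcongr)
        gcongr
      · rw [Set.indicator_of_notMem h, Set.piecewise_eq_of_notMem _ _ _ h,
          Set.piecewise_eq_of_notMem _ _ _ h]; simp
    · rw [integral_indicator hE, integral_mul_const]
      have c2 := hε ζ hζ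
      have : 0 ≤ 2 * (L * d) := by positivity
      calc _ ≤ ε * (2 * (L * d)) := by gcongr
        _ = (2 * ε * L) * d := by ring
        _ ≤ 1/2 * d := by gcongr
        _ = d/2 := by ring
  -- iterates
  set Yk : ℕ → ℂ → X → ℂ := fun k τ => Nat.rec (fun _ => 1) (fun _ Y => picT μ E H0 (Q τ) φ Y) k
    with hYk
  have hY0 : ∀ τ, Yk 0 τ = fun _ => 1 := fun τ => rfl
  have hYs : ∀ k τ, Yk (k+1) τ = picT μ E H0 (Q τ) φ (Yk k τ) := fun k τ => rfl
  clear_value Yk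
  have hYm : ∀ k τ, Measurable (Yk k τ) := by
    intro k τ
    induction k with
    | zero => rw [hY0]; exact measurable_const
    | succ k ih =>
      rw [hYs]
      exact ((hmeasInt _ ih τ).stronglyMeasurable.integral_prod_right).measurable
  have hYB : ∀ k, ∀ τ ∈ U, ∀ ζ ∈ E, Yk k τ ζ ∈ B := by
    intro k τ hτ
    induction k with
    | zero => intro ζ _; rw [hY0]; exact one_mem
    | succ k ih =>
      intro ζ hζ; rw [hYs]
      exact hmemB _ (hYm k τ) ih τ hτ ζ hζ
  have hYd : ∀ k, ∀ ζ ∈ E, DifferentiableOn ℂ (fun τ => Yk k τ ζ) U := by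
    intro k
    induction k with
    | zero => intro ζ _; simp only [hY0]; exact differentiableOn_const _
    | succ k ih =>
      intro ζ hζ
      simp only [hYs, picT]
      refine holo_integral _ _ (hintb ζ hζ) (fun τ hτ => (hInt _ (hYm k τ) (hYB k τ hτ) τ hτ ζ hζ).1)
        (fun η => ?_) (fun τ hτ η => hbd _ (hYB k τ hτ) τ hτ ζ hζ η)
      refine (differentiableOn_const _).mul ((hQd ζ hζ η).mul ?_)
      by_cases h : η ∈ E
      · simp only [Set.piecewise_eq_of_mem _ _ _ h]
        intro τ hτ
        exact (hφd _ (hYB k τ hτ η h)).comp_differentiableWithinAt τ (ih η h τ hτ)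
      · simp only [Set.piecewise_eq_of_notMem _ _ _ h]
        exact differentiableOn_const _
  have hYc : ∀ k, ∀ τ ∈ U, ∀ ζ ∈ E, ‖Yk (k+1) τ ζ - Yk k τ ζ‖ ≤ (1/2)^k := by
    intro k τ hτ
    induction k with
    | zero =>
      intro ζ hζ
      have h := hYB 1 τ hτ ζ hζ
      rw [hB, mem_closedBall_iff_norm] at h
      rw [hY0]; simp only [zero_add, pow_zero]; linarith
    | succ k ih =>
      intro ζ hζ
      rw [hYs (k+1), hYs k]
      have := hcontr _ _ (hYm (k+1) τ) (hYB (k+1) τ hτ) (hYm k τ) (hYB k τ hτ) _ ih τ hτ ζ hζ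
      rw [hYs k] at this
      calc _ ≤ _ := this
        _ = _ := by ring
  intro ζ hζ
  refine ⟨fun τ => 1 + ∑' k, (Yk (k+1) τ ζ - Yk k τ ζ), ?_, ?_⟩
  · refine (differentiableOn_const _).add ?_
    refine differentiableOn_tsum_of_summable_norm (u := fun k : ℕ => ((1:ℝ)/2)^k)
      (summable_geometric_of_lt_one (by norm_num) (by norm_num))
      (fun k => (hYd (k+1) ζ hζ).sub (hYd k ζ hζ)) Metric.isOpen_ball
      (fun k τ hτ => hYc k τ hτ ζ hζ)
  · intro τ hτ y hym hyB hye
    have hyk : ∀ k, ∀ ζ ∈ E, ‖y ζ - Yk k τ ζ‖ ≤ (1/2)^k := by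
      intro k
      induction k with
      | zero =>
        intro ζ hζ
        have h := hyB ζ hζ
        rw [hB, mem_closedBall_iff_norm] at h
        rw [hY0]; simp only [pow_zero]; linarith
      | succ k ih =>
        intro ζ hζ
        rw [hYs k, hye ζ hζ]
        have := hcontr _ _ hym hyB (hYm k τ) (hYB k τ hτ) _ ih τ hτ ζ hζ
        calc _ ≤ _ := this
          _ = _ := by ring
    have hlim : Tendsto (fun k => Yk k τ ζ) atTop (𝓝 (y ζ)) := by
      rw [tendsto_iff_norm_sub_tendsto_zero]
      refine squeeze_zero (fun _ => norm_nonneg _) (fun k => ?_)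
        (tendsto_pow_atTop_nhds_zero_of_lt_one (r := (1:ℝ)/2) (by norm_num) (by norm_num))
      rw [norm_sub_rev]; exact hyk k ζ hζ
    have hsum : Summable (fun k => Yk (k+1) τ ζ - Yk k τ ζ) :=
      Summable.of_norm_bounded (summable_geometric_of_lt_one (r := (1:ℝ)/2) (by norm_num) (by norm_num))
        (fun k => hYc k τ hτ ζ hζ)
    have h2 : Tendsto (fun k => 1 + ∑ i ∈ Finset.range k, (Yk (i+1) τ ζ - Yk i τ ζ)) atTop
        (𝓝 (1 + ∑' k, (Yk (k+1) τ ζ - Yk k τ ζ))) := hsum.hasSum.tendsto_sum_nat.const_add 1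
    refine tendsto_nhds_unique hlim (h2.congr fun k => ?_)
    rw [Finset.sum_range_sub (fun i => Yk i τ ζ), hY0]; ring

end

section
variable {n : ℕ}

def aT (r x : ℝ) : ℝ := max 0 (r - x)
def bT (r x : ℝ) : ℝ := aT r x ^ 2 - 2 * r * aT r x

/-- the real twist -/
def tw (r τ : ℝ) (p : Heis n) : Heis n :=
  (fun k => exp (I * (τ * aT r (nsq p.1) : ℝ)) * p.1 k, p.2 + τ * bT r (nsq p.1))

def dA (r : ℝ) (ζ η : Heis n) : ℝ := aT r (nsq ζ.1) - aT r (nsq η.1)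
def dB (r : ℝ) (ζ η : Heis n) : ℝ := bT r (nsq ζ.1) - bT r (nsq η.1)

def Aker (r : ℝ) (τ : ℂ) (ζ η : Heis n) : ℂ :=
  nsq ζ.1 + nsq η.1 - 2 * exp (I * (τ * dA r ζ η)) * hermInner ζ.1 η.1
    - I * (ζ.2 - η.2 + τ * dB r ζ η)

def Astar (r : ℝ) (τ : ℂ) (ζ η : Heis n) : ℂ :=
  nsq ζ.1 + nsq η.1 - 2 * exp (-I * (τ * dA r ζ η)) * (starRingEnd ℂ) (hermInner ζ.1 η.1)
    + I * (ζ.2 - η.2 + τ * dB r ζ η)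

theorem Astar_eq (r : ℝ) (τ : ℂ) (ζ η : Heis n) :
    Astar r τ ζ η = (starRingEnd ℂ) (Aker r ((starRingEnd ℂ) τ) ζ η) := by
  simp only [Aker, Astar, map_sub, map_add, map_mul, conj_ofReal, ← exp_conj, conj_I, conj_conj,
    map_ofNat]
  ring

theorem Aker_zero (r : ℝ) (ζ η : Heis n) : Aker r 0 ζ η = -I * wC (hmul (hinv η) ζ) := by
  have h2 := hermInner_conj ζ.1 η.1
  have h1 : nsq (-η.1 + ζ.1) = nsq ζ.1 + nsq η.1 - 2 * (hermInner ζ.1 η.1).re := by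
    have := nsq_add (-η.1) ζ.1
    rw [this]
    have hn : nsq (-η.1) = nsq η.1 := by simp [nsq, normSq_neg]
    rw [hn, hermInner_neg_left]
    have h3 := congrArg Complex.re h2
    simp only [conj_re, neg_re] at *
    linarith
  have h3 := congrArg Complex.im h2
  simp only [conj_im] at h3
  apply Complex.ext
  · simp [Aker, wC, hmul, hinv, h1]
  · simp [Aker, wC, hmul, hinv, h1, hermInner_neg_left]
    linarith

theorem norm_Aker_zero (r : ℝ) (ζ η : Heis n) : ‖Aker r 0 ζ η‖ = ‖wC (hmul (hinv η) ζ)‖ := by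
  rw [Aker_zero]; simp

theorem nsq_sub_le (r : ℝ) (ζ η : Heis n) : nsq (ζ.1 - η.1) ≤ ‖Aker r 0 ζ η‖ := by
  rw [norm_Aker_zero]
  have h := nsq_le_N (hmul (hinv η) ζ)
  have : (hmul (hinv η) ζ).1 = ζ.1 - η.1 := by simp only [hmul, hinv]; abel
  rwa [this] at h

theorem nsq_exp_mul (θ : ℝ) (z : Fin n → ℂ) : nsq (fun k => exp (I * θ) * z k) = nsq z := by
  simp [nsq, normSq_mul, normSq_exp_I]

theorem nsq_tw (r τ : ℝ) (p : Heis n) : nsq (tw r τ p).1 = nsq p.1 := nsq_exp_mul _ _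

theorem Aker_tw (r τ : ℝ) (ζ η : Heis n) :
    Aker r 0 (tw r τ ζ) (tw r τ η) = Aker r τ ζ η := by
  have h : hermInner (tw r τ ζ).1 (tw r τ η).1 =
      exp (I * (τ * dA r ζ η)) * hermInner ζ.1 η.1 := by
    unfold hermInner tw
    simp only
    rw [Finset.mul_sum]
    refine Finset.sum_congr rfl fun k _ => ?_
    rw [map_mul, ← exp_conj]
    have : exp (I * (τ * dA r ζ η)) = exp (I * (τ * aT r (nsq ζ.1) : ℝ)) *
        exp ((starRingEnd ℂ) (I * (τ * aT r (nsq η.1) : ℝ))) := by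
      rw [← exp_add]
      congr 1
      rw [map_mul, conj_I, conj_ofReal, dA]; push_cast; ring
    rw [this]; ring
  unfold Aker
  rw [h, nsq_tw, nsq_tw]
  simp only [zero_mul, mul_zero, exp_zero, tw, dB]
  push_cast
  ring

theorem aT_sub_sq_of_le {r x y : ℝ} (hx : x ≤ r) :
    (bT r x - bT r y) + 2 * (aT r x - aT r y) * x = -(aT r x - aT r y) ^ 2 := by
  have h : aT r x = r - x := max_eq_right (by linarith)
  unfold bT; rw [h]; ring

theorem aT_abs_le {r x y : ℝ} (hx0 : 0 ≤ x) (hy0 : 0 ≤ y) (hr : 0 ≤ r) (hx : x ≤ r) : |aT r x - aT r y| ≤ r := by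
  unfold aT
  rw [abs_le]
  constructor <;> rcases max_cases 0 (r - x) with h | h <;> rcases max_cases 0 (r - y) with h' | h' <;>
    linarith

/-- |Δa| ≤ 2 √r √(nsq (z - z')) squared form -/
theorem dA_sq_le {r : ℝ} (hr : 0 ≤ r) (ζ η : Heis n) (hx : nsq ζ.1 ≤ r) :
    dA r ζ η ^ 2 ≤ 4 * r * nsq (ζ.1 - η.1) := by
  have hx0 := nsq_nonneg ζ.1
  have hy0 := nsq_nonneg η.1
  have hd0 := nsq_nonneg (ζ.1 - η.1)
  set a := √(nsq ζ.1) with ha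
  set b := √(nsq η.1) with hb
  have ha2 : a ^ 2 = nsq ζ.1 := Real.sq_sqrt hx0
  have hb2 : b ^ 2 = nsq η.1 := Real.sq_sqrt hy0
  have ha0 : 0 ≤ a := Real.sqrt_nonneg _
  have hb0 : 0 ≤ b := Real.sqrt_nonneg _
  have hsub : nsq (ζ.1 - η.1) = nsq ζ.1 + nsq η.1 - 2 * (hermInner ζ.1 η.1).re := by
    have := nsq_add ζ.1 (-η.1)
    rw [← sub_eq_add_neg] at this
    have hn : nsq (-η.1) = nsq η.1 := by simp [nsq, normSq_neg]
    rw [this, hn, hermInner_neg_right]; simp; ring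
  have hcs : (hermInner ζ.1 η.1).re ≤ a * b := by
    have h1 := hermInner_abs ζ.1 η.1
    have h2 := Complex.re_le_norm (hermInner ζ.1 η.1)
    have h3 : ‖hermInner ζ.1 η.1‖ ≤ a * b := by
      apply le_of_sq_le_sq _ (by positivity)
      rw [mul_pow, ha2, hb2]; exact h1
    linarith
  have key : (a - b) ^ 2 ≤ nsq (ζ.1 - η.1) := by rw [hsub]; nlinarith
  have har : a ^ 2 ≤ r := by rw [ha2]; exact hx
  unfold dA aT
  rw [← ha2, ← hb2, max_eq_right (by linarith : 0 ≤ r - a ^ 2)]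
  rcases le_total (b ^ 2) r with h | h
  · rw [max_eq_right (by linarith)]
    have h1 : (r - a ^ 2 - (r - b ^ 2)) ^ 2 = (a - b) ^ 2 * (a + b) ^ 2 := by ring
    have h2 : (a + b) ^ 2 ≤ 4 * r := by nlinarith [sq_nonneg (a - b)]
    rw [h1]
    calc _ ≤ (a - b) ^ 2 * (4 * r) := by gcongr
      _ ≤ nsq (ζ.1 - η.1) * (4 * r) := by gcongr
      _ = _ := by ring
  · rw [max_eq_left (by linarith)]
    set c := √r with hc
    have hc2 : c ^ 2 = r := Real.sq_sqrt hr
    have hc0 : 0 ≤ c := Real.sqrt_nonneg _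
    have hac : a ≤ c := by apply le_of_sq_le_sq _ hc0; rw [hc2]; exact har
    have hcb : c ≤ b := by apply le_of_sq_le_sq _ hb0; rw [hc2]; exact h
    have h1 : (r - a ^ 2 - 0) ^ 2 = (c - a) ^ 2 * (c + a) ^ 2 := by rw [← hc2]; ring
    have h2 : (c + a) ^ 2 ≤ 4 * r := by rw [← hc2]; nlinarith
    have h3 : (c - a) ^ 2 ≤ (a - b) ^ 2 := by nlinarith
    rw [h1]
    calc _ ≤ (a - b) ^ 2 * (4 * r) := by gcongr
      _ ≤ nsq (ζ.1 - η.1) * (4 * r) := by gcongr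
      _ = _ := by ring

theorem Aker_sub (r : ℝ) (τ : ℂ) (ζ η : Heis n) (hx : nsq ζ.1 ≤ r) :
    Aker r τ ζ η - Aker r 0 ζ η = I * τ * (dA r ζ η : ℂ) ^ 2
      - 2 * I * τ * dA r ζ η * hermInner ζ.1 (η.1 - ζ.1)
      - 2 * (exp (I * (τ * dA r ζ η)) - 1 - I * (τ * dA r ζ η)) *
        (nsq ζ.1 + hermInner ζ.1 (η.1 - ζ.1)) := by
  have h1 : hermInner ζ.1 (η.1 - ζ.1) = hermInner ζ.1 η.1 - nsq ζ.1 := by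
    rw [sub_eq_add_neg, hermInner_add_right, hermInner_neg_right, hermInner_self]; ring
  have h2 : ((bT r (nsq ζ.1) - bT r (nsq η.1) : ℝ) : ℂ) = ((-(dA r ζ η) ^ 2 - 2 * dA r ζ η * nsq ζ.1 : ℝ) : ℂ) := by
    have h3 := aT_sub_sq_of_le (y := nsq η.1) hx
    congr 1; unfold dA; linarith
  rw [h1]
  unfold Aker dB
  rw [h2]
  push_cast
  simp only [zero_mul, mul_zero, exp_zero]
  ring

theorem Aker_est {r : ℝ} (hr : 0 ≤ r) (hr1 : r ≤ 1) {τ : ℂ} (hτ : ‖τ‖ ≤ 1) (ζ η : Heis n)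
    (hx : nsq ζ.1 ≤ r) : ‖Aker r τ ζ η - Aker r 0 ζ η‖ ≤ 20 * ‖τ‖ * ‖Aker r 0 ζ η‖ := by
  set D := nsq (ζ.1 - η.1) with hD
  have hD0 : 0 ≤ D := nsq_nonneg _
  have hDA : D ≤ ‖Aker r 0 ζ η‖ := nsq_sub_le r ζ η
  have hda := dA_sq_le hr ζ η hx
  have hda1 : |dA r ζ η| ≤ r := aT_abs_le (nsq_nonneg _) (nsq_nonneg _) hr hx
  set d := dA r ζ η with hd
  have hx0 := nsq_nonneg ζ.1
  have hherm : ‖hermInner ζ.1 (η.1 - ζ.1)‖ ^ 2 ≤ r * D := by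
    refine (hermInner_abs _ _).trans ?_
    have : nsq (η.1 - ζ.1) = D := by
      rw [hD, ← neg_sub ζ.1 η.1]; simp only [nsq, Pi.neg_apply, normSq_neg]
    rw [this]; gcongr
  set h := ‖hermInner ζ.1 (η.1 - ζ.1)‖ with hh
  have hh0 : 0 ≤ h := norm_nonneg _
  have hdh : |d| * h ≤ 2 * r * D := by
    apply le_of_sq_le_sq _ (by positivity)
    rw [mul_pow, sq_abs]
    calc _ ≤ (4 * r * D) * (r * D) := by gcongr
      _ = _ := by ring
  have hd2 : |d| ^ 2 ≤ 4 * D := by rw [sq_abs]; nlinarith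
  have hx1 : ‖I * (τ * d)‖ ≤ ‖τ‖ * |d| := by simp
  have hd1 : |d| ≤ 1 := hda1.trans hr1
  have hexp : ‖exp (I * (τ * d)) - 1 - I * (τ * d)‖ ≤ ‖τ‖ * |d| ^ 2 := by
    have h1 : ‖I * (τ * d)‖ ≤ 1 := hx1.trans (by nlinarith [abs_nonneg d, norm_nonneg τ])
    refine (Complex.norm_exp_sub_one_sub_id_le h1).trans ?_
    calc ‖I * (τ * d)‖ ^ 2 ≤ (‖τ‖ * |d|) ^ 2 := by gcongr
      _ = ‖τ‖ * (‖τ‖ * |d| ^ 2) := by ring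
      _ ≤ 1 * (‖τ‖ * |d| ^ 2) := by gcongr
      _ = _ := by ring
  rw [Aker_sub r τ ζ η hx]
  have hdn : ‖(d : ℂ)‖ = |d| := by simp
  have t1 : ‖I * τ * (d : ℂ) ^ 2‖ ≤ ‖τ‖ * (4 * D) := by
    rw [norm_mul, norm_mul, norm_pow, norm_I, hdn, one_mul]; gcongr
  have t2 : ‖2 * I * τ * d * hermInner ζ.1 (η.1 - ζ.1)‖ ≤ ‖τ‖ * (4 * D) := by
    rw [norm_mul, norm_mul, norm_mul, norm_mul, norm_I, hdn, ← hh, Complex.norm_ofNat]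
    calc 2 * 1 * ‖τ‖ * |d| * h = ‖τ‖ * (2 * (|d| * h)) := by ring
      _ ≤ ‖τ‖ * (4 * D) := mul_le_mul_of_nonneg_left (by nlinarith) (norm_nonneg _)
  have t3 : ‖2 * (exp (I * (τ * d)) - 1 - I * (τ * d)) * (nsq ζ.1 + hermInner ζ.1 (η.1 - ζ.1))‖
      ≤ ‖τ‖ * (12 * D) := by
    rw [norm_mul, norm_mul, Complex.norm_ofNat]
    have h4 : ‖(nsq ζ.1 + hermInner ζ.1 (η.1 - ζ.1) : ℂ)‖ ≤ nsq ζ.1 + h := by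
      refine (norm_add_le _ _).trans ?_
      rw [norm_real, Real.norm_of_nonneg hx0]
    calc _ ≤ 2 * (‖τ‖ * |d| ^ 2) * (nsq ζ.1 + h) := by gcongr
      _ = ‖τ‖ * (2 * (|d| ^ 2 * nsq ζ.1 + |d| * (|d| * h))) := by ring
      _ ≤ ‖τ‖ * (2 * ((4 * D) * 1 + 1 * (2 * r * D))) := by
          gcongr; exact hx.trans hr1
      _ ≤ ‖τ‖ * (12 * D) := mul_le_mul_of_nonneg_left (by nlinarith) (norm_nonneg _)
  have t4 := norm_sub_le (I * τ * (d : ℂ) ^ 2 - 2 * I * τ * d * hermInner ζ.1 (η.1 - ζ.1))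
    (2 * (exp (I * (τ * d)) - 1 - I * (τ * d)) * (nsq ζ.1 + hermInner ζ.1 (η.1 - ζ.1)))
  have t5 := norm_sub_le (I * τ * (d : ℂ) ^ 2) (2 * I * τ * d * hermInner ζ.1 (η.1 - ζ.1))
  calc _ ≤ ‖τ‖ * (20 * D) := by linarith
    _ ≤ ‖τ‖ * (20 * ‖Aker r 0 ζ η‖) := by gcongr
    _ = _ := by ring

end

section
variable {n : ℕ}

theorem cpow_near (s : ℂ) : ∃ C > 0, ∃ ρ > 0, ρ < 1 ∧ ∀ w : ℂ, ‖w‖ ≤ ρ → ‖(1 + w) ^ s - 1‖ ≤ C * ‖w‖ := by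
  have hd : HasDerivAt (fun w : ℂ => (1 + w) ^ s) (s * (1 + 0) ^ (s - 1) * 1) 0 := by
    apply HasDerivAt.cpow_const
    · exact (hasDerivAt_id (0:ℂ)).const_add 1
    · simp
  have hO := hd.isBigO_sub
  obtain ⟨C, hC, h⟩ := hO.exists_pos
  rw [Asymptotics.IsBigOWith_def] at h
  obtain ⟨ε, hε, hb⟩ := Metric.eventually_nhds_iff.1 h
  refine ⟨C, hC, min (ε/2) (1/2), by positivity, by
    have := min_le_right (ε/2) (1/2); linarith, fun w hw => ?_⟩
  have h1 : dist w 0 < ε := by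
    rw [dist_zero_right]
    have := min_le_left (ε/2) (1/2); linarith
  simpa using hb h1

def Qk (r : ℝ) (τ : ℂ) (ζ η : Heis n) : ℂ :=
  ((1 + (Aker r τ ζ η - Aker r 0 ζ η) / Aker r 0 ζ η) *
    (1 + (Astar r τ ζ η - Astar r 0 ζ η) / Astar r 0 ζ η)) ^ (-(n:ℂ) / 2)

def Gam (ζ η : Heis n) : ℝ := Gm (hmul (hinv η) ζ)

theorem Gam_eq (ζ η : Heis n) : Gam ζ η = (1 / ‖wC (hmul (hinv η) ζ)‖) ^ n := Gm_eq _

theorem Gam_nonneg (ζ η : Heis n) : 0 ≤ Gam ζ η := by rw [Gam_eq]; positivity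

theorem Astar_zero (r : ℝ) (ζ η : Heis n) : Astar r 0 ζ η = (starRingEnd ℂ) (Aker r 0 ζ η) := by
  rw [Astar_eq]; simp

theorem ratio_le {r : ℝ} (hr : 0 ≤ r) (hr1 : r ≤ 1) {τ : ℂ} (hτ : ‖τ‖ ≤ 1) (ζ η : Heis n)
    (hx : nsq ζ.1 ≤ r) : ‖(Aker r τ ζ η - Aker r 0 ζ η) / Aker r 0 ζ η‖ ≤ 20 * ‖τ‖ := by
  rw [norm_div]
  exact div_le_of_le_mul₀ (norm_nonneg _) (by positivity) (Aker_est hr hr1 hτ ζ η hx)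

theorem ratio_le' {r : ℝ} (hr : 0 ≤ r) (hr1 : r ≤ 1) {τ : ℂ} (hτ : ‖τ‖ ≤ 1) (ζ η : Heis n)
    (hx : nsq ζ.1 ≤ r) : ‖(Astar r τ ζ η - Astar r 0 ζ η) / Astar r 0 ζ η‖ ≤ 20 * ‖τ‖ := by
  rw [Astar_zero, Astar_eq, ← map_sub, ← map_div₀, RCLike.norm_conj]
  refine (ratio_le hr hr1 (by rwa [RCLike.norm_conj]) ζ η hx).trans_eq ?_
  rw [RCLike.norm_conj]

theorem q_est {r : ℝ} (hr : 0 ≤ r) (hr1 : r ≤ 1) {τ : ℂ} (hτ : ‖τ‖ ≤ 1/20) (ζ η : Heis n)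
    (hx : nsq ζ.1 ≤ r) : ‖(1 + (Aker r τ ζ η - Aker r 0 ζ η) / Aker r 0 ζ η) *
    (1 + (Astar r τ ζ η - Astar r 0 ζ η) / Astar r 0 ζ η) - 1‖ ≤ 60 * ‖τ‖ := by
  have h1 := ratio_le hr hr1 (by linarith) ζ η hx (τ := τ)
  have h2 := ratio_le' hr hr1 (by linarith) ζ η hx (τ := τ)
  set x := (Aker r τ ζ η - Aker r 0 ζ η) / Aker r 0 ζ η
  set y := (Astar r τ ζ η - Astar r 0 ζ η) / Astar r 0 ζ η
  have e : (1 + x) * (1 + y) - 1 = x + y + x * y := by ring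
  rw [e]
  have t := norm_nonneg τ
  calc _ ≤ ‖x‖ + ‖y‖ + ‖x‖ * ‖y‖ := by
        refine (norm_add_le _ _).trans (add_le_add (norm_add_le _ _) (norm_mul_le _ _))
    _ ≤ 20 * ‖τ‖ + 20 * ‖τ‖ + (20 * ‖τ‖) * (20 * ‖τ‖) := by gcongr
    _ ≤ _ := by nlinarith

theorem Qk_props (n : ℕ) : ∃ δ > 0, δ ≤ 1 ∧ ∃ C ≥ 0, ∀ r : ℝ, 0 ≤ r → r ≤ 1 → ∀ ζ : Heis n,
    nsq ζ.1 ≤ r → ∀ η, DifferentiableOn ℂ (fun τ => Qk r τ ζ η) (Metric.ball 0 δ) ∧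
      ∀ τ ∈ Metric.ball (0:ℂ) δ, ‖Qk r τ ζ η - 1‖ ≤ C * ‖τ‖ := by
  obtain ⟨C, hC, ρ, hρ, hρ1, h⟩ := cpow_near (-(n:ℂ)/2)
  have hδ : (0:ℝ) < min (1/20) (ρ/60) := by positivity
  have a1 := min_le_left (1/20) (ρ/60)
  have a2 := min_le_right (1/20) (ρ/60)
  set δ := min (1/20) (ρ/60)
  refine ⟨δ, hδ, by linarith, C * 60, by positivity, fun r hr hr1 ζ hx η => ?_⟩
  have hq : ∀ τ ∈ Metric.ball (0:ℂ) δ, ‖(1 + (Aker r τ ζ η - Aker r 0 ζ η) / Aker r 0 ζ η) *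
    (1 + (Astar r τ ζ η - Astar r 0 ζ η) / Astar r 0 ζ η) - 1‖ ≤ 60 * ‖τ‖ := by
    intro τ hτ
    rw [mem_ball_zero_iff] at hτ
    exact q_est hr hr1 (by linarith) ζ η hx
  have hq2 : ∀ τ ∈ Metric.ball (0:ℂ) δ, 60 * ‖τ‖ ≤ ρ := by
    intro τ hτ
    rw [mem_ball_zero_iff] at hτ
    linarith
  constructor
  · intro τ hτ
    apply DifferentiableAt.differentiableWithinAt
    unfold Qk
    apply DifferentiableAt.cpow_const
    · unfold Aker Astar; fun_prop
    · have := mem_slitPlane_of_norm_lt_one (z := (1 + (Aker r τ ζ η - Aker r 0 ζ η) / Aker r 0 ζ η) *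
        (1 + (Astar r τ ζ η - Astar r 0 ζ η) / Astar r 0 ζ η) - 1)
        (by linarith [hq τ hτ, hq2 τ hτ])
      simpa using this
  · intro τ hτ
    have := h _ ((hq τ hτ).trans (hq2 τ hτ))
    rw [add_sub_cancel] at this
    refine this.trans ?_
    rw [mul_assoc]
    gcongr
    exact hq τ hτ

theorem Qk_real (hn : 1 ≤ n) {r : ℝ} (hr : 0 ≤ r) (hr1 : r ≤ 1) {τ : ℝ} (hτ : |τ| ≤ 1) (ζ η : Heis n)
    (hx : nsq ζ.1 ≤ r) : (Gam ζ η : ℂ) * Qk r τ ζ η = (Gam (tw r τ ζ) (tw r τ η) : ℂ) := by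
  have hτ' : ‖(τ:ℂ)‖ ≤ 1 := by simpa using hτ
  have e1 := norm_Aker_zero r ζ η
  have e2 := norm_Aker_zero r (tw r τ ζ) (tw r τ η)
  rw [Aker_tw] at e2
  have hest := Aker_est hr hr1 hτ' ζ η hx
  rw [Gam_eq, Gam_eq, ← e1, ← e2]
  by_cases h0 : Aker r 0 ζ η = 0
  · rw [h0] at hest
    simp only [sub_zero, norm_zero, mul_zero, norm_le_zero_iff] at hest
    have hn0 : n ≠ 0 := by omega
    simp [h0, hest, hn0]
  · have q : (1 + (Aker r τ ζ η - Aker r 0 ζ η) / Aker r 0 ζ η) *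
        (1 + (Astar r τ ζ η - Astar r 0 ζ η) / Astar r 0 ζ η) =
        (((‖Aker r τ ζ η‖ / ‖Aker r 0 ζ η‖) ^ 2 : ℝ) : ℂ) := by
      have h0' : (starRingEnd ℂ) (Aker r 0 ζ η) ≠ 0 := by simpa using h0
      rw [Astar_zero, Astar_eq, conj_ofReal, sub_div, sub_div, div_self h0, div_self h0']
      rw [add_sub_cancel, add_sub_cancel, div_mul_div_comm, mul_conj, mul_conj, normSq_eq_norm_sq,
        normSq_eq_norm_sq, ← ofReal_div, div_pow]
    unfold Qk
    rw [q]
    have h3 : (-(n:ℂ)/2) = ((-(n:ℝ)/2 : ℝ) : ℂ) := by push_cast; ring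
    rw [h3, ← ofReal_cpow (by positivity), ← ofReal_mul]
    congr 1
    have hp : 0 < ‖Aker r 0 ζ η‖ := norm_pos_iff.2 h0
    have h4 : ((‖Aker r τ ζ η‖ / ‖Aker r 0 ζ η‖) ^ 2) ^ (-(n:ℝ)/2) =
        (‖Aker r 0 ζ η‖ / ‖Aker r τ ζ η‖) ^ n := by
      rw [← Real.rpow_natCast, ← Real.rpow_mul (by positivity)]
      have : ((2:ℕ):ℝ) * (-(n:ℝ)/2) = -(n:ℝ) := by push_cast; ring
      rw [this, Real.rpow_neg (by positivity), Real.rpow_natCast, ← inv_pow, inv_div]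
    rw [h4, ← mul_pow]
    congr 1
    field_simp

theorem continuous_nsq : Continuous (nsq : (Fin n → ℂ) → ℝ) := (contDiff_nsq (k := 0)).continuous

theorem continuous_aT (r : ℝ) : Continuous (aT r) := by unfold aT; fun_prop
theorem continuous_bT (r : ℝ) : Continuous (bT r) := by
  have := continuous_aT r
  unfold bT; fun_prop

theorem continuous_Aker (r : ℝ) (τ : ℂ) :
    Continuous (Function.uncurry (Aker r τ) : Heis n × Heis n → ℂ) := by
  have h1 := continuous_aT r
  have h2 := continuous_bT r
  have h3 := continuous_nsq (n := n)
  unfold Aker Function.uncurry dA dB hermInner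
  have h4 : Continuous fun a : Heis n × Heis n => ∑ j, a.1.1 j * (starRingEnd ℂ) (a.2.1 j) := by
    refine continuous_finsetSum _ fun j _ => ?_
    exact ((continuous_apply j).comp (continuous_fst.comp continuous_fst)).mul
      (continuous_conj.comp ((continuous_apply j).comp (continuous_fst.comp continuous_snd)))
  fun_prop

theorem continuous_Astar (r : ℝ) (τ : ℂ) :
    Continuous (Function.uncurry (Astar r τ) : Heis n × Heis n → ℂ) := by
  have : (Function.uncurry (Astar r τ) : Heis n × Heis n → ℂ) =
      fun a => (starRingEnd ℂ) (Function.uncurry (Aker r ((starRingEnd ℂ) τ)) a) := by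
    funext a; exact Astar_eq _ _ _ _
  rw [this]
  exact continuous_conj.comp (continuous_Aker r _)

theorem measurable_Qk (r : ℝ) (τ : ℂ) :
    Measurable (Function.uncurry (Qk r τ) : Heis n × Heis n → ℂ) := by
  have a := (continuous_Aker (n := n) r τ).measurable
  have b := (continuous_Aker (n := n) r 0).measurable
  have c := (continuous_Astar (n := n) r τ).measurable
  have d := (continuous_Astar (n := n) r 0).measurable
  exact ((((a.sub b).div b).const_add 1).mul (((c.sub d).div d).const_add 1)).pow_const _

theorem measurable_Gam : Measurable (Function.uncurry Gam : Heis n × Heis n → ℝ) := by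
  have b := (continuous_Aker (n := n) 0 0).measurable
  have : (Function.uncurry Gam : Heis n × Heis n → ℝ) =
      fun a => (1 / ‖Function.uncurry (Aker 0 0) a‖) ^ n := by
    funext a
    show Gam a.1 a.2 = (1 / ‖Aker 0 0 a.1 a.2‖) ^ n
    rw [Gam_eq, norm_Aker_zero]
  rw [this]
  exact (measurable_const.div b.norm).pow_const n

end

section
variable {n : ℕ}

theorem mp_hmul (a : Heis n) : MeasurePreserving (hmul a) volume volume := by
  have h := MeasurePreserving.skew_product (μa := (volume : Measure (Fin n → ℂ)))
    (μc := (volume : Measure ℝ)) (μd := (volume : Measure ℝ))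
    (measurePreserving_add_left (volume : Measure (Fin n → ℂ)) a.1)
    (g := fun z t => (a.2 + 2 * (hermInner a.1 z).im) + t) ?_ ?_
  · have e : (hmul a : Heis n → Heis n) =
        fun p => (a.1 + p.1, (a.2 + 2 * (hermInner a.1 p.1).im) + p.2) := by
      funext p; simp only [hmul]; congr 1; ring
    rw [e]; exact h
  · have h1 : Continuous fun p : Heis n => hermInner a.1 p.1 := by
      unfold hermInner
      refine continuous_finsetSum _ fun j _ => ?_
      exact continuous_const.mul (continuous_conj.comp ((continuous_apply j).comp continuous_fst))
    have : Continuous fun p : Heis n => (a.2 + 2 * (hermInner a.1 p.1).im) + p.2 := by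
      have := Complex.continuous_im.comp h1
      simp only [Function.comp_def] at this
      fun_prop
    exact this.measurable
  · exact Eventually.of_forall fun z => (measurePreserving_add_left (volume : Measure ℝ) _).map_eq

theorem mp_circ (c : Circle) : MeasurePreserving (fun z : Fin n → ℂ => fun k => (c:ℂ) * z k) volume volume := by
  have h : MeasurePreserving (fun z : ℂ => (c:ℂ) * z) volume volume :=
    (rotation c).measurePreserving
  exact volume_preserving_pi (fun _ => h)

theorem lint_rot (θ : (Fin n → ℂ) → ℝ) (hθ : Measurable θ)
    (hinv : ∀ (c : Circle) z, θ (fun k => (c:ℂ) * z k) = θ z)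
    (g : (Fin n → ℂ) → ENNReal) (hg : Measurable g) :
    ∫⁻ z : Fin n → ℂ, g (fun k => exp (I * θ z) * z k) = ∫⁻ z, g z := by
  have key : ∀ θ : (Fin n → ℂ) → ℝ, Measurable θ →
      (∀ (c : Circle) z, θ (fun k => (c:ℂ) * z k) = θ z) →
      ∫⁻ z : Fin n → ℂ, g (fun k => exp (I * θ z) * z k) =
      ∫⁻ z : Fin n → ℂ, ∫⁻ α : UnitAddCircle, g (fun k => (AddCircle.toCircle α : ℂ) * z k) := by
    intro θ hθ hinv
    have h1 : ∀ α : UnitAddCircle, ∫⁻ z : Fin n → ℂ, g (fun k => exp (I * θ z) * z k) =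
        ∫⁻ z : Fin n → ℂ, g (fun k => exp (I * θ z) * (AddCircle.toCircle α : ℂ) * z k) := by
      intro α
      have hm : Measurable fun z : Fin n → ℂ => g (fun k => exp (I * θ z) * z k) := by
        refine hg.comp (measurable_pi_lambda _ fun k => ?_)
        fun_prop
      rw [← (mp_circ (AddCircle.toCircle α)).lintegral_comp hm]
      refine lintegral_congr fun z => ?_
      rw [hinv]; simp only [mul_assoc]
    have h2 : ∫⁻ α : UnitAddCircle, ∫⁻ z : Fin n → ℂ, g (fun k => exp (I * θ z) * z k) =
        ∫⁻ z : Fin n → ℂ, g (fun k => exp (I * θ z) * z k) := by simp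
    rw [← h2, lintegral_congr h1, lintegral_lintegral_swap]
    · refine lintegral_congr fun z => ?_
      rw [← lintegral_add_left_eq_self (fun α : UnitAddCircle => g (fun k => (AddCircle.toCircle α : ℂ) * z k)) ((θ z / (2 * Real.pi) : ℝ) : UnitAddCircle)]
      refine lintegral_congr fun α => ?_
      congr 1; funext k
      show _ = ((AddCircle.toCircle _ : Circle) : ℂ) * z k
      rw [AddCircle.toCircle_add, AddCircle.toCircle_apply_mk]
      congr 1
      rw [Circle.coe_mul, Circle.coe_exp]
      congr 2
      push_cast
      have : (Real.pi : ℂ) ≠ 0 := by exact_mod_cast Real.pi_ne_zero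
      field_simp
    · refine Measurable.aemeasurable ?_
      refine hg.comp (measurable_pi_lambda _ fun k => ?_)
      have : Measurable fun α : UnitAddCircle => (AddCircle.toCircle α : ℂ) :=
        (continuous_subtype_val.comp AddCircle.continuous_toCircle).measurable
      have h3 : Measurable fun c : UnitAddCircle × (Fin n → ℂ) => (AddCircle.toCircle c.1 : ℂ) :=
        this.comp measurable_fst
      have h4 : Measurable fun c : UnitAddCircle × (Fin n → ℂ) => cexp (I * (θ c.2)) := by fun_prop
      have h5 : Measurable fun c : UnitAddCircle × (Fin n → ℂ) => c.2 k := by fun_prop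
      exact (h4.mul h3).mul h5
  rw [key θ hθ hinv, ← key (fun _ => 0) measurable_const (by simp)]
  simp

theorem mp_tw (r τ : ℝ) : MeasurePreserving (tw r τ : Heis n → Heis n) volume volume := by
  have hn := continuous_nsq (n := n)
  have ha := (continuous_aT r).comp hn
  have hb := (continuous_bT r).comp hn
  simp only [Function.comp_def] at ha hb
  have hR : Measurable fun z : Fin n → ℂ => fun k => exp (I * (τ * aT r (nsq z) : ℝ)) * z k := by
    refine measurable_pi_lambda _ fun k => ?_
    have := ha.measurable
    fun_prop
  have h1 : MeasurePreserving (fun z : Fin n → ℂ => fun k => exp (I * (τ * aT r (nsq z) : ℝ)) * z k)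
      volume volume := by
    refine ⟨hR, ?_⟩
    ext s hs
    rw [Measure.map_apply hR hs, ← lintegral_indicator_one (hR hs), ← lintegral_indicator_one hs]
    rw [← lint_rot (fun z => τ * aT r (nsq z)) ((ha.measurable).const_mul τ) ?_ _ (measurable_one.indicator hs)]
    · rfl
    · intro c z
      have : nsq (fun k => (c:ℂ) * z k) = nsq z := by simp [nsq, normSq_mul]
      rw [this]
  have h := MeasurePreserving.skew_product (μa := (volume : Measure (Fin n → ℂ)))
    (μc := (volume : Measure ℝ)) (μd := (volume : Measure ℝ)) h1
    (g := fun z t => t + τ * bT r (nsq z)) ?_ ?_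
  · exact h
  · have : Continuous fun p : Heis n => p.2 + τ * bT r (nsq p.1) := by
      have := hb.comp continuous_fst (X := Heis n)
      simp only [Function.comp_def] at this
      fun_prop
    exact this.measurable
  · exact Eventually.of_forall fun z => (measurePreserving_add_right (volume : Measure ℝ) _).map_eq
end

section
variable {n : ℕ}

/-- the standard inversion -/
def Iv (p : Heis n) : Heis n := inv0 (fun _ => 1) 1 p

def dilL (s : ℝ) : Heis n →L[ℝ] Heis n :=
  (s • ContinuousLinearMap.id ℝ (Fin n → ℂ)).prodMap (s ^ 2 • ContinuousLinearMap.id ℝ ℝ)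

theorem dilL_apply (s : ℝ) (p : Heis n) : dilL s p = dil s p := by
  simp [dilL, dil]; rfl

theorem det_dilL (s : ℝ) : (dilL s : Heis n →L[ℝ] Heis n).det = s ^ (2 * n + 2) := by
  have e : ((dilL s : Heis n →L[ℝ] Heis n) : Heis n →ₗ[ℝ] Heis n) =
      (s • (LinearMap.id : (Fin n → ℂ) →ₗ[ℝ] (Fin n → ℂ))).prodMap
        (s ^ 2 • (LinearMap.id : ℝ →ₗ[ℝ] ℝ)) := rfl
  rw [ContinuousLinearMap.det, e, LinearMap.det_prodMap, LinearMap.det_smul, LinearMap.det_smul]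
  simp [Module.finrank_pi_fintype, Complex.finrank_real_complex]
  ring

def rtL (m : Fin n → ℂ) : Heis n →L[ℝ] Heis n :=
  (ContinuousLinearMap.pi fun k => (ContinuousLinearMap.mul ℝ ℂ (m k)).comp
    (ContinuousLinearMap.proj (R := ℝ) (φ := fun _ : Fin n => ℂ) k)).prodMap (ContinuousLinearMap.id ℝ ℝ)

theorem rtL_apply (m : Fin n → ℂ) (p : Heis n) : rtL m p = rt m p := by
  simp [rtL, rt]; rfl

def cjL : Heis n →L[ℝ] Heis n :=
  (ContinuousLinearMap.pi fun k => (conjCLE : ℂ →L[ℝ] ℂ).comp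
    (ContinuousLinearMap.proj (R := ℝ) (φ := fun _ : Fin n => ℂ) k)).prodMap (ContinuousLinearMap.id ℝ ℝ)

theorem cjL_apply (p : Heis n) : cjL p = cj p := by
  simp [cjL, cj]; rfl

theorem det_compL (A B : Heis n →L[ℝ] Heis n) : (A.comp B).det = A.det * B.det := by
  simp only [ContinuousLinearMap.det]
  rw [← LinearMap.det_comp]; rfl

theorem det_rt_conj (m : Fin n → ℂ) : (rtL fun k => (starRingEnd ℂ) (m k)).det = (rtL m).det := by
  have h1 : (cjL : Heis n →L[ℝ] Heis n).comp cjL = ContinuousLinearMap.id ℝ _ := by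
    refine ContinuousLinearMap.ext fun p => ?_
    simp only [ContinuousLinearMap.comp_apply, cjL_apply, cj, ContinuousLinearMap.id_apply, conj_conj]
  have h2 : (rtL fun k => (starRingEnd ℂ) (m k)) = cjL.comp ((rtL m).comp cjL) := by
    refine ContinuousLinearMap.ext fun p => ?_
    simp only [ContinuousLinearMap.comp_apply, cjL_apply, rtL_apply, cj, rt, map_mul, conj_conj]
  have h3 : (cjL : Heis n →L[ℝ] Heis n).det * (cjL : Heis n →L[ℝ] Heis n).det = 1 := by
    rw [← det_compL, h1]; simp [ContinuousLinearMap.det]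
  rw [h2, det_compL, det_compL]
  linear_combination (rtL m).det * h3

theorem det_rt_ne (m : Fin n → ℂ) (hm : ∀ k, normSq (m k) = 1) : (rtL m).det ≠ 0 := by
  have h2 : (rtL fun k => (starRingEnd ℂ) (m k)).comp (rtL m) = ContinuousLinearMap.id ℝ _ := by
    refine ContinuousLinearMap.ext fun p => ?_
    simp only [ContinuousLinearMap.comp_apply, rtL_apply, rt, ← mul_assoc, ← normSq_eq_conj_mul_self, hm]
    simp
  have h3 : (rtL fun k => (starRingEnd ℂ) (m k)).det * (rtL m).det = 1 := by
    rw [← det_compL, h2]; simp [ContinuousLinearMap.det]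
  intro h; rw [h] at h3; simp at h3

theorem Iv_rt (m : Fin n → ℂ) (hm : ∀ k, normSq (m k) = 1) (p : Heis n) :
    Iv (rt m p) = rt (fun k => (starRingEnd ℂ) (m k)) (Iv p) := by
  simp only [Iv, inv0, norm_wC_rt m hm]
  simp only [rt, map_mul]
  congr 1
  funext k; ring

theorem hasFDerivAt_Iv {p : Heis n} (hp : p ≠ 0) : HasFDerivAt Iv (fderiv ℝ Iv p) p :=
  ((contDiffAt_inv0 (fun _ => 1) 1 hp (k := 1)).differentiableAt (by norm_num)).hasFDerivAt

theorem jac_comm (A B : Heis n →L[ℝ] Heis n) (h : ∀ q, Iv (A q) = B (Iv q)) {p : Heis n}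
    (hp : p ≠ 0) (hAp : A p ≠ 0) :
    (fderiv ℝ Iv (A p)).det * A.det = B.det * (fderiv ℝ Iv p).det := by
  rw [← det_compL, ← det_compL]
  congr 1
  have h1 := (hasFDerivAt_Iv hAp).comp p A.hasFDerivAt
  have h2 := B.hasFDerivAt.comp p (hasFDerivAt_Iv hp)
  have e : (Iv ∘ A : Heis n → Heis n) = B ∘ Iv := funext h
  rw [e] at h1
  exact h1.unique h2

theorem Iv_Iv {p : Heis n} (hp : p ≠ 0) : Iv (Iv p) = p :=
  inv0_inv0 _ (by simp) one_ne_zero hp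

theorem norm_Iv (p : Heis n) (hp : p ≠ 0) : ‖wC (Iv p)‖ = 1 / ‖wC p‖ := by
  rw [Iv, norm_wC_inv0 _ (by simp)]; norm_num

theorem Iv_ne {p : Heis n} (hp : p ≠ 0) : Iv p ≠ 0 := by
  intro h
  have h1 := norm_Iv p hp
  rw [h] at h1
  have := norm_wC_pos hp
  have h2 : wC (0 : Heis n) = 0 := by simp [wC, nsq]
  rw [h2, norm_zero] at h1
  have : 1 / ‖wC p‖ > 0 := by positivity
  linarith

theorem jac_one {p : Heis n} (hp : ‖wC p‖ = 1) : |(fderiv ℝ Iv p).det| = 1 := by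
  have hp0 : p ≠ 0 := by
    rintro rfl; simp [wC, nsq] at hp
  have h1 : (fderiv ℝ Iv (Iv p)).det * (fderiv ℝ Iv p).det = 1 := by
    rw [← det_compL]
    have h2 := (hasFDerivAt_Iv (Iv_ne hp0)).comp p (hasFDerivAt_Iv hp0)
    have h3 : HasFDerivAt (Iv ∘ Iv : Heis n → Heis n) (ContinuousLinearMap.id ℝ _) p := by
      refine (hasFDerivAt_id p).congr_of_eventuallyEq ?_
      filter_upwards [isOpen_ne.mem_nhds hp0] with q hq using Iv_Iv hq
    rw [h2.unique h3]; simp [ContinuousLinearMap.det]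
  classical
  set m : Fin n → ℂ := fun k => if p.1 k = 0 then 1 else
    -(starRingEnd ℂ) (p.1 k) * wC p / p.1 k with hm
  have hw : normSq (wC p) = 1 := by rw [normSq_eq_norm_sq, hp]; norm_num
  have hm1 : ∀ k, normSq (m k) = 1 := by
    intro k
    simp only [hm]
    split_ifs with h
    · simp
    · rw [normSq_div, normSq_mul, normSq_neg, normSq_conj, hw, mul_one]
      exact div_self (by simpa using h)
  have h4 : Iv p = rt m p := by
    have hwi : ((starRingEnd ℂ) (wC p))⁻¹ = wC p := by
      rw [inv_def, conj_conj, normSq_conj, hw]; simp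
    simp only [Iv, inv0, rt, hwi]
    ext1
    · funext k
      simp only [hm]
      split_ifs with h
      · simp [h]
      · field_simp
        simp
    · simp
  have h5 := jac_comm (rtL m) (rtL fun k => (starRingEnd ℂ) (m k))
    (fun q => by rw [rtL_apply, rtL_apply, Iv_rt m hm1]) hp0 (by rw [rtL_apply, ← h4]; exact Iv_ne hp0)
  rw [det_rt_conj, rtL_apply, ← h4, mul_comm] at h5
  have h6 := mul_left_cancel₀ (det_rt_ne m hm1) h5
  rw [h6] at h1
  have : (fderiv ℝ Iv p).det ^ 2 = 1 := by rw [sq]; exact h1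
  nlinarith [sq_abs (fderiv ℝ Iv p).det, abs_nonneg (fderiv ℝ Iv p).det]

theorem jac_Iv {p : Heis n} (hp : p ≠ 0) :
    |(fderiv ℝ Iv p).det| = (1 / ‖wC p‖) ^ (2 * n + 2) := by
  have hN := norm_wC_pos hp
  set N := ‖wC p‖
  set s := (Real.sqrt N)⁻¹ with hs
  have hs0 : 0 < s := by positivity
  have hs2 : s ^ 2 = 1 / N := by rw [hs, inv_pow, Real.sq_sqrt hN.le, one_div]
  have h1 : ‖wC (dil s p)‖ = 1 := by
    rw [norm_wC_dil, hs2]; exact one_div_mul_cancel hN.ne'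
  have h5 := jac_comm (dilL s) (dilL s⁻¹)
    (fun q => by rw [dilL_apply, dilL_apply]; exact inv0_dil _ _ hs0.ne' _) hp (by
      rw [dilL_apply]; intro h; rw [h] at h1; simp [wC, nsq] at h1)
  have h6 := congrArg abs h5
  rw [dilL_apply, abs_mul, abs_mul, jac_one h1, det_dilL, det_dilL, abs_of_pos (by positivity),
    abs_of_pos (by positivity)] at h6
  rw [← hs2, ← pow_mul]
  have h7 : s ^ (2 * n + 2) * s⁻¹ ^ (2 * n + 2) = 1 := by
    rw [← mul_pow, mul_inv_cancel₀ hs0.ne', one_pow]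
  have : s ^ (2 * (2 * n + 2)) = s ^ (2 * n + 2) * s ^ (2 * n + 2) := by rw [← pow_add]; congr 1; ring
  rw [this]
  linear_combination (-s ^ (2 * n + 2)) * h6 - |(fderiv ℝ Iv p).det| * h7

theorem Iv_image : (Iv : Heis n → Heis n) '' {0}ᶜ = {0}ᶜ := by
  ext p
  constructor
  · rintro ⟨q, hq, rfl⟩; exact Iv_ne hq
  · intro hp; exact ⟨Iv p, Iv_ne hp, Iv_Iv hp⟩

theorem Iv_inj : Set.InjOn (Iv : Heis n → Heis n) {0}ᶜ := by
  intro p hp q hq h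
  rw [← Iv_Iv hp, h, Iv_Iv hq]

theorem haar_Heis : (volume : Measure (Heis n)).IsAddHaarMeasure :=
  Measure.prod.instIsAddHaarMeasure _ _

theorem restrict_ne : (volume : Measure (Heis n)).restrict {0}ᶜ = volume := by
  refine Measure.restrict_eq_self_of_ae_mem ?_
  rw [ae_iff]
  have : {a : Heis n | ¬ a ∈ ({0}ᶜ : Set (Heis n))} = ({0} : Set (Fin n → ℂ)) ×ˢ ({0} : Set ℝ) := by
    ext p; simp [Prod.ext_iff]
  rw [this, Measure.volume_eq_prod, Measure.prod_prod]
  simp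

theorem lint_Iv (g : Heis n → ENNReal) :
    ∫⁻ p, g p = ∫⁻ p : Heis n, ENNReal.ofReal ((1 / ‖wC p‖) ^ (2 * n + 2)) * g (Iv p) := by
  haveI := haar_Heis (n := n)
  have h := lintegral_image_eq_lintegral_abs_det_fderiv_mul (volume : Measure (Heis n))
    (s := {0}ᶜ) (f := Iv) (f' := fderiv ℝ Iv) (measurableSet_singleton 0).compl
    (fun x hx => (hasFDerivAt_Iv hx).hasFDerivWithinAt) Iv_inj g
  rw [Iv_image] at h
  rw [setLIntegral_congr_fun (f := fun p : Heis n => ENNReal.ofReal |(fderiv ℝ Iv p).det| * g (Iv p)) (g := fun p : Heis n => ENNReal.ofReal ((1 / ‖wC p‖) ^ (2 * n + 2)) * g (Iv p))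
    (measurableSet_singleton 0).compl
    (fun x hx => by simp only [jac_Iv hx])] at h
  rwa [restrict_ne] at h

theorem int_Iv (g : Heis n → ℝ) :
    ∫ p, g p = ∫ p : Heis n, (1 / ‖wC p‖) ^ (2 * n + 2) * g (Iv p) := by
  haveI := haar_Heis (n := n)
  have h := integral_image_eq_integral_abs_det_fderiv_smul (volume : Measure (Heis n))
    (s := {0}ᶜ) (f := Iv) (f' := fderiv ℝ Iv) (measurableSet_singleton 0).compl
    (fun x hx => (hasFDerivAt_Iv hx).hasFDerivWithinAt) Iv_inj g
  rw [Iv_image] at h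
  rw [setIntegral_congr_fun (f := fun p : Heis n => |(fderiv ℝ Iv p).det| • g (Iv p)) (g := fun p : Heis n => (1 / ‖wC p‖) ^ (2 * n + 2) * g (Iv p))
    (measurableSet_singleton 0).compl
    (fun x hx => by simp only [jac_Iv hx, smul_eq_mul])] at h
  rwa [restrict_ne] at h

theorem Aker0 (ζ η : Heis n) : Aker 0 0 ζ η =
    -I * wC ζ + I * (starRingEnd ℂ) (wC η) - 2 * hermInner ζ.1 η.1 := by
  simp only [Aker, wC, map_add, map_mul, conj_ofReal, conj_I]
  simp
  ring_nf
  simp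

theorem herm_Iv (ζ η : Heis n) : hermInner (Iv ζ).1 (Iv η).1 =
    (starRingEnd ℂ) (hermInner ζ.1 η.1) * (((starRingEnd ℂ) (wC ζ))⁻¹ * (wC η)⁻¹) := by
  simp only [hermInner, Iv, inv0, map_sum, Finset.sum_mul]
  refine Finset.sum_congr rfl fun k _ => ?_
  simp only [map_mul, map_neg, map_inv₀, conj_conj, map_one, conj_ofReal]
  push_cast
  ring

theorem Aker_Iv {ζ η : Heis n} (hζ : ζ ≠ 0) (hη : η ≠ 0) : Aker 0 0 (Iv ζ) (Iv η) =
    (starRingEnd ℂ) (Aker 0 0 ζ η) * (((starRingEnd ℂ) (wC ζ))⁻¹ * (wC η)⁻¹) := by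
  have h1 := wC_ne hη
  have h2 : (starRingEnd ℂ) (wC ζ) ≠ 0 := by simpa using wC_ne hζ
  rw [Aker0, Aker0, herm_Iv, Iv, Iv, wC_inv0 _ (by simp), wC_inv0 _ (by simp)]
  simp only [map_sub, map_add, map_mul, map_neg, conj_I, conj_conj, map_inv₀, conj_ofReal, map_ofNat]
  field_simp
  push_cast
  ring

theorem Gam_Iv {ζ η : Heis n} (hζ : ζ ≠ 0) (hη : η ≠ 0) :
    Gam (Iv ζ) (Iv η) = ‖wC ζ‖ ^ n * ‖wC η‖ ^ n * Gam ζ η := by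
  rw [Gam_eq, Gam_eq, ← norm_Aker_zero 0, ← norm_Aker_zero 0, Aker_Iv hζ hη]
  simp only [norm_mul, norm_inv, RCLike.norm_conj]
  rw [← mul_pow, ← mul_pow]
  congr 1
  rw [one_div, mul_inv, mul_inv, inv_inv, inv_inv, one_div]
  ring

theorem lint_hmul (a : Heis n) (g : Heis n → ENNReal) : ∫⁻ p, g (hmul a p) = ∫⁻ p, g p := by
  have hc : Continuous (hmul a) := (contDiff_hmul a (k := 0)).continuous
  have hc' : Continuous (hmul (hinv a)) := (contDiff_hmul (hinv a) (k := 0)).continuous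
  let e : Heis n ≃ₜ Heis n := ⟨⟨hmul a, hmul (hinv a), fun p => hinv_hmul_cancel a p,
    fun p => hmul_hinv_cancel a p⟩, hc, hc'⟩
  exact (mp_hmul a).lintegral_comp_emb e.measurableEmbedding g

theorem int_hmul (a : Heis n) (g : Heis n → ℝ) : ∫ p, g (hmul a p) = ∫ p, g p := by
  have hc : Continuous (hmul a) := (contDiff_hmul a (k := 0)).continuous
  have hc' : Continuous (hmul (hinv a)) := (contDiff_hmul (hinv a) (k := 0)).continuous
  let e : Heis n ≃ₜ Heis n := ⟨⟨hmul a, hmul (hinv a), fun p => hinv_hmul_cancel a p,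
    fun p => hmul_hinv_cancel a p⟩, hc, hc'⟩
  exact (mp_hmul a).integral_comp e.measurableEmbedding g

theorem Gam_hmul (a ζ η : Heis n) : Gam (hmul a ζ) (hmul a η) = Gam ζ η := by
  unfold Gam
  congr 1
  have : hinv (hmul a η) = hmul (hinv η) (hinv a) := by
    have h := hermInner_conj a.1 η.1
    have h3 := congrArg Complex.im h
    simp only [conj_im] at h3
    refine Prod.ext ?_ ?_
    · simp only [hinv, hmul]; abel
    · simp only [hinv, hmul, hermInner_neg_left, hermInner_neg_right, neg_neg]
      linarith
  rw [this, hmul_assoc, hinv_hmul_cancel]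
end

section
variable {n : ℕ}

theorem dilL_img {s : ℝ} (hs : 0 < s) : (dilL s : Heis n → Heis n) '' Set.univ = Set.univ := by
  rw [Set.image_univ, Set.range_eq_univ]
  intro p
  refine ⟨dil s⁻¹ p, ?_⟩
  rw [dilL_apply, dil_dil, mul_inv_cancel₀ hs.ne', dil_one]

theorem dilL_inj {s : ℝ} (hs : 0 < s) : Set.InjOn (dilL s : Heis n → Heis n) Set.univ := by
  intro p _ q _ h
  rw [dilL_apply, dilL_apply] at h
  have := congrArg (dil s⁻¹) h
  rwa [dil_dil, dil_dil, inv_mul_cancel₀ hs.ne', dil_one, dil_one] at this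

theorem lint_dil {s : ℝ} (hs : 0 < s) (g : Heis n → ENNReal) :
    ∫⁻ p, g p = ENNReal.ofReal (s ^ (2 * n + 2)) * ∫⁻ p : Heis n, g (dil s p) := by
  have := haar_Heis (n := n)
  have h := lintegral_image_eq_lintegral_abs_det_fderiv_mul (volume : Measure (Heis n))
    (s := Set.univ) (f := dilL s) (f' := fun _ => dilL s) MeasurableSet.univ
    (fun x _ => (dilL s).hasFDerivAt.hasFDerivWithinAt) (dilL_inj hs) g
  rw [dilL_img hs] at h
  simp only [Measure.restrict_univ, det_dilL, dilL_apply] at h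
  rw [h, abs_of_pos (by positivity), lintegral_const_mul' _ _ ENNReal.ofReal_ne_top]

theorem int_dil {s : ℝ} (hs : 0 < s) (g : Heis n → ℝ) :
    ∫ p, g p = s ^ (2 * n + 2) * ∫ p : Heis n, g (dil s p) := by
  have := haar_Heis (n := n)
  have h := integral_image_eq_integral_abs_det_fderiv_smul (volume : Measure (Heis n))
    (s := Set.univ) (f := dilL s) (f' := fun _ => dilL s) MeasurableSet.univ
    (fun x _ => (dilL s).hasFDerivAt.hasFDerivWithinAt) (dilL_inj hs) g
  rw [dilL_img hs] at h
  simp only [Measure.restrict_univ, det_dilL, dilL_apply, smul_eq_mul] at h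
  rw [h, abs_of_pos (by positivity), integral_const_mul]

/-- Koranyi balls (in the variable `N = |w|`) -/
def NB (n : ℕ) (ρ : ℝ) : Set (Heis n) := {p | ‖wC p‖ < ρ}

theorem isOpen_NB (ρ : ℝ) : IsOpen (NB n ρ) := isOpen_lt continuous_N continuous_const
theorem meas_NB (ρ : ℝ) : MeasurableSet (NB n ρ) := (isOpen_NB ρ).measurableSet

theorem vol_NB_lt (ρ : ℝ) : volume (NB n ρ) < ⊤ := by
  have := haar_Heis (n := n)
  exact lt_of_le_of_lt (measure_mono (fun p (hp : ‖wC p‖ < ρ) => hp.le)) (isCompact_N ρ).measure_lt_top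

theorem vol_NB {s : ℝ} (hs : 0 < s) (ρ : ℝ) :
    volume (NB n (s ^ 2 * ρ)) = ENNReal.ofReal (s ^ (2 * n + 2)) * volume (NB n ρ) := by
  rw [← lintegral_indicator_one (meas_NB _), ← lintegral_indicator_one (meas_NB _), lint_dil hs]
  congr 1
  refine lintegral_congr fun p => ?_
  have : dil s p ∈ NB n (s ^ 2 * ρ) ↔ p ∈ NB n ρ := by
    simp only [NB, Set.mem_ofPred_eq, norm_wC_dil]
    exact mul_lt_mul_iff_right₀ (by positivity)
  by_cases h : p ∈ NB n ρ
  · rw [Set.indicator_of_mem h, Set.indicator_of_mem (this.2 h)]; rfl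
  · rw [Set.indicator_of_notMem h, Set.indicator_of_notMem (fun h' => h (this.1 h'))]

theorem M1_lt : ∫⁻ p in NB n 1, ENNReal.ofReal (Gm p) < ⊤ := by
  have hle : ∫⁻ p in NB n 1, ENNReal.ofReal (Gm p) ≤
      ∫⁻ p, ∑' k : ℕ, (NB n (((1/2:ℝ)^k)^2 * 1)).indicator (fun _ => ENNReal.ofReal (4 ^ (n*(k+1)))) p := by
    rw [← lintegral_indicator (meas_NB _)]
    refine lintegral_mono fun p => ?_
    by_cases hp : p ∈ NB n 1
    · rw [Set.indicator_of_mem hp]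
      have hex : ∃ k : ℕ, p ∈ NB n (((1/2:ℝ)^k)^2 * 1) ∧ Gm p ≤ 4 ^ (n*(k+1)) := by
        by_cases h0 : p = 0
        · refine ⟨0, by simpa using hp, ?_⟩
          have : wC (0 : Heis n) = 0 := by simp [wC, nsq]
          rw [h0, Gm_eq, this]
          simp only [norm_zero, div_zero]
          rcases Nat.eq_zero_or_pos n with h | h
          · subst h; simp
          · rw [zero_pow (by omega)]; positivity
        · have hN := norm_wC_pos h0
          have hN1 : ‖wC p‖ ≤ 1 := le_of_lt hp
          obtain ⟨k, hk1, hk2⟩ := exists_nat_pow_near_of_lt_one hN hN1 (y := 1/4) (by norm_num) (by norm_num)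
          rcases hk2.lt_or_eq with hk2 | hk2
          · refine ⟨k, ?_, ?_⟩
            · show ‖wC p‖ < _
              rw [← pow_mul, mul_comm k 2, pow_mul]; norm_num; norm_num at hk2; exact hk2
            · rw [Gm_eq, mul_comm, pow_mul]
              refine pow_le_pow_left₀ (by positivity) ?_ n
              rw [div_le_iff₀ hN]
              have : (4:ℝ)^(k+1) * (1/4)^(k+1) = 1 := by rw [← mul_pow]; norm_num
              rw [← this]
              exact mul_le_mul_of_nonneg_left hk1.le (by positivity)
          · cases k with
            | zero => exfalso; have : ‖wC p‖ < 1 := hp; rw [hk2] at this; simp at this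
            | succ k =>
              refine ⟨k, ?_, ?_⟩
              · show ‖wC p‖ < _
                rw [← pow_mul, mul_comm k 2, pow_mul, hk2, mul_one, pow_succ]
                norm_num
              · rw [Gm_eq, mul_comm, pow_mul, hk2]
                refine le_of_eq ?_
                congr 1
                rw [one_div, ← inv_pow]; norm_num
      obtain ⟨k, hk, hk'⟩ := hex
      refine le_trans ?_ (ENNReal.le_tsum k)
      rw [Set.indicator_of_mem hk]
      exact ENNReal.ofReal_le_ofReal hk'
    · rw [Set.indicator_of_notMem hp]; exact zero_le
  refine lt_of_le_of_lt hle ?_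
  rw [lintegral_tsum (fun k => (measurable_const.indicator (meas_NB _)).aemeasurable)]
  have : ∀ k : ℕ, ∫⁻ p, (NB n (((1/2:ℝ)^k)^2 * 1)).indicator (fun _ => ENNReal.ofReal (4 ^ (n*(k+1)))) p
      = ENNReal.ofReal (4 ^ n * (1/4) ^ k) * volume (NB n 1) := by
    intro k
    rw [lintegral_indicator (meas_NB _), setLIntegral_const, vol_NB (by positivity), ← mul_assoc,
      ← ENNReal.ofReal_mul (by positivity)]
    congr 2
    have e1 : (((1:ℝ)/2)^k)^(2*n+2) = (1/4)^(n*k) * (1/4)^k := by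
      rw [← pow_mul, ← pow_add]
      have : (1:ℝ)/4 = (1/2)^2 := by norm_num
      rw [this, ← pow_mul]; congr 1; ring
    have e2 : (4:ℝ)^(n*(k+1)) = 4^(n*k) * 4^n := by rw [← pow_add]; congr 1
    rw [e1, e2]
    have h2 : (4:ℝ)^(n*k) * (1/4)^(n*k) = 1 := by rw [← mul_pow]; norm_num
    linear_combination (4^n * (1/4)^k) * h2
  simp only [this]
  rw [ENNReal.tsum_mul_right]
  refine ENNReal.mul_lt_top ?_ (vol_NB_lt 1)
  have hs : Summable fun k : ℕ => (4:ℝ) ^ n * (1/4) ^ k :=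
    (summable_geometric_of_lt_one (by norm_num) (by norm_num)).mul_left _
  exact hs.tsum_ofReal_lt_top

theorem Gm_dil (s : ℝ) (p : Heis n) : Gm (dil s p) = (1 / s ^ 2) ^ n * Gm p := by
  rw [Gm_eq, Gm_eq, norm_wC_dil, ← mul_pow]
  congr 1
  rw [div_mul_div_comm, one_mul]

theorem Gm_nonneg (p : Heis n) : 0 ≤ Gm p := by rw [Gm_eq]; positivity

theorem measurable_Gm : Measurable (Gm : Heis n → ℝ) := by
  have : (Gm : Heis n → ℝ) = fun p => (1 / ‖wC p‖) ^ n := funext Gm_eq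
  rw [this]
  exact (measurable_const.div continuous_N.measurable).pow_const n

def M1 (n : ℕ) : ENNReal := ∫⁻ p in NB n 1, ENNReal.ofReal (Gm p)

theorem M_scale {ρ : ℝ} (hρ : 0 < ρ) :
    ∫⁻ p in NB n ρ, ENNReal.ofReal (Gm p) = ENNReal.ofReal ρ * M1 n := by
  set s := Real.sqrt ρ
  have hs : 0 < s := Real.sqrt_pos.2 hρ
  have hs2 : s ^ 2 = ρ := Real.sq_sqrt hρ.le
  rw [M1, ← lintegral_indicator (meas_NB _), ← lintegral_indicator (meas_NB _), lint_dil hs]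
  have : ∀ p, (NB n ρ).indicator (fun p => ENNReal.ofReal (Gm p)) (dil s p) =
      ENNReal.ofReal ((1 / s ^ 2) ^ n) * (NB n 1).indicator (fun p => ENNReal.ofReal (Gm p)) p := by
    intro p
    have hiff : dil s p ∈ NB n ρ ↔ p ∈ NB n 1 := by
      simp only [NB, Set.mem_ofPred_eq, norm_wC_dil, ← hs2]
      rw [← mul_lt_mul_iff_right₀ (show 0 < s ^ 2 by positivity) (c := 1), mul_one]
    by_cases h : p ∈ NB n 1
    · rw [Set.indicator_of_mem h, Set.indicator_of_mem (hiff.2 h), Gm_dil,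
        ENNReal.ofReal_mul (by positivity)]
    · rw [Set.indicator_of_notMem h, Set.indicator_of_notMem (fun h' => h (hiff.1 h')), mul_zero]
  simp only [this]
  rw [lintegral_const_mul' _ _ ENNReal.ofReal_ne_top, ← mul_assoc, ← ENNReal.ofReal_mul (by positivity)]
  congr 2
  rw [← hs2, pow_add, pow_mul, mul_assoc, mul_comm, mul_assoc, ← mul_pow]
  rw [one_div_mul_cancel (by positivity), one_pow, mul_one]

theorem Gam_symm (ζ η : Heis n) : Gam ζ η = Gm (hmul (hinv ζ) η) := by
  unfold Gam
  rw [Gm_eq, Gm_eq]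
  have : hmul (hinv η) ζ = hinv (hmul (hinv ζ) η) := by
    have h := hermInner_conj ζ.1 η.1
    have h3 := congrArg Complex.im h
    simp only [conj_im] at h3
    refine Prod.ext ?_ ?_
    · simp only [hinv, hmul]; abel
    · simp only [hinv, hmul, hermInner_neg_left]
      simp only [neg_im]; linarith
  rw [this, N_hinv]

theorem Gam_lint (ζ : Heis n) (S : Set (Heis n)) (hS : MeasurableSet S) {ρ : ℝ} (hρ : 0 < ρ) :
    ∫⁻ η in S, ENNReal.ofReal (Gam ζ η) ≤
      ENNReal.ofReal ρ * M1 n + ENNReal.ofReal ((1/ρ) ^ n) * volume S := by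
  rw [← lintegral_indicator hS, ← M_scale hρ, ← lintegral_indicator (meas_NB _)]
  rw [← lint_hmul (hinv ζ) ((NB n ρ).indicator _), ← lintegral_indicator_one hS,
    ← lintegral_const_mul' _ _ ENNReal.ofReal_ne_top, ← lintegral_add_right]
  · refine lintegral_mono fun η => ?_
    by_cases h : η ∈ S
    · rw [Set.indicator_of_mem h, Set.indicator_of_mem h, Pi.one_apply, mul_one]
      by_cases h' : hmul (hinv ζ) η ∈ NB n ρ
      · rw [Set.indicator_of_mem h', Gam_symm]; exact le_self_add
      · rw [Set.indicator_of_notMem h', zero_add, Gam_symm, Gm_eq]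
        refine ENNReal.ofReal_le_ofReal (pow_le_pow_left₀ (by positivity) ?_ n)
        have : ρ ≤ ‖wC (hmul (hinv ζ) η)‖ := not_lt.1 h'
        exact one_div_le_one_div_of_le hρ this
    · rw [Set.indicator_of_notMem h]; exact zero_le
  · exact (measurable_one.indicator hS).const_mul _

theorem lint_tail : ∫⁻ p in (NB n 1)ᶜ, ENNReal.ofReal ((1 / ‖wC p‖) ^ (n + 2)) < ⊤ := by
  rw [← lintegral_indicator (meas_NB _).compl, lint_Iv]
  have hle : ∀ p : Heis n, ENNReal.ofReal ((1 / ‖wC p‖) ^ (2 * n + 2)) *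
      (NB n 1)ᶜ.indicator (fun p => ENNReal.ofReal ((1 / ‖wC p‖) ^ (n + 2))) (Iv p) ≤
      (NB n 2).indicator (fun p => ENNReal.ofReal (Gm p)) p := by
    intro p
    by_cases h : Iv p ∈ (NB n 1)ᶜ
    · rw [Set.indicator_of_mem h]
      have h1 : 1 ≤ ‖wC (Iv p)‖ := not_lt.1 h
      by_cases hp : p = 0
      · exfalso
        rw [hp, Iv, norm_wC_inv0 _ (by simp)] at h1
        have : wC (0 : Heis n) = 0 := by simp [wC, nsq]
        rw [this] at h1; norm_num at h1
      have hN := norm_wC_pos hp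
      rw [norm_Iv p hp] at h1 ⊢
      have h2 : ‖wC p‖ ≤ 1 := by rwa [le_div_iff₀ hN, one_mul] at h1
      have h3 : p ∈ NB n 2 := show ‖wC p‖ < 2 by linarith
      rw [Set.indicator_of_mem h3, ← ENNReal.ofReal_mul (by positivity), Gm_eq]
      refine ENNReal.ofReal_le_ofReal (le_of_eq ?_)
      rw [one_div_one_div, show 2 * n + 2 = n + (n + 2) by ring, pow_add, mul_assoc, ← mul_pow,
        one_div_mul_cancel hN.ne', one_pow, mul_one]
    · rw [Set.indicator_of_notMem h, mul_zero]; exact zero_le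
  refine lt_of_le_of_lt (lintegral_mono hle) ?_
  rw [lintegral_indicator (meas_NB _), M_scale two_pos]
  exact ENNReal.mul_lt_top ENNReal.ofReal_lt_top M1_lt

/-- the bump `K` -/
def Kf (p : Heis n) : ℝ := (1 / ‖wC p + I‖) ^ (n + 2)

theorem norm_wC_I (p : Heis n) (ε : ℝ) (hε : 0 ≤ ε) : ‖wC p‖ ≤ ‖wC p + I * ε‖ ∧ ε ≤ ‖wC p + I * ε‖ := by
  have hx := nsq_nonneg p.1
  constructor
  · rw [← sq_le_sq₀ (norm_nonneg _) (norm_nonneg _), ← normSq_eq_norm_sq, ← normSq_eq_norm_sq,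
      normSq_apply, normSq_apply]
    simp
    nlinarith
  · have := abs_im_le_norm (wC p + I * ε)
    have h2 := le_abs_self (wC p + I * ε).im
    simp at this h2
    linarith

theorem continuous_Kf : Continuous (Kf : Heis n → ℝ) := by
  unfold Kf
  have h : Continuous fun p : Heis n => ‖wC p + I‖ :=
    ((contDiff_wC (k := 0)).continuous.add continuous_const).norm
  refine (continuous_const.div h fun p => ?_).pow _
  have := (norm_wC_I p 1 zero_le_one).2
  simp at this
  linarith

theorem integrable_Kf : Integrable (Kf : Heis n → ℝ) := by
  refine ⟨continuous_Kf.aestronglyMeasurable, ?_⟩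
  rw [hasFiniteIntegral_iff_enorm, ← lintegral_add_compl _ (meas_NB (n := n) 1)]
  have hb : ∀ p : Heis n, ‖Kf p‖ₑ ≤ 1 ∧ ‖Kf p‖ₑ ≤ ENNReal.ofReal ((1 / ‖wC p‖) ^ (n + 2)) ∨ p = 0 := by
    intro p
    by_cases hp : p = 0
    · exact Or.inr hp
    left
    have hN := norm_wC_pos hp
    have h := norm_wC_I p 1 zero_le_one
    simp only [ofReal_one, mul_one] at h
    have hk : 0 ≤ Kf p := by unfold Kf; positivity
    rw [Real.enorm_eq_ofReal hk]
    constructor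
    · rw [← ENNReal.ofReal_one]
      refine ENNReal.ofReal_le_ofReal (pow_le_one₀ (by positivity) ?_)
      rw [div_le_one (by linarith)]; exact h.2
    · exact ENNReal.ofReal_le_ofReal (pow_le_pow_left₀ (by positivity) (one_div_le_one_div_of_le hN h.1) _)
  refine ENNReal.add_lt_top.2 ⟨?_, ?_⟩
  · refine lt_of_le_of_lt (setLIntegral_mono measurable_const (g := fun _ => 1) fun p _ => ?_) ?_
    · rcases hb p with h | h
      · exact h.1
      · have hk : 0 ≤ Kf p := by unfold Kf; positivity
        have h0 : wC (0 : Heis n) = 0 := by simp [wC, nsq]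
        rw [h, Kf, h0]; simp
    · rw [setLIntegral_const, one_mul]; exact vol_NB_lt 1
  · refine lt_of_le_of_lt (setLIntegral_mono' (meas_NB 1).compl fun p hp => ?_) lint_tail
    rcases hb p with h | h
    · exact h.2
    · exfalso
      apply hp
      have h0 : wC (0 : Heis n) = 0 := by simp [wC, nsq]
      rw [h]; show ‖_‖ < _; rw [h0]; simp

theorem Kf_pos (p : Heis n) : 0 < Kf p := by
  have := (norm_wC_I p 1 zero_le_one).2
  simp only [ofReal_one, mul_one] at this
  unfold Kf
  have : 0 < ‖wC p + I‖ := by linarith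
  positivity

theorem int_Kf_pos : 0 < ∫ p : Heis n, Kf p := by
  have := haar_Heis (n := n)
  rw [integral_pos_iff_support_of_nonneg (fun p => (Kf_pos p).le) integrable_Kf]
  have : Function.support (Kf : Heis n → ℝ) = Set.univ := by
    ext p; simp [(Kf_pos p).ne']
  rw [this]
  exact isOpen_univ.measure_pos _ Set.univ_nonempty
end

section
variable {n : ℕ}

/-- affine vector fields -/
def fV (v0 : Heis n) (l : Heis n →L[ℝ] ℝ) (p : Heis n) : Heis n := v0 + l p • ((0, 1) : Heis n)

theorem contDiff_fV (v0 : Heis n) (l : Heis n →L[ℝ] ℝ) {k : WithTop ℕ∞} : ContDiff ℝ k (fV v0 l) :=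
  contDiff_const.add (l.contDiff.smul contDiff_const)

theorem int_field (v0 : Heis n) (l : Heis n →L[ℝ] ℝ) (hl : l (0, 1) = 0) {φ : Heis n → ℝ}
    (hφ : ContDiff ℝ 1 φ) (hc : HasCompactSupport φ) : ∫ p, fderiv ℝ φ p (fV v0 l p) = 0 := by
  have := haar_Heis (n := n)
  have hdc : ∀ v : Heis n, Continuous fun p => fderiv ℝ φ p v := fun v =>
    (hφ.continuous_fderiv (by norm_num)).clm_apply continuous_const
  have hds : ∀ v : Heis n, HasCompactSupport fun p => fderiv ℝ φ p v := fun v =>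
    (hc.fderiv ℝ).comp_left (g := fun L : Heis n →L[ℝ] ℝ => L v) (by simp)
  have hdi : ∀ v : Heis n, Integrable fun p => fderiv ℝ φ p v := fun v =>
    (hdc v).integrable_of_hasCompactSupport (hds v)
  have h2i : Integrable fun p => l p * fderiv ℝ φ p (0, 1) :=
    (l.continuous.mul (hdc _)).integrable_of_hasCompactSupport ((hds _).mul_left)
  have hφi : Integrable φ := hφ.continuous.integrable_of_hasCompactSupport hc
  have hlφ : Integrable fun p => l p * φ p :=
    (l.continuous.mul hφ.continuous).integrable_of_hasCompactSupport hc.mul_left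
  have e : ∀ p, fderiv ℝ φ p (fV v0 l p) = fderiv ℝ φ p v0 + l p * fderiv ℝ φ p (0, 1) := by
    intro p; rw [fV, map_add, map_smul, smul_eq_mul]
  simp only [e]
  rw [integral_add (hdi v0) h2i]
  have hd : Differentiable ℝ φ := hφ.differentiable (by norm_num)
  have h1 := integral_mul_fderiv_eq_neg_fderiv_mul_of_integrable (μ := (volume : Measure (Heis n)))
    (f := fun _ : Heis n => (1:ℝ)) (g := φ) (v := v0) (by simp) (by simpa using hdi v0) (by simpa using hφi)
    (fun x _ => by fun_prop) (fun x _ => hd x)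
  have h2 := integral_mul_fderiv_eq_neg_fderiv_mul_of_integrable (μ := (volume : Measure (Heis n)))
    (f := l) (g := φ) (v := ((0, 1) : Heis n)) (by simp [hl]) h2i hlφ
    (fun x _ => l.differentiableAt) (fun x _ => hd x)
  simp at h1
  simp [hl] at h2
  rw [h1, h2, add_zero]

theorem green_field (v0 : Heis n) (l : Heis n →L[ℝ] ℝ) (hl : l (0, 1) = 0) {g φ : Heis n → ℝ}
    (hg : ContDiff ℝ 2 g) (hφ : ContDiff ℝ 2 φ) (hc : HasCompactSupport g) :
    let V := fV v0 l
    ∫ p, (g p * fderiv ℝ (fun q => fderiv ℝ φ q (V q)) p (V p) -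
      φ p * fderiv ℝ (fun q => fderiv ℝ g q (V q)) p (V p)) = 0 := by
  intro V
  have hV : ContDiff ℝ 1 V := contDiff_fV v0 l
  have h1 : ContDiff ℝ 1 fun q => fderiv ℝ φ q (V q) := (hφ.fderiv_right (by norm_num)).clm_apply hV
  have h2 : ContDiff ℝ 1 fun q => fderiv ℝ g q (V q) := (hg.fderiv_right (by norm_num)).clm_apply hV
  have g1 : ContDiff ℝ 1 g := hg.of_le (by norm_num)
  have φ1 : ContDiff ℝ 1 φ := hφ.of_le (by norm_num)
  have hc2 : HasCompactSupport fun q => fderiv ℝ g q (V q) :=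
    (hc.fderiv ℝ).mono (fun q hq => by
      rw [Function.mem_support] at hq ⊢; intro h; rw [h] at hq; exact hq rfl)
  have hψ := int_field v0 l hl (φ := fun q => g q * fderiv ℝ φ q (V q) - φ q * fderiv ℝ g q (V q))
    ((g1.mul h1).sub (φ1.mul h2)) (hc.mul_right.sub hc2.mul_left)
  rw [← hψ]
  congr 1; funext p
  have a1 := (g1.differentiable (by norm_num) p).hasFDerivAt
  have a2 := (φ1.differentiable (by norm_num) p).hasFDerivAt
  have a3 := (h1.differentiable (by norm_num) p).hasFDerivAt
  have a4 := (h2.differentiable (by norm_num) p).hasFDerivAt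
  have a5 := ((a1.mul a3).sub (a2.mul a4)).fderiv
  erw [a5]
  simp only [ContinuousLinearMap.sub_apply, ContinuousLinearMap.add_apply, ContinuousLinearMap.smul_apply,
    smul_eq_mul]
  show _ = g p * _ + fderiv ℝ φ p (V p) * fderiv ℝ g p (V p) - (φ p * _ + fderiv ℝ g p (V p) * fderiv ℝ φ p (V p))
  ring

def lX (j : Fin n) : Heis n →L[ℝ] ℝ := (2:ℝ) • (imCLM.comp
  ((ContinuousLinearMap.proj (R := ℝ) (φ := fun _ : Fin n => ℂ) j).comp (ContinuousLinearMap.fst ℝ _ _)))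
def lY (j : Fin n) : Heis n →L[ℝ] ℝ := (-2:ℝ) • (reCLM.comp
  ((ContinuousLinearMap.proj (R := ℝ) (φ := fun _ : Fin n => ℂ) j).comp (ContinuousLinearMap.fst ℝ _ _)))

theorem XVec_fV (j : Fin n) : XVec j = fV (Pi.single j 1, 0) (lX j) := by
  funext p
  refine Prod.ext ?_ ?_ <;> simp [XVec, fV, lX]
theorem YVec_fV (j : Fin n) : YVec j = fV (Pi.single j I, 0) (lY j) := by
  funext p
  refine Prod.ext ?_ ?_ <;> simp [YVec, fV, lY]

theorem cont_field (V : Heis n → Heis n) (hV : ContDiff ℝ 1 V) {φ : Heis n → ℝ}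
    (hφ : ContDiff ℝ 2 φ) : Continuous fun p => fderiv ℝ (fun q => fderiv ℝ φ q (V q)) p (V p) := by
  have h1 : ContDiff ℝ 1 fun q => fderiv ℝ φ q (V q) := (hφ.fderiv_right (by norm_num)).clm_apply hV
  exact (h1.continuous_fderiv (by norm_num)).clm_apply hV.continuous

theorem supp_field (V : Heis n → Heis n) {g : Heis n → ℝ} (hc : HasCompactSupport g) :
    HasCompactSupport fun p => fderiv ℝ (fun q => fderiv ℝ g q (V q)) p (V p) := by
  have h : ∀ g : Heis n → ℝ, HasCompactSupport g → HasCompactSupport fun q => fderiv ℝ g q (V q) :=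
    fun g hc => (hc.fderiv ℝ).mono (fun q hq => by
      rw [Function.mem_support] at hq ⊢; intro h; rw [h] at hq; exact hq rfl)
  exact h _ (h _ hc)

theorem continuous_subLap {φ : Heis n → ℝ} (hφ : ContDiff ℝ 2 φ) : Continuous (subLap φ) := by
  unfold subLap
  refine continuous_finsetSum _ fun j _ => ?_
  refine Continuous.add ?_ ?_
  · exact cont_field (XVec j) (by rw [XVec_fV]; exact contDiff_fV _ _) hφ
  · exact cont_field (YVec j) (by rw [YVec_fV]; exact contDiff_fV _ _) hφ

theorem hcs_sum {ι : Type*} (s : Finset ι) (f : ι → Heis n → ℝ) (h : ∀ i ∈ s, HasCompactSupport (f i)) :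
    HasCompactSupport fun p => ∑ i ∈ s, f i p := by
  classical
  induction s using Finset.induction_on with
  | empty => simp; exact HasCompactSupport.zero
  | insert a s ha ih =>
    simp only [Finset.sum_insert ha]
    exact (h a (Finset.mem_insert_self _ _)).add (ih fun i hi => h i (Finset.mem_insert_of_mem hi))

theorem supp_subLap {g : Heis n → ℝ} (hc : HasCompactSupport g) : HasCompactSupport (subLap g) := by
  unfold subLap
  exact hcs_sum _ _ fun j _ => (supp_field (XVec j) hc).add (supp_field (YVec j) hc)

theorem green {g φ : Heis n → ℝ} (hg : ContDiff ℝ 2 g) (hφ : ContDiff ℝ 2 φ) (hc : HasCompactSupport g) :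
    ∫ p, g p * subLap φ p = ∫ p, φ p * subLap g p := by
  have := haar_Heis (n := n)
  rw [← sub_eq_zero, ← integral_sub]
  · have e : ∀ p, g p * subLap φ p - φ p * subLap g p = ∑ j,
        ((g p * Xop j (Xop j φ) p - φ p * Xop j (Xop j g) p) +
         (g p * Yop j (Yop j φ) p - φ p * Yop j (Yop j g) p)) := by
      intro p
      simp only [subLap, Finset.mul_sum, ← Finset.sum_sub_distrib]
      refine Finset.sum_congr rfl fun j _ => by ring
    have hi : ∀ V : Heis n → Heis n, ContDiff ℝ 1 V → Integrable fun p =>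
        (g p * fderiv ℝ (fun q => fderiv ℝ φ q (V q)) p (V p) -
          φ p * fderiv ℝ (fun q => fderiv ℝ g q (V q)) p (V p)) := by
      intro V hV
      exact ((hg.continuous.mul (cont_field V hV hφ)).sub
        (hφ.continuous.mul (cont_field V hV hg))).integrable_of_hasCompactSupport
        (hc.mul_right.sub (supp_field V hc).mul_left)
    have hX : ∀ j : Fin n, ContDiff ℝ 1 (XVec j) := fun j => by rw [XVec_fV]; exact contDiff_fV _ _
    have hY : ∀ j : Fin n, ContDiff ℝ 1 (YVec j) := fun j => by rw [YVec_fV]; exact contDiff_fV _ _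
    simp only [e]
    rw [integral_finsetSum]
    · refine Finset.sum_eq_zero fun j _ => ?_
      have h1 := hi _ (hX j)
      have h2 := hi _ (hY j)
      have i1 := green_field (Pi.single j 1, 0) (lX j) (by simp [lX]) hg hφ hc
      have i2 := green_field (Pi.single j I, 0) (lY j) (by simp [lY]) hg hφ hc
      rw [← XVec_fV] at i1
      rw [← YVec_fV] at i2
      have := integral_add h1 h2
      refine this.trans ?_
      simp only at i1 i2
      rw [i1, i2, add_zero]
    · intro j _
      exact (hi _ (hX j)).add (hi _ (hY j))
  · exact (hg.continuous.mul (continuous_subLap hφ)).integrable_of_hasCompactSupport hc.mul_right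
  · exact (hφ.continuous.mul (continuous_subLap hg)).integrable_of_hasCompactSupport
      (supp_subLap hc).mul_left

/-- regularised fundamental solution -/
def Ge (ε : ℝ) (p : Heis n) : ℝ := rho n 1 (normSq (wC p + I * ε))

theorem Ge_eq (ε : ℝ) (p : Heis n) : Ge ε p = (1 / ‖wC p + I * ε‖) ^ n := rho_eq _

theorem normSq_We_pos {ε : ℝ} (hε : 0 < ε) (p : Heis n) : 0 < normSq (wC p + I * ε) := by
  rw [normSq_eq_norm_sq]
  have := (norm_wC_I p ε hε.le).2
  have : 0 < ‖wC p + I * ε‖ := by linarith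
  positivity

theorem contDiff_Ge {ε : ℝ} (hε : 0 < ε) {k : WithTop ℕ∞} : ContDiff ℝ k (Ge ε : Heis n → ℝ) := by
  unfold Ge rho
  have h : ContDiff ℝ k (fun q : Heis n => normSq (wC q + I * ε)) := by
    simp only [normSq_apply, add_re, add_im, wC_re, wC_im]
    have := (contDiff_nsq (n := n) (k := k)).comp (contDiff_fst (E := Fin n → ℂ) (F := ℝ))
    exact ((contDiff_snd.add contDiff_const).mul (contDiff_snd.add contDiff_const)).add
      ((this.add contDiff_const).mul (this.add contDiff_const))
  exact contDiff_const.mul (h.rpow_const_of_ne fun p => (normSq_We_pos hε p).ne')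

theorem subLap_Ge {ε : ℝ} (hε : 0 < ε) (p : Heis n) :
    - subLap (Ge ε : Heis n → ℝ) p = 4 * n ^ 2 * (ε * (1 / ‖wC p + I * ε‖) ^ (n + 2)) := by
  set W := wC p + I * ε with hW
  have hWim : W.im = nsq p.1 + ε := by simp [hW]
  have hN : 0 < normSq W := normSq_We_pos hε p
  have hjet : ∀ (j : Fin n) (c : ℂ), J2 (fun s : ℝ => Ge ε (p + s • hv p j c)) (rho n 1 (normSq W))
      (-2 * n * rho n 1 (normSq W) / normSq W *
        ((starRingEnd ℂ) W * (I * ((starRingEnd ℂ) (p.1 j) * c))).re)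
      (4 * n * (n + 2) * rho n 1 (normSq W) / (normSq W)^2 *
        (((starRingEnd ℂ) W * (I * ((starRingEnd ℂ) (p.1 j) * c))).re)^2
        - n * rho n 1 (normSq W) / normSq W
          * (4 * normSq (p.1 j) + 2 * (nsq p.1 + ε)) * normSq c) := by
    intro j c
    have h0 : J2 (fun s : ℝ => wC (p + s • hv p j c) + I * ε) W (2 * I * ((starRingEnd ℂ) (p.1 j) * c))
      (2 * I * (normSq c : ℂ)) := by
      refine ((J2_wC p j c).add (J2.const (I * ε))).cast rfl ?_ ?_ <;> simp
    have h1 := rho_jet n 1 (J2_normSq h0) hN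
    have h2 : ((starRingEnd ℂ) W * (2 * I * ((starRingEnd ℂ) (p.1 j) * c))).re
      = 2 * ((starRingEnd ℂ) W * (I * ((starRingEnd ℂ) (p.1 j) * c))).re := by
      rw [← re_ofReal_mul]; congr 1; push_cast; ring
    refine h1.cast rfl ?_ ?_
    · rw [h2]; ring
    · rw [h2]
      have h3 : normSq (2 * I * ((starRingEnd ℂ) (p.1 j) * c)) = 4 * normSq (p.1 j) * normSq c := by
        simp [normSq_mul, normSq_ofNat]; ring
      have h4 : ((starRingEnd ℂ) W * (2 * I * ↑(normSq c))).re = 2 * (nsq p.1 + ε) * normSq c := by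
        rw [← hWim]; simp; ring
      rw [h3, h4]; ring
  rw [subLap_jets (contDiff_Ge hε).contDiffAt hjet]
  have hR : (1 / ‖W‖) ^ (n + 2) = rho n 1 (normSq W) / normSq W := by
    rw [rho_eq, normSq_eq_norm_sq, pow_add]; field_simp
  rw [hR]
  set R := rho n 1 (normSq W)
  have : ∀ j : Fin n, ((4 * n * (n + 2) * R / (normSq W)^2 *
        (((starRingEnd ℂ) W * (I * ((starRingEnd ℂ) (p.1 j) * 1))).re)^2
        - n * R / normSq W
          * (4 * normSq (p.1 j) + 2 * (nsq p.1 + ε)) * normSq 1) +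
        (4 * n * (n + 2) * R / (normSq W)^2 *
        (((starRingEnd ℂ) W * (I * ((starRingEnd ℂ) (p.1 j) * I))).re)^2
        - n * R / normSq W
          * (4 * normSq (p.1 j) + 2 * (nsq p.1 + ε)) * normSq I))
      = 4 * n * R / normSq W * (n * normSq (p.1 j) - (nsq p.1 + ε)) := by
    intro j
    have h := sq_pair ((starRingEnd ℂ) W * (I * (starRingEnd ℂ) (p.1 j)))
    have e1 : ∀ c : ℂ, (starRingEnd ℂ) W * (I * ((starRingEnd ℂ) (p.1 j) * c))
      = (starRingEnd ℂ) W * (I * (starRingEnd ℂ) (p.1 j)) * c := fun c => by ring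
    rw [e1, e1]
    have h5 : normSq ((starRingEnd ℂ) W * (I * (starRingEnd ℂ) (p.1 j)))
      = normSq W * normSq (p.1 j) := by simp [normSq_mul]
    rw [h5] at h
    simp only [normSq_one, normSq_I]
    generalize normSq W = N at *
    generalize ((starRingEnd ℂ) W * (I * (starRingEnd ℂ) (p.1 j)) * 1).re = x at *
    generalize ((starRingEnd ℂ) W * (I * (starRingEnd ℂ) (p.1 j)) * I).re = y at *
    have hy : y ^ 2 = N * normSq (p.1 j) - x ^ 2 := by linarith
    rw [hy]; field_simp; ring
  rw [Finset.sum_congr rfl fun j _ => this j, ← Finset.mul_sum, Finset.sum_sub_distrib,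
    ← Finset.mul_sum, sum_normSq]
  simp
  ring
end

section
variable {n : ℕ}

theorem Ge_dil {s : ℝ} (hs : 0 < s) (p : Heis n) :
    s ^ (2 * n + 2) * (s ^ 2 * (1 / ‖wC (dil s p) + I * ((s ^ 2 : ℝ) : ℂ)‖) ^ (n + 2)) = Kf p := by
  have e : wC (dil s p) + I * ((s ^ 2 : ℝ) : ℂ) = ((s ^ 2 : ℝ) : ℂ) * (wC p + I) := by
    rw [wC_dil]; push_cast; ring
  rw [e, norm_mul, Kf, norm_real, Real.norm_of_nonneg (by positivity), one_div, one_div, mul_inv, mul_pow]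
  have : s ≠ 0 := hs.ne'
  have h2 : s ^ (2 * n + 2) * s ^ 2 * ((s ^ 2)⁻¹) ^ (n + 2) = 1 := by
    rw [inv_pow, ← pow_mul, ← pow_add]
    have : 2 * n + 2 + 2 = 2 * (n + 2) := by ring
    rw [this]
    exact mul_inv_cancel₀ (by positivity)
  calc _ = (s ^ (2 * n + 2) * s ^ 2 * ((s ^ 2)⁻¹) ^ (n + 2)) * (‖wC p + I‖⁻¹) ^ (n + 2) := by ring
    _ = _ := by rw [h2, one_mul]

theorem intOn_Gm (ρ : ℝ) : IntegrableOn (Gm : Heis n → ℝ) (NB n ρ) := by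
  refine ⟨measurable_Gm.aestronglyMeasurable, ?_⟩
  rw [hasFiniteIntegral_iff_enorm]
  have : ∀ p : Heis n, ‖Gm p‖ₑ = ENNReal.ofReal (Gm p) := fun p => Real.enorm_of_nonneg (Gm_nonneg p)
  simp only [this]
  calc _ ≤ ∫⁻ p in NB n (max ρ 1), ENNReal.ofReal (Gm p) :=
        lintegral_mono_set (fun p (hp : ‖wC p‖ < ρ) => show ‖wC p‖ < max ρ 1 from lt_max_of_lt_left hp)
    _ = _ := M_scale (by positivity)
    _ < ⊤ := ENNReal.mul_lt_top ENNReal.ofReal_lt_top M1_lt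

theorem cs_NB {g : Heis n → ℝ} (hc : HasCompactSupport g) : ∃ ρ > 0, ∀ p, g p ≠ 0 → ‖wC p‖ < ρ := by
  obtain ⟨C, hC⟩ := hc.isCompact.exists_bound_of_continuousOn (f := fun p : Heis n => ‖wC p‖) continuous_N.continuousOn
  refine ⟨max C 0 + 1, by positivity, fun p hp => ?_⟩
  have := hC p (subset_tsupport _ hp)
  rw [norm_norm] at this
  have := le_max_left C 0
  linarith

theorem int_Gm_mul {H : Heis n → ℝ} (hH : Continuous H) (hc : HasCompactSupport H) :
    Integrable fun p => Gm p * |H p| := by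
  obtain ⟨ρ, hρ, h⟩ := cs_NB hc
  obtain ⟨C, hC⟩ := hc.exists_bound_of_continuous hH
  have hi := ((intOn_Gm (n := n) ρ).integrable_indicator (meas_NB ρ)).const_mul C
  refine hi.mono' (measurable_Gm.mul hH.abs.measurable).aestronglyMeasurable (ae_of_all _ fun p => ?_)
  rw [Real.norm_of_nonneg (mul_nonneg (Gm_nonneg p) (abs_nonneg _))]
  by_cases hp : H p = 0
  · rw [hp, abs_zero, mul_zero]
    exact mul_nonneg ((norm_nonneg _).trans (hC p)) (Set.indicator_nonneg (fun q _ => Gm_nonneg q) p)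
  · rw [Set.indicator_of_mem (show p ∈ NB n ρ from h p hp), mul_comm]
    exact mul_le_mul_of_nonneg_right (hC p) (Gm_nonneg p)

/-- normalising constant -/
def c0 (n : ℕ) : ℝ := 4 * n ^ 2 * ∫ p : Heis n, Kf p

theorem c0_pos (hn : 1 ≤ n) : 0 < c0 n := by
  have := int_Kf_pos (n := n)
  have : (0:ℝ) < n := by exact_mod_cast hn
  unfold c0; positivity

theorem rep0 (hn : 1 ≤ n) {g : Heis n → ℝ} (hg : ContDiff ℝ 2 g) (hc : HasCompactSupport g) :
    c0 n * g 0 = ∫ p, Gm p * (- subLap g p) := by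
  have hH := continuous_subLap hg
  have hHc := supp_subLap hc
  have e : ∀ s : ℝ, 0 < s → ∫ p, g (dil s p) * (4 * n ^ 2 * Kf p) = ∫ p, Ge (s^2) p * (- subLap g p) := by
    intro s hs
    have h := green hg (contDiff_Ge (n := n) (k := 2) (ε := s ^ 2) (by positivity)) hc
    have h2 : ∫ p, g p * (- subLap (Ge (s^2)) p) = ∫ p, Ge (s^2) p * (- subLap g p) := by
      simp only [mul_neg, integral_neg, h]
    rw [← h2, int_dil hs (fun p => g p * (- subLap (Ge (s^2)) p)), ← integral_const_mul]
    congr 1; funext p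
    rw [subLap_Ge (by positivity), ← Ge_dil hs p]
    ring
  have l1 : Tendsto (fun s : ℝ => ∫ p, g (dil s p) * (4 * n ^ 2 * Kf p)) (𝓝[>] 0) (𝓝 (∫ p : Heis n, g 0 * (4 * n ^ 2 * Kf p))) := by
    obtain ⟨C, hC⟩ := hc.exists_bound_of_continuous hg.continuous
    refine tendsto_integral_filter_of_dominated_convergence (fun p => C * (4 * n ^ 2 * Kf p)) ?_ ?_ ?_ ?_
    · refine Eventually.of_forall fun s => ?_
      exact ((hg.continuous.comp (contDiff_dil (k := 0) s).continuous).mul (continuous_const.mul continuous_Kf)).aestronglyMeasurable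
    · refine Eventually.of_forall fun s => ae_of_all _ fun p => ?_
      have := (Kf_pos p).le
      rw [norm_mul, Real.norm_of_nonneg (by positivity : 0 ≤ 4 * (n:ℝ) ^ 2 * Kf p)]
      exact mul_le_mul_of_nonneg_right (hC _) (by positivity)
    · exact (integrable_Kf.const_mul _).const_mul _
    · refine ae_of_all _ fun p => ?_
      refine Tendsto.mul_const _ ?_
      have hd : Continuous fun s : ℝ => dil s p := by
        unfold dil
        fun_prop
      have := (hg.continuous.comp hd).tendsto 0
      have h0 : dil 0 p = 0 := by
        refine Prod.ext ?_ ?_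
        · funext k; simp [dil]
        · simp [dil]
      simp only [Function.comp_apply, h0] at this
      exact this.mono_left nhdsWithin_le_nhds
  have l2 : Tendsto (fun s : ℝ => ∫ p, Ge (s^2) p * (- subLap g p)) (𝓝[>] 0) (𝓝 (∫ p : Heis n, Gm p * (- subLap g p))) := by
    have hne : ∀ᵐ p : Heis n, p ≠ 0 := by
      have := haar_Heis (n := n)
      have : Nonempty (Fin n) := ⟨⟨0, hn⟩⟩
      have : (volume : Measure (Heis n)) {0} = 0 := by
        simp
      exact compl_mem_ae_iff.2 this
    refine tendsto_integral_filter_of_dominated_convergence (fun p => Gm p * |subLap g p|) ?_ ?_ ?_ ?_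
    · filter_upwards [self_mem_nhdsWithin] with s hs
      exact ((contDiff_Ge (n := n) (k := 0) (ε := s ^ 2) (pow_pos hs 2)).continuous.mul hH.neg).aestronglyMeasurable
    · refine Eventually.of_forall fun s => ?_
      filter_upwards [hne] with p hp
      rw [norm_mul, norm_neg]
      refine mul_le_mul_of_nonneg_right ?_ (abs_nonneg _)
      rw [Ge_eq, Gm_eq, Real.norm_of_nonneg (by positivity)]
      have := norm_wC_pos hp
      gcongr
      exact (norm_wC_I p _ (sq_nonneg s)).1
    · exact int_Gm_mul hH hHc
    · filter_upwards [hne] with p hp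
      refine Tendsto.mul_const _ ?_
      have h1 : Tendsto (fun s : ℝ => (1 / ‖wC p + I * ((s ^ 2 : ℝ) : ℂ)‖) ^ n) (𝓝 0) (𝓝 ((1 / ‖wC p + I * (((0:ℝ) ^ 2 : ℝ) : ℂ)‖) ^ n)) := by
        refine ContinuousAt.tendsto (f := fun s : ℝ => (1 / ‖wC p + I * ((s ^ 2 : ℝ) : ℂ)‖) ^ n) ?_
        refine ContinuousAt.pow (ContinuousAt.div continuousAt_const ?_ ?_) _
        · fun_prop
        · simpa using wC_ne hp
      simp only [Ge_eq, Gm_eq]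
      have e0 : wC p + I * (((0:ℝ) ^ 2 : ℝ) : ℂ) = wC p := by simp
      rw [e0] at h1
      exact h1.mono_left nhdsWithin_le_nhds
  have l3 := l2.congr' (f₂ := fun s : ℝ => ∫ p, g (dil s p) * (4 * n ^ 2 * Kf p)) (by
    filter_upwards [self_mem_nhdsWithin] with s hs
    exact (e s hs).symm)
  rw [← tendsto_nhds_unique l1 l3, integral_const_mul, integral_const_mul, c0]
  ring

theorem rep (hn : 1 ≤ n) {g : Heis n → ℝ} (hg : ContDiff ℝ 2 g) (hc : HasCompactSupport g) (ζ : Heis n) :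
    c0 n * g ζ = ∫ η, Gam ζ η * (- subLap g η) := by
  have hcc : HasCompactSupport (fun p => g (hmul ζ p)) := by
    have hi : IsClosedEmbedding (hmul ζ : Heis n → Heis n) := by
      refine (Homeomorph.mk ⟨hmul ζ, hmul (hinv ζ), fun p => ?_, fun p => ?_⟩ ?_ ?_ : Heis n ≃ₜ Heis n).isClosedEmbedding
      · exact hinv_hmul_cancel ζ p
      · exact hmul_hinv_cancel ζ p
      · exact (contDiff_hmul (k := 0) ζ).continuous
      · exact (contDiff_hmul (k := 0) (hinv ζ)).continuous
    exact hc.comp_isClosedEmbedding hi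
  have h := rep0 hn (hg.comp (contDiff_hmul (k := 2) ζ)) hcc
  simp only [Function.comp_apply, hmul_zero] at h
  rw [h, ← int_hmul ζ (fun η => Gam ζ η * (- subLap g η))]
  congr 1; funext p
  rw [Gam_symm, hinv_hmul_cancel]
  congr 2
  exact subLap_hmul ζ p hg.contDiffAt
end

section
variable {n : ℕ}

theorem measurable_Iv : Measurable (Iv : Heis n → Heis n) := by
  have h : Measurable fun p : Heis n => ((starRingEnd ℂ) (wC p))⁻¹ :=
    (continuous_conj.comp (contDiff_wC (k := 0)).continuous).measurable.inv
  unfold Iv inv0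
  refine Measurable.prodMk (measurable_pi_lambda _ fun k => ?_) ?_
  · have h2 : Measurable fun p : Heis n => (starRingEnd ℂ) (p.1 k) :=
      (continuous_conj.comp ((continuous_apply k).comp continuous_fst)).measurable
    exact (h2.mul h).const_mul _
  · exact (measurable_re.comp h).const_mul _

theorem ae_ne : ∀ᵐ p : Heis n, p ≠ 0 := by
  have h := ae_restrict_mem (μ := (volume : Measure (Heis n))) (measurableSet_singleton (0 : Heis n)).compl
  rw [restrict_ne] at h
  exact h

def fT (a : Heis n) (h : Heis n → ℝ) (p : Heis n) : ℝ := (1 / ‖wC (hmul a p)‖) ^ n * h (Iv (hmul a p))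
def FT (a : Heis n) (H : Heis n → ℝ) (p : Heis n) : ℝ := (1 / ‖wC (hmul a p)‖) ^ (n + 2) * H (Iv (hmul a p))

theorem measurable_fT (a : Heis n) {h : Heis n → ℝ} (hh : Measurable h) : Measurable (fT a h) := by
  have hm := (contDiff_hmul a (k := 0)).continuous.measurable
  exact ((measurable_const.div (continuous_N.measurable.comp hm)).pow_const n).mul (hh.comp (measurable_Iv.comp hm))

theorem measurable_FT (a : Heis n) {h : Heis n → ℝ} (hh : Measurable h) : Measurable (FT a h) := by
  have hm := (contDiff_hmul a (k := 0)).continuous.measurable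
  exact ((measurable_const.div (continuous_N.measurable.comp hm)).pow_const _).mul (hh.comp (measurable_Iv.comp hm))

theorem key_id {ζ q : Heis n} (hζ : ζ ≠ 0) (hq : q ≠ 0) :
    (1 / ‖wC q‖) ^ (2 * n + 2) * (Gam ζ (Iv q) * (1 / ‖wC (Iv q)‖) ^ (n + 2)) =
      (1 / ‖wC ζ‖) ^ n * Gam (Iv ζ) q := by
  have h := Gam_Iv (Iv_ne hζ) hq
  rw [Iv_Iv hζ, norm_Iv ζ hζ] at h
  rw [h, norm_Iv q hq]
  have hN := (norm_wC_pos hq).ne'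
  simp only [one_div, inv_inv, inv_pow]
  field_simp
  ring

theorem rep_fT (hn : 1 ≤ n) {h : Heis n → ℝ} (hg : ContDiff ℝ 2 h) (hc : HasCompactSupport h)
    (a ζ : Heis n) (hζ : hmul a ζ ≠ 0) :
    c0 n * fT a h ζ = ∫ η, Gam ζ η * FT a (fun q => -subLap h q) η := by
  have e1 : ∀ η, Gam ζ η * FT a (fun q => -subLap h q) η =
      (fun η' => Gam (hmul a ζ) η' * ((1 / ‖wC η'‖) ^ (n + 2) * (-subLap h (Iv η')))) (hmul a η) := by
    intro η
    simp only [FT, Gam_hmul]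
  simp only [e1]
  rw [int_hmul a (fun η' => Gam (hmul a ζ) η' * ((1 / ‖wC η'‖) ^ (n + 2) * (-subLap h (Iv η')))), int_Iv]
  have e2 : ∫ p : Heis n, (1 / ‖wC p‖) ^ (2 * n + 2) * (Gam (hmul a ζ) (Iv p) *
      ((1 / ‖wC (Iv p)‖) ^ (n + 2) * (-subLap h (Iv (Iv p))))) =
      ∫ p : Heis n, (1 / ‖wC (hmul a ζ)‖) ^ n * (Gam (Iv (hmul a ζ)) p * (-subLap h p)) := by
    refine integral_congr_ae ?_
    filter_upwards [ae_ne] with p hp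
    rw [Iv_Iv hp]
    have := key_id hζ hp
    calc _ = ((1 / ‖wC p‖) ^ (2 * n + 2) * (Gam (hmul a ζ) (Iv p) * (1 / ‖wC (Iv p)‖) ^ (n + 2))) * (-subLap h p) := by ring
      _ = _ := by rw [this]; ring
  rw [e2, integral_const_mul, ← rep hn hg hc, fT]
  ring

theorem lint_FT {H : Heis n → ℝ} {B : ℝ} (hB0 : 0 ≤ B) {K : Set (Heis n)} (hK : MeasurableSet K)
    (hB : ∀ q, |H q| ≤ B) (hHK : ∀ q, q ∉ K → H q = 0) (a ζ : Heis n) (hζ : hmul a ζ ≠ 0)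
    (S : Set (Heis n)) (hS : MeasurableSet S) {ρ : ℝ} (hρ : 0 < ρ) :
    ∫⁻ η in S, ENNReal.ofReal (Gam ζ η * |FT a H η|) ≤ ENNReal.ofReal ((1 / ‖wC (hmul a ζ)‖) ^ n * B) *
      (ENNReal.ofReal ρ * M1 n + ENNReal.ofReal ((1/ρ) ^ n) *
        volume (K ∩ {q | hmul (hinv a) (Iv q) ∈ S})) := by
  have hm := (contDiff_hmul (hinv a) (k := 0)).continuous.measurable
  set S' : Set (Heis n) := {q | hmul (hinv a) (Iv q) ∈ S} with hS'
  have hS'm : MeasurableSet S' := (hm.comp measurable_Iv) hS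
  rw [← lintegral_indicator hS]
  set g : Heis n → ENNReal := fun η' => S.indicator (fun _ => ENNReal.ofReal
    (Gam (hmul a ζ) η' * ((1 / ‖wC η'‖) ^ (n + 2) * |H (Iv η')|))) (hmul (hinv a) η') with hg
  have e1 : ∀ η, S.indicator (fun η => ENNReal.ofReal (Gam ζ η * |FT a H η|)) η = g (hmul a η) := by
    intro η
    simp only [hg, hinv_hmul_cancel, FT, Gam_hmul]
    by_cases h : η ∈ S
    · rw [Set.indicator_of_mem h, Set.indicator_of_mem h]
      rw [abs_mul, abs_of_nonneg (by positivity : 0 ≤ (1 / ‖wC (hmul a η)‖) ^ (n + 2))]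
    · rw [Set.indicator_of_notMem h, Set.indicator_of_notMem h]
  simp only [e1]
  rw [lint_hmul, lint_Iv]
  calc _ ≤ ∫⁻ q : Heis n, ENNReal.ofReal ((1 / ‖wC (hmul a ζ)‖) ^ n * B) *
          (K ∩ S').indicator (fun q => ENNReal.ofReal (Gam (Iv (hmul a ζ)) q)) q := by
        refine lintegral_mono_ae ?_
        filter_upwards [ae_ne] with q hq
        simp only [hg]
        by_cases hqS : hmul (hinv a) (Iv q) ∈ S
        · rw [Set.indicator_of_mem hqS, Iv_Iv hq]
          by_cases hqK : q ∈ K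
          · rw [Set.indicator_of_mem (show q ∈ K ∩ S' from ⟨hqK, hqS⟩),
              ← ENNReal.ofReal_mul (by positivity), ← ENNReal.ofReal_mul (by positivity)]
            refine ENNReal.ofReal_le_ofReal ?_
            have := key_id hζ hq
            have hG := Gam_nonneg (Iv (hmul a ζ)) q
            calc _ = ((1 / ‖wC q‖) ^ (2 * n + 2) * (Gam (hmul a ζ) (Iv q) * (1 / ‖wC (Iv q)‖) ^ (n + 2))) * |H q| := by ring
              _ = ((1 / ‖wC (hmul a ζ)‖) ^ n * Gam (Iv (hmul a ζ)) q) * |H q| := by rw [this]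
              _ ≤ ((1 / ‖wC (hmul a ζ)‖) ^ n * Gam (Iv (hmul a ζ)) q) * B :=
                mul_le_mul_of_nonneg_left (hB q) (by positivity)
              _ = _ := by ring
          · rw [hHK q hqK]; simp
        · rw [Set.indicator_of_notMem hqS]; simp
    _ = ENNReal.ofReal ((1 / ‖wC (hmul a ζ)‖) ^ n * B) *
          ∫⁻ q in K ∩ S', ENNReal.ofReal (Gam (Iv (hmul a ζ)) q) := by
        rw [lintegral_const_mul' _ _ ENNReal.ofReal_ne_top, lintegral_indicator (hK.inter hS'm)]
    _ ≤ _ := by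
        gcongr
        exact Gam_lint _ _ (hK.inter hS'm) hρ

def Er (n : ℕ) (r : ℝ) : Set (Heis n) := {p | nsq p.1 < r}
theorem meas_Er (r : ℝ) : MeasurableSet (Er n r) :=
  (isOpen_lt (continuous_nsq.comp continuous_fst) continuous_const).measurableSet

theorem vol_E_tendsto (hn : 1 ≤ n) (a : Heis n) {K : Set (Heis n)} (hK : MeasurableSet K) (hKf : volume K < ⊤) :
    Tendsto (fun k : ℕ => volume (K ∩ {q | hmul (hinv a) (Iv q) ∈ Er n (1 / ((k:ℝ) + 1))})) atTop (𝓝 0) := by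
  have hm := (contDiff_hmul (hinv a) (k := 0)).continuous.measurable
  have hanti : Antitone fun k : ℕ => K ∩ {q | hmul (hinv a) (Iv q) ∈ Er n (1 / ((k:ℝ) + 1))} := by
    intro k l hkl q hq
    have h2 : nsq (hmul (hinv a) (Iv q)).1 < 1 / ((l:ℝ) + 1) := hq.2
    have h3 : nsq (hmul (hinv a) (Iv q)).1 < 1 / ((k:ℝ) + 1) := lt_of_lt_of_le h2 (Nat.one_div_le_one_div hkl)
    exact ⟨hq.1, h3⟩
  have h := tendsto_measure_iInter_atTop (μ := (volume : Measure (Heis n))) (s := fun k : ℕ => K ∩ {q | hmul (hinv a) (Iv q) ∈ Er n (1 / ((k:ℝ) + 1))})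
    (fun k => (hK.inter ((hm.comp measurable_Iv) (meas_Er _))).nullMeasurableSet) hanti
    ⟨0, (lt_of_le_of_lt (measure_mono Set.inter_subset_left) hKf).ne⟩
  have hz : volume (⋂ k : ℕ, K ∩ {q | hmul (hinv a) (Iv q) ∈ Er n (1 / ((k:ℝ) + 1))}) = 0 := by
    refine measure_mono_null (t := {q : Heis n | (Iv q).1 = a.1}) ?_ ?_
    · intro q hq
      rw [Set.mem_iInter] at hq
      have h0 : nsq (hmul (hinv a) (Iv q)).1 = 0 := by
        refine le_antisymm ?_ (nsq_nonneg _)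
        exact ge_of_tendsto' tendsto_one_div_add_atTop_nhds_zero_nat (fun k => (hq k).2.le)
      have h1 := nsq_eq_zero.1 h0
      simp only [hmul, hinv] at h1
      show (Iv q).1 = a.1
      rw [neg_add_eq_zero] at h1
      exact h1.symm
    · have hms : MeasurableSet {q : Heis n | (Iv q).1 = a.1} :=
        (measurable_fst.comp measurable_Iv) (measurableSet_singleton a.1)
      rw [← lintegral_indicator_one hms, lint_Iv]
      have : Nonempty (Fin n) := ⟨⟨0, hn⟩⟩
      have hnull : (volume : Measure (Heis n)) {q | q.1 = a.1} = 0 := by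
        have e : {q : Heis n | q.1 = a.1} = ({a.1} : Set (Fin n → ℂ)) ×ˢ (Set.univ : Set ℝ) := by
          ext q; simp
        rw [e, Measure.volume_eq_prod, Measure.prod_prod]
        simp
      have hae : ∀ᵐ q : Heis n, q.1 ≠ a.1 := by
        rw [ae_iff]; simpa using hnull
      rw [lintegral_eq_zero_iff']
      · filter_upwards [hae, ae_ne] with q hq hq0
        rw [Set.indicator_of_notMem]
        · simp
        · show ¬ (Iv (Iv q)).1 = a.1
          rwa [Iv_Iv hq0]
      · refine (Measurable.mul ?_ ?_).aemeasurable
        · exact ((measurable_const.div continuous_N.measurable).pow_const _).ennreal_ofReal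
        · exact (measurable_one.indicator hms).comp measurable_Iv
  rwa [hz] at h
end

section
variable {n : ℕ}

theorem nsq_half (z0 z : Fin n → ℂ) (h : nsq z ≤ nsq z0 / 4) : nsq z0 / 4 ≤ nsq (z0 + z) := by
  have h1 : nsq z0 ≤ 2 * nsq (z0 + z) + 2 * nsq z := by
    simp only [nsq, Finset.mul_sum, ← Finset.sum_add_distrib]
    refine Finset.sum_le_sum fun k _ => ?_
    simp only [normSq_apply, Pi.add_apply, add_re, add_im]
    nlinarith [sq_nonneg ((z0 k).re + 2 * (z k).re), sq_nonneg ((z0 k).im + 2 * (z k).im)]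
  linarith

theorem tw_mem {r τ : ℝ} {p : Heis n} (hp : p ∈ Er n r) : tw r τ p ∈ Er n r := by
  show nsq (tw r τ p).1 < r
  rw [nsq_tw]; exact hp

theorem tw_off {r τ : ℝ} {p : Heis n} (hp : p ∉ Er n r) : tw r τ p = p := by
  have h : ¬ nsq p.1 < r := hp
  have h0 : aT r (nsq p.1) = 0 := max_eq_left (by linarith)
  have h1 : bT r (nsq p.1) = 0 := by rw [bT, h0]; ring
  simp [tw, h0, h1]

theorem bT_abs {r x : ℝ} (hr : 0 ≤ r) (hr1 : r ≤ 1) (hx : 0 ≤ x) : |bT r x| ≤ 1 := by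
  have h0 : 0 ≤ aT r x := le_max_left _ _
  have h1 : aT r x ≤ r := max_le hr (by linarith)
  unfold bT
  rw [abs_le]; constructor <;> nlinarith

theorem N_tw {r τ : ℝ} (hr : 0 ≤ r) (hr1 : r ≤ 1) (hτ : |τ| ≤ 1) (p : Heis n) :
    ‖wC p‖ ≤ ‖wC (tw r τ p)‖ + 1 := by
  have h : wC p = wC (tw r τ p) - ((τ * bT r (nsq p.1) : ℝ) : ℂ) := by
    apply Complex.ext
    · simp [tw]
    · rw [sub_im, wC_im, wC_im, nsq_tw]; simp
  rw [h]
  refine (norm_sub_le _ _).trans ?_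
  have hb := bT_abs hr hr1 (nsq_nonneg p.1)
  rw [norm_real, Real.norm_eq_abs, abs_mul]
  nlinarith [abs_nonneg τ, abs_nonneg (bT r (nsq p.1))]

theorem N_ratio (a : Heis n) (ha : 0 < nsq a.1) {r τ : ℝ} (hr : 0 ≤ r) (hr1 : r ≤ 1) (hτ : |τ| ≤ 1)
    (hra : r ≤ nsq a.1 / 4) {p : Heis n} (hp : p ∈ Er n r) :
    ‖wC (hmul a p)‖ ≤ ((6 * ‖wC a‖ + 2) / (nsq a.1 / 4) + 4) * ‖wC (hmul a (tw r τ p))‖ := by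
  have h1 := N_hmul a p
  have h2 := N_tw hr hr1 hτ p
  have h3 := N_hmul (hinv a) (hmul a (tw r τ p))
  rw [hinv_hmul_cancel, N_hinv] at h3
  have h4 : nsq (tw r τ p).1 < r := tw_mem hp
  have h5 := nsq_half a.1 (tw r τ p).1 (by linarith)
  have h6 : nsq a.1 / 4 ≤ ‖wC (hmul a (tw r τ p))‖ := h5.trans (nsq_le_N (hmul a (tw r τ p)))
  set M := ‖wC (hmul a (tw r τ p))‖
  have h7 : 6 * ‖wC a‖ + 2 ≤ (6 * ‖wC a‖ + 2) / (nsq a.1 / 4) * M := by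
    rw [div_mul_eq_mul_div, le_div_iff₀ (by linarith)]
    exact mul_le_mul_of_nonneg_left h6 (by positivity)
  nlinarith

theorem cutoff {v : Heis n → ℝ} (hv : ContDiff ℝ (⊤ : ℕ∞) v) (R : ℝ) (hR : 0 ≤ R) : ∃ h : Heis n → ℝ,
    ContDiff ℝ 2 h ∧ HasCompactSupport h ∧ ∀ q, ‖wC q‖ ≤ R → h q = v q ∧ subLap h q = subLap v q := by
  have hN : ContDiff ℝ 2 fun q : Heis n => normSq (wC q) := by
    simp only [normSq_apply, wC_re, wC_im]
    have := (contDiff_nsq (n := n) (k := 2)).comp (contDiff_fst (E := Fin n → ℂ) (F := ℝ))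
    simp only [Function.comp_def] at this
    exact (contDiff_snd.mul contDiff_snd).add (this.mul this)
  have hv2 : ContDiff ℝ 2 v := contDiff_infty.1 hv 2
  have hχ : ContDiff ℝ 2 fun q : Heis n => Real.smoothTransition (R ^ 2 + 2 - normSq (wC q)) :=
    Real.smoothTransition.contDiff.comp (contDiff_const.sub hN)
  refine ⟨fun q => Real.smoothTransition (R ^ 2 + 2 - normSq (wC q)) * v q, hχ.mul hv2, ?_, ?_⟩
  · refine HasCompactSupport.intro (isCompact_N (n := n) (R + 2)) fun q hq => ?_
    have h : ¬ ‖wC q‖ ≤ R + 2 := hq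
    push Not at h
    rw [Real.smoothTransition.zero_of_nonpos, zero_mul]
    rw [normSq_eq_norm_sq]; nlinarith
  · intro q hq
    have hev : (fun q => Real.smoothTransition (R ^ 2 + 2 - normSq (wC q)) * v q) =ᶠ[𝓝 q] v := by
      have h1 : ∀ᶠ q' in 𝓝 q, normSq (wC q') < R ^ 2 + 1 := by
        refine hN.continuous.continuousAt.eventually_lt continuousAt_const ?_
        rw [normSq_eq_norm_sq]; nlinarith [norm_nonneg (wC q)]
      filter_upwards [h1] with q' hq'
      rw [Real.smoothTransition.one_of_one_le (by linarith), one_mul]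
    exact ⟨hev.self_of_nhds, subLap_congr hev⟩

theorem cpow_lip (e : ℝ) : ∃ L : ℝ, 0 ≤ L ∧ (∀ w ∈ Metric.closedBall (1:ℂ) (1/4), DifferentiableAt ℂ (fun w => w ^ (e:ℂ)) w) ∧
    ∀ a ∈ Metric.closedBall (1:ℂ) (1/4), ∀ b ∈ Metric.closedBall (1:ℂ) (1/4),
      ‖a ^ (e:ℂ) - b ^ (e:ℂ)‖ ≤ L * ‖a - b‖ := by
  have hs : ∀ w ∈ Metric.closedBall (1:ℂ) (1/4), w ∈ slitPlane := by
    intro w hw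
    left
    rw [mem_closedBall_iff_norm] at hw
    have := (abs_re_le_norm (w - 1)).trans hw
    rw [sub_re, one_re, abs_le] at this
    linarith
  have hd : ∀ w ∈ Metric.closedBall (1:ℂ) (1/4), HasDerivAt (fun w : ℂ => w ^ (e:ℂ)) (e * w ^ ((e:ℂ) - 1)) w := by
    intro w hw
    have := (hasDerivAt_id w).cpow_const (c := (e:ℂ)) (hs w hw)
    simpa using this
  obtain ⟨L, hL⟩ := (isCompact_closedBall (1:ℂ) (1/4)).exists_bound_of_continuousOn
    (f := fun w : ℂ => (e:ℂ) * w ^ ((e:ℂ) - 1)) (by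
      intro w hw
      exact (continuousAt_const.mul (continuousAt_id.cpow continuousAt_const (hs w hw))).continuousWithinAt)
  refine ⟨max L 0, le_max_right _ _, fun w hw => (hd w hw).differentiableAt, fun a ha b hb => ?_⟩
  exact (convex_closedBall (1:ℂ) (1/4)).norm_image_sub_le_of_norm_hasDerivWithin_le
    (fun w hw => (hd w hw).hasDerivWithinAt) (fun w hw => (hL w hw).trans (le_max_left _ _)) hb ha

/-- the twisted solution satisfies the fixed point equation -/
theorem tw_eqn (hn : 1 ≤ n) {r τ : ℝ} (hr : 0 ≤ r) (hr1 : r ≤ 1) (hτ : |τ| ≤ 1) {e : ℝ}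
    {f F : Heis n → ℝ} (hF : Measurable F) (hf : ∀ p ∈ Er n r, 0 < f p) (hFf : ∀ p ∈ Er n r, F p = f p ^ e)
    (hrep : ∀ ζ ∈ Er n r, c0 n * f ζ = ∫ η, Gam ζ η * F η) (ζ : Heis n) (hζ : ζ ∈ Er n r) :
    ((f (tw r τ ζ) / f ζ : ℝ) : ℂ) = picT volume (Er n r) (fun ζ η => Gam ζ η * F η / (c0 n * f ζ)) (Qk r τ)
      (fun w => w ^ (e:ℂ)) (fun η => ((f (tw r τ η) / f η : ℝ) : ℂ)) ζ := by
  classical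
  have hc := c0_pos hn
  have hfζ := hf ζ hζ
  have e1 : ∀ η, ((Gam ζ η * F η / (c0 n * f ζ) : ℝ) : ℂ) * (Qk r τ ζ η *
      (Er n r).piecewise (fun η => ((f (tw r τ η) / f η : ℝ) : ℂ) ^ (e:ℂ)) (fun _ => 1) η) =
      ((Gam (tw r τ ζ) (tw r τ η) * F (tw r τ η) / (c0 n * f ζ) : ℝ) : ℂ) := by
    intro η
    have hQ := Qk_real hn hr hr1 hτ ζ η (le_of_lt hζ)
    by_cases hη : η ∈ Er n r
    · rw [Set.piecewise_eq_of_mem _ _ _ hη]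
      have h1 := hf η hη
      have h2 := hf _ (tw_mem (τ := τ) hη)
      rw [← ofReal_cpow (by positivity), hFf η hη, hFf _ (tw_mem hη), Real.div_rpow h2.le h1.le]
      have h3 : f η ^ e ≠ 0 := (Real.rpow_pos_of_pos h1 e).ne'
      have h4 : f η ^ e * (f (tw r τ η) ^ e / f η ^ e) = f (tw r τ η) ^ e := by field_simp
      push_cast
      rw [← hQ]
      have h4' := congrArg (fun x : ℝ => (x:ℂ)) h4
      push_cast at h4'
      rw [show ∀ A B D Qq X Y : ℂ, A * B / D * (Qq * (X / Y)) = A * Qq * (B * (X / Y)) / D by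
        intros; ring, h4']
    · rw [Set.piecewise_eq_of_notMem _ _ _ hη]
      push_cast
      rw [← hQ, tw_off hη]
      ring
  unfold picT
  simp only [e1]
  rw [integral_complex_ofReal]
  congr 1
  rw [integral_div]
  have hmp := mp_tw (n := n) r τ
  have h5 : ∫ η, Gam (tw r τ ζ) (tw r τ η) * F (tw r τ η) = ∫ η, Gam (tw r τ ζ) η * F η := by
    have hm : Measurable fun η => Gam (tw r τ ζ) η * F η :=
      (measurable_Gam.comp measurable_prodMk_left).mul hF
    have := integral_map (μ := (volume : Measure (Heis n))) hmp.measurable.aemeasurable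
      (f := fun η => Gam (tw r τ ζ) η * F η) hm.aestronglyMeasurable
    rw [hmp.map_eq] at this
    exact this.symm
  rw [h5, ← hrep _ (tw_mem hζ)]
  field_simp

open Classical in
/-- crude bound implies fine bound -/
theorem pic_bound {X : Type*} [MeasurableSpace X] (μ : Measure X) (E : Set X) (hE : MeasurableSet E)
    (H0 : X → X → ℝ) (Q : X → X → ℂ) (φ : ℂ → ℂ) (Y : X → ℂ) (C ε κ K : ℝ) (ζ : X)
    (hInteg : Integrable (H0 ζ) μ) (hC : ∫ η, |H0 ζ η| ∂μ ≤ C) (hε : ∫ η in E, |H0 ζ η| ∂μ ≤ ε)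
    (h1 : ∫ η, H0 ζ η ∂μ = 1) (hQ1 : ∀ η, ‖Q ζ η - 1‖ ≤ κ) (hκ0 : 0 ≤ κ) (hK : 1 ≤ K)
    (hφ : ∀ η ∈ E, ‖φ (Y η)‖ ≤ K - 1) (hm : AEStronglyMeasurable (fun η => (H0 ζ η : ℂ) *
      (Q ζ η * E.piecewise (fun η => φ (Y η)) (fun _ => 1) η)) μ) :
    ‖picT μ E H0 Q φ Y ζ - 1‖ ≤ κ * K * C + ε * K := by
  set Z : X → ℂ := E.piecewise (fun η => φ (Y η)) (fun _ => 1) with hZ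
  have hZ1 : ∀ η, ‖Z η‖ ≤ K ∧ ‖Z η - 1‖ ≤ E.indicator (fun _ => K) η := by
    intro η
    by_cases h : η ∈ E
    · rw [hZ, Set.piecewise_eq_of_mem _ _ _ h, Set.indicator_of_mem h]
      have := hφ η h
      refine ⟨by linarith, (norm_sub_le _ _).trans ?_⟩
      rw [norm_one]; linarith
    · rw [hZ, Set.piecewise_eq_of_notMem _ _ _ h, Set.indicator_of_notMem h]; simpa using hK
  have hb : ∀ η, ‖Q ζ η * Z η - 1‖ ≤ κ * K + E.indicator (fun _ => K) η := by
    intro η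
    have : Q ζ η * Z η - 1 = (Q ζ η - 1) * Z η + (Z η - 1) := by ring
    rw [this]
    refine (norm_add_le _ _).trans (add_le_add ?_ (hZ1 η).2)
    rw [norm_mul]
    exact mul_le_mul (hQ1 η) (hZ1 η).1 (norm_nonneg _) hκ0
  have hi : Integrable (fun η => κ * K * |H0 ζ η| + E.indicator (fun η => K * |H0 ζ η|) η) μ :=
    (hInteg.abs.const_mul _).add ((hInteg.abs.const_mul K).indicator hE)
  have hb2 : ∀ η, ‖(H0 ζ η : ℂ) * (Q ζ η * Z η) - H0 ζ η‖ ≤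
      κ * K * |H0 ζ η| + E.indicator (fun η => K * |H0 ζ η|) η := by
    intro η
    have : (H0 ζ η : ℂ) * (Q ζ η * Z η) - H0 ζ η = (H0 ζ η : ℂ) * (Q ζ η * Z η - 1) := by ring
    rw [this, norm_mul, norm_real, Real.norm_eq_abs]
    refine (mul_le_mul_of_nonneg_left (hb η) (abs_nonneg _)).trans (le_of_eq ?_)
    by_cases h : η ∈ E
    · rw [Set.indicator_of_mem h, Set.indicator_of_mem h]; ring
    · rw [Set.indicator_of_notMem h, Set.indicator_of_notMem h]; ring
  have hintC : Integrable (fun η => (H0 ζ η : ℂ)) μ := hInteg.ofReal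
  have hd : Integrable (fun η => (H0 ζ η : ℂ) * (Q ζ η * Z η) - H0 ζ η) μ :=
    hi.mono' (hm.sub hintC.aestronglyMeasurable) (ae_of_all _ hb2)
  have hp : Integrable (fun η => (H0 ζ η : ℂ) * (Q ζ η * Z η)) μ := by
    have := hd.add hintC
    refine this.congr (ae_of_all _ fun η => ?_)
    simp
  have h1C : ∫ η, (H0 ζ η : ℂ) ∂μ = 1 := by rw [integral_complex_ofReal, h1]; simp
  have : picT μ E H0 Q φ Y ζ - 1 = ∫ η, ((H0 ζ η : ℂ) * (Q ζ η * Z η) - H0 ζ η) ∂μ := by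
    rw [integral_sub hp hintC, h1C]; rfl
  rw [this]
  refine (norm_integral_le_of_norm_le hi (ae_of_all _ hb2)).trans ?_
  rw [integral_add (hInteg.abs.const_mul _) ((hInteg.abs.const_mul K).indicator hE), integral_const_mul,
    integral_indicator hE, integral_const_mul]
  have : 0 ≤ κ * K := by positivity
  nlinarith
end

section
variable {n : ℕ}

theorem small_k (hn : 1 ≤ n) (a : Heis n) (A : ℝ) {K : Set (Heis n)} (hK : MeasurableSet K)
    (hKf : volume K < ⊤) {c : ℝ} (hc : 0 < c) {ε : ℝ} (hε : 0 < ε) :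
    ∃ ρ > 0, ∃ k : ℕ, 1 / ((k:ℝ) + 1) ≤ c ∧ ENNReal.ofReal A * (ENNReal.ofReal ρ * M1 n +
      ENNReal.ofReal ((1/ρ) ^ n) * volume (K ∩ {q | hmul (hinv a) (Iv q) ∈ Er n (1 / ((k:ℝ) + 1))})) ≤
      ENNReal.ofReal ε := by
  have hM : M1 n ≠ ⊤ := M1_lt.ne
  have t1 : Tendsto (fun ρ : ℝ => ENNReal.ofReal A * (ENNReal.ofReal ρ * M1 n)) (𝓝[>] 0) (𝓝 0) := by
    have h : Tendsto (fun ρ : ℝ => ENNReal.ofReal ρ) (𝓝[>] 0) (𝓝 0) := by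
      have := (ENNReal.continuous_ofReal.tendsto 0).mono_left (nhdsWithin_le_nhds (s := Set.Ioi (0:ℝ)))
      simpa using this
    have h2 := ENNReal.Tendsto.mul_const (b := M1 n) h (Or.inr hM)
    have h3 := ENNReal.Tendsto.const_mul (a := ENNReal.ofReal A) h2 (Or.inr ENNReal.ofReal_ne_top)
    simpa using h3
  have hε2 : (0 : ENNReal) < ENNReal.ofReal (ε / 2) := ENNReal.ofReal_pos.2 (by positivity)
  obtain ⟨ρ, hρ1, hρ⟩ := ((t1.eventually_le_const hε2).and self_mem_nhdsWithin).exists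
  have t2 := ENNReal.Tendsto.const_mul (a := ENNReal.ofReal ((1/ρ) ^ n)) (vol_E_tendsto hn a hK hKf) (Or.inr ENNReal.ofReal_ne_top)
  have t3 := ENNReal.Tendsto.const_mul (a := ENNReal.ofReal A) t2 (Or.inr ENNReal.ofReal_ne_top)
  simp only [mul_zero] at t3
  obtain ⟨k, hk1, hk2⟩ := ((t3.eventually_le_const hε2).and
    (tendsto_one_div_add_atTop_nhds_zero_nat.eventually_le_const hc)).exists
  refine ⟨ρ, hρ, k, hk2, ?_⟩
  rw [mul_add, ← add_halves ε, ENNReal.ofReal_add (by positivity) (by positivity)]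
  exact add_le_add hρ1 hk1

theorem rpow_id (hn : 1 ≤ n) {e : ℝ} (he : n * e = n + 2) {x y : ℝ} (hx : 0 ≤ x) (hy : 0 ≤ y) :
    (x ^ n * y) ^ e = x ^ (n + 2) * y ^ e := by
  rw [Real.mul_rpow (by positivity) hy, ← Real.rpow_natCast, ← Real.rpow_mul hx, he,
    ← Real.rpow_natCast x (n + 2)]
  push_cast; rfl

theorem line_CE (a : Heis n) {c A : ℝ} {H0 : Heis n → Heis n → ℝ} {K : Set (Heis n)} (hKf : volume K < ⊤)
    (hlint : ∀ ζ : Heis n, nsq ζ.1 ≤ c → ∀ S : Set (Heis n), MeasurableSet S → ∀ ρ : ℝ, 0 < ρ →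
      ∫⁻ η in S, ENNReal.ofReal |H0 ζ η| ≤ ENNReal.ofReal A * (ENNReal.ofReal ρ * M1 n +
        ENNReal.ofReal ((1/ρ) ^ n) * volume (K ∩ {q | hmul (hinv a) (Iv q) ∈ S}))) :
    ∃ CE : ENNReal, CE < ⊤ ∧ ∀ ζ : Heis n, nsq ζ.1 ≤ c → ∫⁻ η, ENNReal.ofReal |H0 ζ η| ≤ CE := by
  refine ⟨ENNReal.ofReal A * (ENNReal.ofReal 1 * M1 n + ENNReal.ofReal ((1/1) ^ n) * volume K), ?_, ?_⟩
  · refine ENNReal.mul_lt_top ENNReal.ofReal_lt_top (ENNReal.add_lt_top.2 ⟨?_, ?_⟩)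
    · exact ENNReal.mul_lt_top ENNReal.ofReal_lt_top M1_lt
    · exact ENNReal.mul_lt_top ENNReal.ofReal_lt_top hKf
  · intro ζ hζ
    have h := hlint ζ hζ Set.univ MeasurableSet.univ 1 one_pos
    rw [Measure.restrict_univ] at h
    have hle : volume (K ∩ {q | hmul (hinv a) (Iv q) ∈ (Set.univ : Set (Heis n))}) ≤ volume K :=
      measure_mono Set.inter_subset_left
    refine le_trans h ?_
    exact mul_le_mul' le_rfl (add_le_add le_rfl (mul_le_mul' le_rfl hle))

set_option maxHeartbeats 2000000 in
theorem line_main (hn : 1 ≤ n) {e : ℝ} (he0 : 0 < e) (a : Heis n) (ha : 0 < nsq a.1) {c : ℝ}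
    (hcdef : c = nsq a.1 / 4) (hc : 0 < c) {f F : Heis n → ℝ} (hfm : Measurable f) (hFm : Measurable F)
    {m M : ℝ} (hm : 0 < m) (hM : 0 < M)
    (gpos : ∀ p : Heis n, nsq p.1 ≤ c → 0 < ‖wC (hmul a p)‖)
    (flow : ∀ p : Heis n, nsq p.1 ≤ c → (1 / ‖wC (hmul a p)‖) ^ n * m ≤ f p ∧ f p ≤ (1 / ‖wC (hmul a p)‖) ^ n * M)
    (fpos : ∀ p : Heis n, nsq p.1 ≤ c → 0 < f p) (hFf : ∀ p : Heis n, nsq p.1 ≤ c → F p = f p ^ e)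
    (hrep : ∀ ζ : Heis n, nsq ζ.1 ≤ c → c0 n * f ζ = ∫ η, Gam ζ η * F η)
    {H0 : Heis n → Heis n → ℝ} (hH0 : H0 = fun ζ η => Gam ζ η * F η / (c0 n * f ζ))
    (hH0m : Measurable (Function.uncurry H0)) {A : ℝ} {K : Set (Heis n)} (hK : MeasurableSet K) (hKf : volume K < ⊤)
    (hlint : ∀ ζ : Heis n, nsq ζ.1 ≤ c → ∀ S : Set (Heis n), MeasurableSet S → ∀ ρ : ℝ, 0 < ρ →
      ∫⁻ η in S, ENNReal.ofReal |H0 ζ η| ≤ ENNReal.ofReal A * (ENNReal.ofReal ρ * M1 n +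
        ENNReal.ofReal ((1/ρ) ^ n) * volume (K ∩ {q | hmul (hinv a) (Iv q) ∈ S}))) :
    AnalyticAt ℝ (fun t : ℝ => f (0, t)) 0 := by
  classical
  have hc0 := c0_pos hn
  obtain ⟨CE, hCEt, hlC⟩ := line_CE a hKf hlint
  have hmζ : ∀ ζ, Measurable (H0 ζ) := fun ζ => hH0m.comp measurable_prodMk_left
  have hInteg : ∀ ζ : Heis n, nsq ζ.1 ≤ c → Integrable (H0 ζ) := by
    intro ζ hζ
    refine ⟨(hmζ ζ).aestronglyMeasurable, ?_⟩
    rw [hasFiniteIntegral_iff_enorm]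
    have : ∀ η, ‖H0 ζ η‖ₑ = ENNReal.ofReal |H0 ζ η| := fun η => by
      rw [← Real.norm_eq_abs, ofReal_norm_eq_enorm]
    simp only [this]
    exact lt_of_le_of_lt (hlC ζ hζ) hCEt
  have hint_le : ∀ ζ : Heis n, ∀ S : Set (Heis n), ∀ x : ENNReal, x ≠ ⊤ →
      ∫⁻ η in S, ENNReal.ofReal |H0 ζ η| ≤ x → ∫ η in S, |H0 ζ η| ≤ x.toReal := by
    intro ζ S x hx hle
    rw [integral_eq_lintegral_of_nonneg_ae (ae_of_all _ fun η => abs_nonneg _) (hmζ ζ).abs.aestronglyMeasurable]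
    exact ENNReal.toReal_mono hx hle
  set C := CE.toReal with hC
  have hC0 : 0 ≤ C := ENNReal.toReal_nonneg
  have hCb : ∀ ζ : Heis n, nsq ζ.1 ≤ c → ∫ η, |H0 ζ η| ≤ C := by
    intro ζ hζ
    have := hint_le ζ Set.univ CE hCEt.ne (by rw [Measure.restrict_univ]; exact hlC ζ hζ)
    rwa [Measure.restrict_univ] at this
  have h1 : ∀ ζ : Heis n, nsq ζ.1 ≤ c → ∫ η, H0 ζ η = 1 := by
    intro ζ hζ
    have := fpos ζ hζ
    simp only [hH0]
    rw [integral_div, ← hrep ζ hζ, div_self (by positivity)]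
  -- constants
  obtain ⟨L, hL0, hφd, hφL⟩ := cpow_lip e
  set Kr := (6 * ‖wC a‖ + 2) / (nsq a.1 / 4) + 4 with hKr
  have hKr0 : 0 < Kr := by positivity
  set K1 := Kr ^ n * M / m with hK1
  have hK10 : 0 < K1 := by positivity
  set K2 := K1 ^ e + 1 with hK2
  have hK21 : 1 ≤ K2 := by have := Real.rpow_nonneg hK10.le e; linarith
  set ε := min (1 / (4 * (L + 1))) (1 / (8 * K2)) with hε
  have hε0 : 0 < ε := by positivity
  have ε1 : ε * (L + 1) ≤ 1 / 4 := by
    have : ε ≤ 1 / (4 * (L + 1)) := min_le_left _ _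
    rw [le_div_iff₀ (by positivity)] at this
    linarith
  have ε2 : ε * K2 ≤ 1 / 8 := by
    have : ε ≤ 1 / (8 * K2) := min_le_right _ _
    rw [le_div_iff₀ (by positivity)] at this
    linarith
  obtain ⟨ρ, hρ, k, hk, hkε⟩ := small_k hn a A hK hKf hc hε0
  set r := 1 / ((k:ℝ) + 1) with hr
  have hr0 : 0 < r := by positivity
  have hr1 : r ≤ 1 := by
    rw [hr, div_le_one (by positivity)]
    have : (0:ℝ) ≤ k := by positivity
    linarith
  set E := Er n r with hE
  have hEm : MeasurableSet E := meas_Er r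
  have Ec : ∀ ζ ∈ E, nsq ζ.1 ≤ c := fun ζ hζ => (le_of_lt hζ).trans hk
  have hεb : ∀ ζ ∈ E, ∫ η in E, |H0 ζ η| ≤ ε := by
    intro ζ hζ
    have := hint_le ζ E _ ENNReal.ofReal_ne_top ((hlint ζ (Ec ζ hζ) E hEm ρ hρ).trans hkε)
    rwa [ENNReal.toReal_ofReal hε0.le] at this
  obtain ⟨δ0, hδ0, hδ01, CQ, hCQ, hQ⟩ := Qk_props n
  set D := (1 + L / 4) * C + K2 * C + 1 with hD
  have hD1 : 1 ≤ D := by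
    have : 0 ≤ (1 + L / 4) * C + K2 * C := by positivity
    linarith
  set κ := 1 / (8 * D) with hκ
  have hκ0 : 0 < κ := by positivity
  have hκD : κ * D = 1 / 8 := by rw [hκ]; field_simp
  have hκ1 : κ ≤ 1 := by nlinarith
  have κ1 : κ * (1 + L/4) * C ≤ 1 / 8 := by
    have : 0 ≤ κ * (K2 * C) := by positivity
    nlinarith
  have κ2 : κ * K2 * C ≤ 1 / 8 := by
    have : 0 ≤ κ * ((1 + L/4) * C) := by positivity
    nlinarith
  set δ := min δ0 (κ / (CQ + 1)) with hδ
  have hδp : 0 < δ := by positivity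
  have hδle : δ ≤ δ0 := min_le_left _ _
  have hQ1 : ∀ ζ ∈ E, ∀ η, ∀ τ ∈ Metric.ball (0:ℂ) δ, ‖Qk r τ ζ η - 1‖ ≤ κ := by
    intro ζ hζ η τ hτ
    refine ((hQ r hr0.le hr1 ζ (le_of_lt hζ) η).2 τ (Metric.ball_subset_ball hδle hτ)).trans ?_
    rw [mem_ball_zero_iff] at hτ
    have h2 : δ ≤ κ / (CQ + 1) := min_le_right _ _
    rw [le_div_iff₀ (by positivity)] at h2
    nlinarith [norm_nonneg τ]
  have hφm : Measurable fun w : ℂ => w ^ (e:ℂ) := measurable_id.pow_const _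
  have zero_mem : (0 : Heis n) ∈ E := by
    show nsq (0 : Fin n → ℂ) < r
    simpa [nsq] using hr0
  obtain ⟨g, hgd, hg⟩ := picard (volume : Measure (Heis n)) E hEm H0 hH0m (Qk r) (measurable_Qk r) δ C ε L κ
    (fun ζ hζ => hInteg ζ (Ec ζ hζ)) (fun ζ hζ => hCb ζ (Ec ζ hζ)) hεb (fun ζ hζ => h1 ζ (Ec ζ hζ))
    (fun ζ hζ η => (hQ r hr0.le hr1 ζ (le_of_lt hζ) η).1.mono (Metric.ball_subset_ball hδle))
    hQ1 hκ1 hκ0.le (fun w => w ^ (e:ℂ)) hφm hφd hL0 hφL (by simp) (by nlinarith) (by nlinarith) 0 zero_mem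
  -- real parameters
  have hreal : ∀ τ : ℝ, |τ| < δ → ((f (tw r τ 0) / f 0 : ℝ) : ℂ) = g τ := by
    intro τ hτ
    have hτ1 : |τ| ≤ 1 := by linarith
    have hτb : (τ:ℂ) ∈ Metric.ball (0:ℂ) δ := by
      rw [mem_ball_zero_iff, norm_real]; exact hτ
    set y : Heis n → ℂ := fun η => ((f (tw r τ η) / f η : ℝ) : ℂ) with hy
    have hym : Measurable y :=
      measurable_ofReal.comp ((hfm.comp (mp_tw r τ).measurable).div hfm)
    have heqn : ∀ ζ ∈ E, y ζ = picT volume E H0 (Qk r τ) (fun w => w ^ (e:ℂ)) y ζ := by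
      intro ζ hζ
      rw [hH0]
      exact tw_eqn hn hr0.le hr1 hτ1 hFm (fun p hp => fpos p (Ec p hp)) (fun p hp => hFf p (Ec p hp))
        (fun p hp => hrep p (Ec p hp)) ζ hζ
    have hyb : ∀ η ∈ E, ‖(y η) ^ (e:ℂ)‖ ≤ K2 - 1 := by
      intro η hη
      have hη' := tw_mem (τ := τ) hη
      have q1 := fpos η (Ec η hη)
      have q2 := fpos _ (Ec _ hη')
      have g1 := gpos η (Ec η hη)
      have g2 := gpos _ (Ec _ hη')
      rw [hy]
      simp only
      rw [← ofReal_cpow (by positivity), norm_real, Real.norm_of_nonneg (by positivity), hK2, add_sub_cancel_right]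
      refine Real.rpow_le_rpow (by positivity) ?_ he0.le
      rw [div_le_iff₀ q1]
      have hN := N_ratio a ha hr0.le hr1 hτ1 (hcdef ▸ hk) hη
      rw [← hKr] at hN
      refine (flow _ (Ec _ hη')).2.trans ?_
      have hb : (1 / ‖wC (hmul a (tw r τ η))‖) ^ n ≤ Kr ^ n * (1 / ‖wC (hmul a η)‖) ^ n := by
        rw [← mul_pow]
        gcongr
        rw [mul_one_div, div_le_div_iff₀ g2 g1]
        linarith
      calc _ ≤ Kr ^ n * (1 / ‖wC (hmul a η)‖) ^ n * M := mul_le_mul_of_nonneg_right hb hM.le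
        _ = K1 * ((1 / ‖wC (hmul a η)‖) ^ n * m) := by rw [hK1]; field_simp
        _ ≤ K1 * f η := mul_le_mul_of_nonneg_left (flow η (Ec η hη)).1 hK10.le
    have hy14 : ∀ ζ ∈ E, y ζ ∈ Metric.closedBall (1:ℂ) (1/4) := by
      intro ζ hζ
      rw [mem_closedBall_iff_norm, heqn ζ hζ]
      refine (pic_bound volume E hEm H0 (Qk r τ) (fun w => w ^ (e:ℂ)) y C ε κ K2 ζ (hInteg ζ (Ec ζ hζ))
        (hCb ζ (Ec ζ hζ)) (hεb ζ hζ) (h1 ζ (Ec ζ hζ)) (fun η => hQ1 ζ hζ η τ hτb) hκ0.le hK21 hyb ?_).trans (by linarith)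
      refine Measurable.aestronglyMeasurable ?_
      refine (measurable_ofReal.comp (hmζ ζ)).mul (((measurable_Qk r τ).comp measurable_prodMk_left).mul ?_)
      exact Measurable.piecewise hEm (hφm.comp hym) measurable_const
    exact hg τ hτb y hym hy14 heqn
  have hg0 : AnalyticAt ℝ g 0 :=
    (hgd.analyticAt (Metric.ball_mem_nhds _ hδp)).restrictScalars
  have hlin : AnalyticAt ℝ (fun t : ℝ => ((-t / r ^ 2 : ℝ) : ℂ)) 0 := by
    have h1 : AnalyticAt ℝ (fun t : ℝ => -t / r ^ 2) 0 := analyticAt_id.neg.div analyticAt_const (by positivity)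
    exact (ofRealCLM.analyticAt _).comp h1
  have hcomp2 : AnalyticAt ℝ (fun t : ℝ => f 0 * (g ((-t / r ^ 2 : ℝ) : ℂ)).re) 0 := by
    refine analyticAt_const.mul ?_
    have h2 : AnalyticAt ℝ (fun t : ℝ => g ((-t / r ^ 2 : ℝ) : ℂ)) 0 :=
      AnalyticAt.fun_comp (g := g) (by simpa using hg0) hlin
    exact (reCLM.analyticAt _).comp h2
  refine hcomp2.congr ?_
  have hev : ∀ᶠ t : ℝ in 𝓝 0, |-t / r ^ 2| < δ := by
    have hct : ContinuousAt (fun t : ℝ => |-t / r ^ 2|) 0 := by fun_prop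
    exact hct.eventually_lt continuousAt_const (by simpa using hδp)
  filter_upwards [hev] with t ht
  rw [← hreal _ ht, ofReal_re]
  have e0 : tw r (-t / r ^ 2) (0 : Heis n) = (0, t) := by
    have hz : nsq (0 : Fin n → ℂ) = 0 := by simp [nsq]
    have h3 : bT r 0 = - r ^ 2 := by
      rw [bT, aT, sub_zero, max_eq_right hr0.le]; ring
    refine Prod.ext ?_ ?_
    · funext j; simp [tw]
    · simp only [tw, Prod.fst_zero, hz, h3, Prod.snd_zero]
      field_simp; ring
  rw [e0]
  have := fpos 0 (Ec 0 zero_mem)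
  field_simp

set_option maxHeartbeats 4000000 in
theorem analytic_line (hn : 1 ≤ n) {e : ℝ} (he : n * e = n + 2) {v : Heis n → ℝ}
    (hv : ContDiff ℝ (⊤ : ℕ∞) v) (hpos : ∀ q, 0 < v q) (heq : ∀ q, -subLap v q = v q ^ e)
    (a : Heis n) (ha : 0 < nsq a.1) : AnalyticAt ℝ (fun t : ℝ => fT a v (0, t)) 0 := by
  classical
  have hn0 : (0:ℝ) < n := by exact_mod_cast hn
  have he0 : 0 < e := by
    by_contra h
    have : n * e ≤ 0 := mul_nonpos_of_nonneg_of_nonpos hn0.le (not_lt.1 h)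
    linarith
  set c := nsq a.1 / 4 with hcdef
  have hc : 0 < c := by positivity
  obtain ⟨h, hh, hhc, hhv⟩ := cutoff hv (1 / c) (by positivity)
  set H : Heis n → ℝ := fun q => -subLap h q with hH
  have hHc : Continuous H := (continuous_subLap hh).neg
  have hHs : HasCompactSupport H := (supp_subLap hhc).neg
  obtain ⟨B, hB⟩ := hHs.exists_bound_of_continuous hHc
  have hB0 : 0 ≤ B := (norm_nonneg _).trans (hB 0)
  obtain ⟨ρK, hρK, hKs⟩ := cs_NB hHs
  set K := NB n ρK with hKdef
  have hK : MeasurableSet K := meas_NB _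
  have hKf : volume K < ⊤ := vol_NB_lt _
  have hHK : ∀ q, q ∉ K → H q = 0 := fun q hq => by
    by_contra h0; exact hq (hKs q h0)
  set f := fT a h with hf
  set F := FT a H with hF
  have hfm : Measurable f := measurable_fT a hh.continuous.measurable
  have hFm : Measurable F := measurable_FT a hHc.measurable
  -- bounds on v
  have hcomp := isCompact_N (n := n) (1 / c)
  have hne : {p : Heis n | ‖wC p‖ ≤ 1 / c}.Nonempty := ⟨0, by
    show ‖wC (0 : Heis n)‖ ≤ 1 / c
    have : wC (0 : Heis n) = 0 := by simp [wC, nsq]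
    rw [this, norm_zero]; positivity⟩
  obtain ⟨p1, -, hp1⟩ := hcomp.exists_isMinOn hne hv.continuous.continuousOn
  obtain ⟨p2, -, hp2⟩ := hcomp.exists_isMaxOn hne hv.continuous.continuousOn
  set m := v p1
  set M := v p2
  have hm : 0 < m := hpos _
  have hM : 0 < M := hpos _
  -- geometry
  have geo : ∀ p : Heis n, nsq p.1 ≤ c → hmul a p ≠ 0 ∧ 0 < ‖wC (hmul a p)‖ ∧ ‖wC (Iv (hmul a p))‖ ≤ 1 / c := by
    intro p hp
    have h1 := nsq_half a.1 p.1 hp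
    have h2 : c ≤ ‖wC (hmul a p)‖ := h1.trans (nsq_le_N (hmul a p))
    have h3 : hmul a p ≠ 0 := by
      intro h0
      rw [h0] at h2
      have : wC (0 : Heis n) = 0 := by simp [wC, nsq]
      rw [this, norm_zero] at h2
      linarith
    refine ⟨h3, by linarith, ?_⟩
    rw [norm_Iv _ h3]
    exact one_div_le_one_div_of_le hc h2
  have fv : ∀ p : Heis n, nsq p.1 ≤ c → f p = fT a v p := by
    intro p hp
    rw [hf, fT, fT, (hhv _ (geo p hp).2.2).1]
  have flow : ∀ p : Heis n, nsq p.1 ≤ c → (1 / ‖wC (hmul a p)‖) ^ n * m ≤ f p ∧ f p ≤ (1 / ‖wC (hmul a p)‖) ^ n * M := by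
    intro p hp
    obtain ⟨-, g1, g2⟩ := geo p hp
    rw [fv p hp, fT]
    have b1 : m ≤ v (Iv (hmul a p)) := hp1 g2
    have b2 : v (Iv (hmul a p)) ≤ M := hp2 g2
    constructor <;> gcongr
  have fpos : ∀ p : Heis n, nsq p.1 ≤ c → 0 < f p := fun p hp => by
    have g1 := (geo p hp).2.1
    exact lt_of_lt_of_le (by positivity) (flow p hp).1
  have hFf : ∀ p : Heis n, nsq p.1 ≤ c → F p = f p ^ e := by
    intro p hp
    obtain ⟨-, g1, g2⟩ := geo p hp
    rw [fv p hp, fT, rpow_id hn he (by positivity) (hpos _).le, ← heq, hF, FT, hH]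
    simp only [(hhv _ g2).2]
  have hrep : ∀ ζ : Heis n, nsq ζ.1 ≤ c → c0 n * f ζ = ∫ η, Gam ζ η * F η := fun ζ hζ =>
    rep_fT hn hh hhc a ζ (geo ζ hζ).1
  have hc0 := c0_pos hn
  set H0 : Heis n → Heis n → ℝ := fun ζ η => Gam ζ η * F η / (c0 n * f ζ) with hH0
  have hH0m : Measurable (Function.uncurry H0) :=
    (measurable_Gam.mul (hFm.comp measurable_snd)).div (measurable_const.mul (hfm.comp measurable_fst))
  set A := B / (c0 n * m) with hA
  have hA0 : 0 ≤ A := by positivity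
  have hlint : ∀ ζ : Heis n, nsq ζ.1 ≤ c → ∀ S : Set (Heis n), MeasurableSet S → ∀ ρ : ℝ, 0 < ρ →
      ∫⁻ η in S, ENNReal.ofReal |H0 ζ η| ≤ ENNReal.ofReal A * (ENNReal.ofReal ρ * M1 n +
        ENNReal.ofReal ((1/ρ) ^ n) * volume (K ∩ {q | hmul (hinv a) (Iv q) ∈ S})) := by
    intro ζ hζ S hS ρ hρ
    obtain ⟨g0, g1, g2⟩ := geo ζ hζ
    have hfζ := fpos ζ hζ
    have e1 : ∀ η, ENNReal.ofReal |H0 ζ η| = ENNReal.ofReal (1 / (c0 n * f ζ)) * ENNReal.ofReal (Gam ζ η * |F η|) := by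
      intro η
      rw [← ENNReal.ofReal_mul (by positivity), hH0]
      simp only
      rw [abs_div, abs_mul, abs_of_nonneg (Gam_nonneg _ _), abs_of_pos (by positivity : 0 < c0 n * f ζ)]
      congr 1; ring
    simp only [e1]
    rw [lintegral_const_mul' _ _ ENNReal.ofReal_ne_top]
    refine (mul_le_mul_right (lint_FT hB0 hK hB hHK a ζ g0 S hS hρ) _).trans ?_
    rw [← mul_assoc, ← ENNReal.ofReal_mul (by positivity)]
    refine mul_le_mul_left (ENNReal.ofReal_le_ofReal ?_) _
    rw [hA, div_mul_eq_mul_div, one_mul, div_le_div_iff₀ (by positivity) (by positivity)]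
    have := (flow ζ hζ).1
    calc _ = B * c0 n * ((1 / ‖wC (hmul a ζ)‖) ^ n * m) := by ring
      _ ≤ B * c0 n * f ζ := mul_le_mul_of_nonneg_left this (by positivity)
      _ = _ := by ring
  have hfin := line_main hn he0 a ha hcdef hc hfm hFm hm hM (fun p hp => (geo p hp).2.1) flow fpos hFf hrep hH0 hH0m
    hK hKf hlint
  refine hfin.congr (Eventually.of_forall fun t => ?_)
  exact fv (0, t) (by simpa [nsq] using hc.le)
end

section
variable {n : ℕ}

theorem small_N {P : Heis n → Prop} (h : ∀ᶠ q in 𝓝 (0 : Heis n), P q) :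
    ∃ ε > 0, ∀ q : Heis n, ‖wC q‖ < ε → P q := by
  obtain ⟨s, hs, hP⟩ := Metric.eventually_nhds_iff.1 h
  refine ⟨min s (s ^ 2), by positivity, fun q hq => hP ?_⟩
  rw [dist_zero_right, Prod.norm_def, max_lt_iff]
  constructor
  · rw [pi_norm_lt_iff hs]
    intro j
    have h1 : normSq (q.1 j) ≤ nsq q.1 :=
      Finset.single_le_sum (f := fun j => normSq (q.1 j)) (fun _ _ => normSq_nonneg _) (Finset.mem_univ j)
    have h2 := nsq_le_N q
    have h3 : ‖wC q‖ < s ^ 2 := hq.trans_le (min_le_right _ _)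
    rw [normSq_eq_norm_sq] at h1
    exact lt_of_pow_lt_pow_left₀ 2 hs.le (by linarith)
  · rw [Real.norm_eq_abs]
    exact (abs_snd_le_N q).trans_lt (hq.trans_le (min_le_left _ _))

theorem fst_ne {z : Fin n → ℂ} (hz : z ≠ 0) (t : ℝ) : ((z, t) : Heis n) ≠ 0 := fun h => hz (congrArg Prod.fst h)

theorem line_analytic (hn : 1 ≤ n) {e : ℝ} (he : n * e = n + 2) {v : Heis n → ℝ}
    (hv : ContDiff ℝ (⊤ : ℕ∞) v) (hpos : ∀ q, 0 < v q) (heq : ∀ q, -subLap v q = v q ^ e)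
    (z : Fin n → ℂ) (hz : z ≠ 0) :
    AnalyticOnNhd ℝ (fun t : ℝ => (1 / ‖wC ((z, t) : Heis n)‖) ^ n * v (Iv (z, t))) Set.univ := by
  intro t0 _
  have hp : 0 < nsq z := lt_of_le_of_ne (nsq_nonneg z) fun h => hz (nsq_eq_zero.1 h.symm)
  have h := analytic_line hn he hv hpos heq ((z, t0) : Heis n) hp
  have hs : AnalyticAt ℝ (fun t : ℝ => t - t0) t0 := analyticAt_id.sub analyticAt_const
  have h2 : AnalyticAt ℝ (fun t : ℝ => fT ((z, t0) : Heis n) v (0, t - t0)) t0 :=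
    AnalyticAt.fun_comp (g := fun t : ℝ => fT ((z, t0) : Heis n) v (0, t)) (by simpa using h) hs
  refine h2.congr (Eventually.of_forall fun t => ?_)
  have : hmul ((z, t0) : Heis n) (0, t - t0) = (z, t) := by
    simp [hmul, hermInner]
  simp only [fT, this]

theorem line_eq (hn : 1 ≤ n) {e : ℝ} (he : n * e = n + 2) {v₁ v₂ : Heis n → ℝ}
    (h1 : ContDiff ℝ (⊤ : ℕ∞) v₁) (h2 : ContDiff ℝ (⊤ : ℕ∞) v₂)
    (p1 : ∀ q, 0 < v₁ q) (p2 : ∀ q, 0 < v₂ q)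
    (e1 : ∀ q, -subLap v₁ q = v₁ q ^ e) (e2 : ∀ q, -subLap v₂ q = v₂ q ^ e)
    (hev : v₁ =ᶠ[𝓝 0] v₂) (z : Fin n → ℂ) (hz : z ≠ 0) (t : ℝ) : v₁ (Iv (z, t)) = v₂ (Iv (z, t)) := by
  obtain ⟨ε, hε, hs⟩ := small_N hev
  have a1 := line_analytic hn he h1 p1 e1 z hz
  have a2 := line_analytic hn he h2 p2 e2 z hz
  have key := a1.eq_of_eventuallyEq a2 (z₀ := 1 / ε + 1) (by
    have : ∀ᶠ s : ℝ in 𝓝 (1 / ε + 1), 1 / ε < s := eventually_gt_nhds (by linarith)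
    filter_upwards [this] with s hs1
    have hsp : 0 < s := lt_trans (by positivity) hs1
    have hne := fst_ne hz s
    have hN : s ≤ ‖wC ((z, s) : Heis n)‖ := (le_abs_self s).trans (abs_snd_le_N ((z, s) : Heis n))
    have : ‖wC (Iv ((z, s) : Heis n))‖ < ε := by
      rw [norm_Iv _ hne]
      calc 1 / ‖wC ((z, s) : Heis n)‖ ≤ 1 / s := one_div_le_one_div_of_le hsp hN
        _ < ε := by rwa [one_div_lt hsp hε]
    rw [hs _ this])
  have h := congrFun key t
  have hN := norm_wC_pos (fst_ne hz t)
  exact mul_left_cancel₀ (by positivity) h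

theorem uc_main (hn : 1 ≤ n) {e : ℝ} (he : n * e = n + 2) : UCprop n (fun a => a ^ e) := by
  intro v₁ v₂ h1 h2 p1 p2 e1 e2 hev
  have hoff : ∀ p : Heis n, p.1 ≠ 0 → v₁ p = v₂ p := by
    intro p hp
    have hp0 : p ≠ 0 := fun h => hp (by rw [h]; rfl)
    have hI : (Iv p).1 ≠ 0 := by
      intro h
      apply hp
      funext k
      have hk := congrFun h k
      have hw : (starRingEnd ℂ) (wC p) ≠ 0 := (map_ne_zero _).2 (wC_ne hp0)
      simpa [Iv, inv0, hw] using hk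
    have := line_eq hn he h1 h2 p1 p2 e1 e2 hev (Iv p).1 hI (Iv p).2
    rwa [Prod.mk.eta, Iv_Iv hp0] at this
  funext p
  by_cases hp : p.1 = 0
  · have c1 : Continuous fun x : ℝ => v₁ ((fun _ => (x : ℂ)), p.2) := h1.continuous.comp (by fun_prop)
    have c2 : Continuous fun x : ℝ => v₂ ((fun _ => (x : ℂ)), p.2) := h2.continuous.comp (by fun_prop)
    have := c1.ext_on (dense_compl_singleton (0:ℝ)) c2 (fun x hx => hoff _ (fun h => hx (by
      have := congrFun h ⟨0, hn⟩
      simpa using this)))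
    have h0 := congrFun this 0
    have hpe : ((fun _ => ((0:ℝ) : ℂ)), p.2) = p := Prod.ext (by rw [hp]; funext; simp) rfl
    simpa only [hpe] using h0
  · exact hoff p hp

theorem uc_final (hn : 1 ≤ n) (Q : ℝ) (hQ : Q = 2 * n + 2) : UCprop n (fun a => a ^ ((Q + 2) / (Q - 2))) := by
  apply uc_main hn
  have hn0 : (0:ℝ) < n := by exact_mod_cast hn
  rw [hQ]
  have h1 : (2 * (n:ℝ) + 2 - 2) = 2 * n := by ring
  rw [h1]
  field_simp
  ring
end

/-- if the moving-spheres procedure stops at a finite critical radius,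
then u coincides with its generalized Kelvin transform. -/
theorem moving_spheres_stop (n : ℕ) (hn : 1 ≤ n) (Q : ℝ) (hQ : Q = 2 * n + 2)
    (u : Heis n → ℝ) (hsmooth : ContDiff ℝ (⊤ : ℕ∞) u) (hpos : ∀ q, 0 < u q)
    (heq : ∀ q, -subLap u q = u q ^ ((Q + 2) / (Q - 2)))
    (β : ℝ) (ξ₀ : Heis n)
    (hne : ({μ : ℝ | 0 < μ ∧ ∀ lam ∈ Set.Ioo 0 μ,
      ∀ ζ ∈ ball ξ₀ lam \ {ξ₀}, u ζ ≤ kelvin u ξ₀ lam β ζ} : Set ℝ).Nonempty)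
    (hbdd : BddAbove {μ : ℝ | 0 < μ ∧ ∀ lam ∈ Set.Ioo 0 μ,
      ∀ ζ ∈ ball ξ₀ lam \ {ξ₀}, u ζ ≤ kelvin u ξ₀ lam β ζ}) :
    ∀ ζ : Heis n, ζ ≠ ξ₀ →
      kelvin u ξ₀ (sSup {μ : ℝ | 0 < μ ∧ ∀ lam ∈ Set.Ioo 0 μ,
        ∀ ζ' ∈ ball ξ₀ lam \ {ξ₀}, u ζ' ≤ kelvin u ξ₀ lam β ζ'}) β ζ = u ζ := by
  exact assembly hn Q hQ (uc_final hn Q hQ) u hsmooth hpos heq β ξ₀ hne hbdd
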